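/- There exist constants C₀ such that for every C > C₀ there are c > 0 and x₀ with the following property: for every x > x₀, the number of even integers m in the interval [x, x + (log x)^C] that can be written as the difference of two primes is at least c·(log x)^C. -/

import Mathlib

/-- A natural number `m` is a Maillet number if it is the difference of two primes. -/
def IsMaillet (m : ℕ) : Prop :=
  ∃ p q : ℕ, p.Prime ∧ q.Prime ∧ (m : ℤ) = (p : ℤ) - (q : ℤ)

/-- Every `k`-element set of multiples of `k!` has two elements differing by a Maillet number. -/
def TupleProperty (k : ℕ) : Prop :=
  ∀ h : Fin k → ℕ, StrictMono h → (∀ i, k.factorial ∣ h i) →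
    ∃ i j, i < j ∧ ∃ p q : ℕ, p.Prime ∧ q.Prime ∧ p + h i = q + h j

theorem TupleProperty.exists_bounded_gap {k : ℕ} (hk : 2 ≤ k) (hT : TupleProperty k) :
    ∃ L : ℕ, ∀ y : ℕ, ∃ m, y ≤ m ∧ m ≤ y + L ∧ Even m ∧ IsMaillet m := by
  by_contra! hgap
  have key : ∀ n : ℕ, ∃ S : Finset ℕ, S.card = n ∧ (∀ a ∈ S, k.factorial ∣ a) ∧
      ∀ a ∈ S, ∀ b ∈ S, a < b → ¬ IsMaillet (b - a) := by
    intro n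
    induction n with
    | zero => exact ⟨∅, by simp⟩
    | succ n ih =>
      obtain ⟨S, hcard, hdvd, hS⟩ := ih
      set B := S.sup id with hB
      have hle : ∀ a ∈ S, a ≤ B := fun a ha => Finset.le_sup (f := id) ha
      obtain ⟨y, hy⟩ := hgap (B + k.factorial)
      have hpos := k.factorial_pos
      set b := k.factorial * ((y + B) / k.factorial + 1) with hb
      have hb1 : y + B < b := Nat.lt_mul_div_succ _ hpos
      have hb2 : b ≤ y + B + k.factorial := by
        rw [hb, mul_add, mul_one]
        exact Nat.add_le_add_right (Nat.mul_div_le _ _) _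
      have heven : 2 ∣ k.factorial := Nat.dvd_factorial two_pos hk
      refine ⟨insert b S, ?_, ?_, ?_⟩
      · rw [Finset.card_insert_of_notMem, hcard]
        intro hbS
        have := hle b hbS
        omega
      · intro a ha
        rcases Finset.mem_insert.1 ha with rfl | ha
        · exact Dvd.intro _ rfl
        · exact hdvd a ha
      · intro a ha c hc hac
        rcases Finset.mem_insert.1 ha with rfl | ha
        · rcases Finset.mem_insert.1 hc with rfl | hc
          · omega
          · have := hle c hc
            omega
        · rcases Finset.mem_insert.1 hc with rfl | hc
          · have := hle a ha
            refine hy _ (by omega) (by omega) ?_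
            exact even_iff_two_dvd.2 (Nat.dvd_sub (heven.trans (Dvd.intro _ rfl))
              (heven.trans (hdvd a ha)))
          · exact hS a ha c hc hac
  obtain ⟨S, hcard, hdvd, hS⟩ := key k
  obtain ⟨i, j, hij, p, q, hp, hq, hpq⟩ := hT (S.orderEmbOfFin hcard)
    (S.orderEmbOfFin hcard).strictMono (fun i => hdvd _ (S.orderEmbOfFin_mem hcard i))
  have hlt : S.orderEmbOfFin hcard i < S.orderEmbOfFin hcard j :=
    (S.orderEmbOfFin hcard).strictMono hij
  refine hS _ (S.orderEmbOfFin_mem hcard i) _ (S.orderEmbOfFin_mem hcard j) hlt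
    ⟨p, q, hp, hq, ?_⟩
  omega

theorem ncard_even_maillet_ge {L : ℕ}
    (hL : ∀ y : ℕ, ∃ m, y ≤ m ∧ m ≤ y + L ∧ Even m ∧ IsMaillet m)
    {x H : ℝ} (hx : 0 < x) (hH : 2 * L + 4 ≤ H) :
    1 / (2 * (L + 1)) * H ≤
      ({m : ℕ | x ≤ (m : ℝ) ∧ (m : ℝ) ≤ x + H ∧ Even m ∧ IsMaillet m}.ncard : ℝ) := by
  choose f hf1 hf2 hf3 using hL
  set S := {m : ℕ | x ≤ (m : ℝ) ∧ (m : ℝ) ≤ x + H ∧ Even m ∧ IsMaillet m}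
  have hfin : S.Finite := by
    refine (Set.finite_Iic ⌊x + H⌋₊).subset fun m hm => ?_
    exact Nat.le_floor hm.2.1
  have hL0 : (0 : ℝ) < L + 1 := by positivity
  set t := ⌊(H - 1) / (L + 1)⌋₊
  have ht : (t : ℝ) * (L + 1) ≤ H - 1 := by
    rw [← le_div_iff₀ hL0]
    refine Nat.floor_le (div_nonneg ?_ hL0.le)
    linarith [(Nat.cast_nonneg L : (0 : ℝ) ≤ L)]
  have ht' : H - 1 < (t + 1) * (L + 1) := by
    rw [← div_lt_iff₀ hL0]
    exact Nat.lt_floor_add_one _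
  let g : ℕ → ℕ := fun j => f (⌈x⌉₊ + j * (L + 1))
  have hg : StrictMono g := strictMono_nat_of_lt_succ fun j => by
    have h1 := hf2 (⌈x⌉₊ + j * (L + 1))
    have h2 := hf1 (⌈x⌉₊ + (j + 1) * (L + 1))
    simp only [g]
    linarith
  have himg : (Finset.range t).image g ⊆ hfin.toFinset := by
    intro m hm
    obtain ⟨j, hj, rfl⟩ := Finset.mem_image.1 hm
    have hj : (j : ℝ) + 1 ≤ t := by exact_mod_cast Finset.mem_range.1 hj
    have h1 : ((⌈x⌉₊ + j * (L + 1) : ℕ) : ℝ) ≤ g j := by exact_mod_cast hf1 _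
    have h2 : (g j : ℝ) ≤ ((⌈x⌉₊ + j * (L + 1) + L : ℕ) : ℝ) := by exact_mod_cast hf2 _
    push_cast at h1 h2
    have h3 := Nat.le_ceil x
    have h4 := (Nat.ceil_lt_add_one hx.le).le
    rw [Set.Finite.mem_toFinset]
    refine ⟨?_, ?_, hf3 _⟩
    · have : (0 : ℝ) ≤ j * (L + 1) := by positivity
      linarith
    · nlinarith
  have hcard : t ≤ S.ncard := by
    rw [Set.ncard_eq_toFinset_card _ hfin]
    calc t = ((Finset.range t).image g).card := by
          rw [Finset.card_image_of_injective _ hg.injective, Finset.card_range]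
      _ ≤ _ := Finset.card_le_card himg
  refine le_trans ?_ (Nat.cast_le.2 hcard)
  rw [one_div, inv_mul_le_iff₀ (by positivity)]
  nlinarith

theorem TupleProperty.positive_proportion {k : ℕ} (hk : 2 ≤ k) (hT : TupleProperty k) :
    ∃ C₀ : ℝ, ∀ C : ℝ, C₀ < C →
      ∃ c : ℝ, 0 < c ∧ ∃ x₀ : ℝ, ∀ x : ℝ, x₀ < x →
        c * (Real.log x) ^ C ≤
          ({m : ℕ | x ≤ (m : ℝ) ∧ (m : ℝ) ≤ x + (Real.log x) ^ C ∧ Even m ∧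
            IsMaillet m}.ncard : ℝ) := by
  obtain ⟨L, hL⟩ := hT.exists_bounded_gap hk
  refine ⟨0, fun C hC => ⟨1 / (2 * (L + 1)), by positivity, ?_⟩⟩
  have h := (((tendsto_rpow_atTop hC).comp Real.tendsto_log_atTop).eventually_ge_atTop
    (2 * (L : ℝ) + 4)).and (Filter.eventually_gt_atTop 0)
  obtain ⟨x₀, hx₀⟩ := Filter.eventually_atTop.1 h
  exact ⟨x₀, fun x hx => ncard_even_maillet_ge hL (hx₀ x hx.le).2 (hx₀ x hx.le).1⟩

section

open Complex

namespace DirichletCharacter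

theorem sum_range_natCast_add {r : ℕ} [NeZero r] (f : ZMod r → ℂ) (a : ZMod r) :
    ∑ k ∈ Finset.range r, f (a + (k : ZMod r)) = ∑ z : ZMod r, f z := by
  rw [← Equiv.sum_comp (Equiv.addLeft a) f]
  refine Finset.sum_bij' (fun k _ => (k : ZMod r)) (fun z _ => z.val) ?_ ?_ ?_ ?_ ?_
  · simp
  · intro z _
    exact Finset.mem_range.2 z.val_lt
  · intro k hk
    exact ZMod.val_cast_of_lt (Finset.mem_range.1 hk)
  · simp
  · simp

theorem norm_sum_range_le {r : ℕ} [NeZero r] {χ : DirichletCharacter ℂ r} (hχ : χ ≠ 1) (n : ℕ) :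
    ∀ a : ZMod r, ‖∑ k ∈ Finset.range n, χ (a + (k : ZMod r))‖ ≤ r := by
  induction n using Nat.strong_induction_on with
  | _ n ih =>
    intro a
    rcases lt_or_ge n r with h | h
    · refine (norm_sum_le_of_le _ (fun k _ => χ.norm_le_one _)).trans ?_
      simpa using h.le
    · obtain ⟨m, rfl⟩ := Nat.exists_eq_add_of_le h
      rw [Finset.sum_range_add, sum_range_natCast_add (fun z => χ z),
        MulChar.sum_eq_zero_of_ne_one hχ, zero_add]
      have := ih m (Nat.lt_add_of_pos_left (Nat.pos_of_neZero r)) a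
      simpa using this

theorem norm_sum_Ico_le {r : ℕ} [NeZero r] {χ : DirichletCharacter ℂ r} (hχ : χ ≠ 1) (a b : ℕ) :
    ‖∑ k ∈ Finset.Ico a b, χ (k : ZMod r)‖ ≤ r := by
  rw [Finset.sum_Ico_eq_sum_range]
  simpa using norm_sum_range_le hχ (b - a) (a : ZMod r)

/-- The summatory function of a Dirichlet character. -/
noncomputable def summatory {r : ℕ} (χ : DirichletCharacter ℂ r) (t : ℝ) : ℂ :=
  ∑ k ∈ Finset.Icc 1 ⌊t⌋₊, χ (k : ZMod r)

theorem norm_summatory_le {r : ℕ} [NeZero r] {χ : DirichletCharacter ℂ r} (hχ : χ ≠ 1) (t : ℝ) :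
    ‖summatory χ t‖ ≤ r :=
  norm_sum_Ico_le hχ 1 (⌊t⌋₊ + 1)

theorem norm_summatory_le_self {r : ℕ} (χ : DirichletCharacter ℂ r) {t : ℝ} (ht : 0 ≤ t) :
    ‖summatory χ t‖ ≤ t := by
  refine (norm_sum_le_of_le _ (fun k _ => χ.norm_le_one _)).trans ?_
  simpa using Nat.floor_le ht

theorem summatory_eq_zero {r : ℕ} (χ : DirichletCharacter ℂ r) {t : ℝ} (ht : t < 1) :
    summatory χ t = 0 := by
  rw [summatory, Nat.floor_eq_zero.2 ht]
  simp

theorem measurable_summatory {r : ℕ} (χ : DirichletCharacter ℂ r) : Measurable (summatory χ) :=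
  (measurable_from_nat (f := fun n => ∑ k ∈ Finset.Icc 1 n, χ (k : ZMod r))).comp
    Nat.measurable_floor

theorem differentiableAt_mellin_summatory {r : ℕ} [NeZero r] {χ : DirichletCharacter ℂ r}
    (hχ : χ ≠ 1) {s : ℂ} (hs : 0 < s.re) : DifferentiableAt ℂ (mellin (summatory χ)) (-s) := by
  refine mellin_differentiableAt_of_isBigO_rpow (a := 0) (b := -s.re - 1) ?_ ?_ ?_ ?_ ?_
  · refine MeasureTheory.LocallyIntegrable.locallyIntegrableOn ?_ _
    refine (MeasureTheory.locallyIntegrable_const (r : ℝ)).mono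
      (measurable_summatory χ).aestronglyMeasurable (Filter.Eventually.of_forall fun t => ?_)
    simpa using norm_summatory_le hχ t
  · refine Asymptotics.IsBigO.of_bound r (Filter.Eventually.of_forall fun t => ?_)
    simpa using norm_summatory_le hχ t
  · simpa using hs
  · refine Asymptotics.IsBigO.of_bound 1 ?_
    filter_upwards [mem_nhdsWithin_of_mem_nhds (Iio_mem_nhds (zero_lt_one' ℝ))] with t ht
    rw [summatory_eq_zero χ ht]
    simp
  · simp

theorem mellin_summatory_eq {r : ℕ} (χ : DirichletCharacter ℂ r) (s : ℂ) :
    mellin (summatory χ) (-s) = ∫ t in Set.Ioi (1 : ℝ), summatory χ t * (t : ℂ) ^ (-(s + 1)) := by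
  rw [mellin, MeasureTheory.setIntegral_eq_of_subset_of_forall_sdiff_eq_zero measurableSet_Ioi
    (s := Set.Ici 1) (fun t ht => zero_lt_one.trans_le ht),
    MeasureTheory.integral_Ici_eq_integral_Ioi]
  · refine MeasureTheory.integral_congr_ae (Filter.Eventually.of_forall fun t => ?_)
    simp only [smul_eq_mul]
    rw [mul_comm]
    congr 2
    ring
  · intro t ht
    rw [summatory_eq_zero χ (not_le.1 ht.2), smul_zero]

theorem LFunction_eq_mul_mellin {r : ℕ} [NeZero r] {χ : DirichletCharacter ℂ r}
    (hχ : χ ≠ 1) {s : ℂ} (hs : 0 < s.re) :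
    LFunction χ s = s * mellin (summatory χ) (-s) := by
  have hU : IsOpen {s : ℂ | 0 < s.re} := isOpen_lt continuous_const continuous_re
  have hconv : Convex ℝ {s : ℂ | 0 < s.re} := convex_halfSpace_re_gt 0
  have h1 : AnalyticOnNhd ℂ (LFunction χ) {s : ℂ | 0 < s.re} :=
    (differentiable_LFunction hχ).differentiableOn.analyticOnNhd hU
  have h2 : AnalyticOnNhd ℂ (fun s => s * mellin (summatory χ) (-s)) {s : ℂ | 0 < s.re} := by
    refine DifferentiableOn.analyticOnNhd (fun z hz => ?_) hU
    refine DifferentiableAt.differentiableWithinAt ?_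
    exact differentiableAt_id.mul
      ((differentiableAt_mellin_summatory hχ hz).comp z differentiableAt_id.neg)
  refine h1.eqOn_of_preconnected_of_eventuallyEq h2 hconv.isPreconnected
    (show (2 : ℂ) ∈ _ by simp) ?_ hs
  · have hV : IsOpen {s : ℂ | 1 < s.re} := isOpen_lt continuous_const continuous_re
    filter_upwards [hV.mem_nhds (show (2 : ℂ) ∈ {s : ℂ | 1 < s.re} by simp)] with z hz
    rw [LFunction_eq_LSeries χ hz]
    rw [LSeries_eq_mul_integral (fun n => χ n) (r := 0) le_rfl (zero_lt_one.trans hz)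
      (LSeriesSummable_of_one_lt_re χ hz)
      (Asymptotics.IsBigO.of_bound r (Filter.Eventually.of_forall fun n => ?_))]
    · rw [mellin_summatory_eq]
      rfl
    · rw [Real.rpow_zero, norm_one, mul_one]
      exact norm_sum_Ico_le hχ 1 (n + 1)

theorem norm_LFunction_le {r : ℕ} [NeZero r] {χ : DirichletCharacter ℂ r} (hχ : χ ≠ 1)
    {δ : ℝ} (hδ : 0 < δ) (hδ' : δ ≤ 1 / 2) {s : ℂ} (hs : 1 - δ ≤ s.re) :
    ‖LFunction χ s‖ ≤ ‖s‖ * ((r : ℝ) ^ (2 * δ) / δ) := by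
  have hs0 : 0 < s.re := by linarith
  rw [LFunction_eq_mul_mellin hχ hs0, norm_mul, mellin_summatory_eq]
  refine mul_le_mul_of_nonneg_left ?_ (norm_nonneg _)
  have hintegral : ∫ t in Set.Ioi (1 : ℝ), (r : ℝ) ^ (2 * δ) * t ^ (-1 - δ) = (r : ℝ) ^ (2 * δ) / δ := by
    rw [MeasureTheory.integral_const_mul, integral_Ioi_rpow_of_lt (by linarith) zero_lt_one]
    simp only [Real.one_rpow]
    rw [div_eq_mul_inv]
    congr 1
    rw [show -1 - δ + 1 = -δ by ring, inv_neg, neg_one_mul, neg_neg]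
  rw [← hintegral]
  refine MeasureTheory.norm_integral_le_of_norm_le ?_ ?_
  · exact (integrableOn_Ioi_rpow_of_lt (by linarith) zero_lt_one).const_mul _
  · refine (MeasureTheory.ae_restrict_iff' measurableSet_Ioi).2
      (Filter.Eventually.of_forall fun t (ht : 1 < t) => ?_)
    have ht0 : 0 < t := zero_lt_one.trans ht
    rw [norm_mul, norm_cpow_eq_rpow_re_of_pos ht0]
    have h1 : ‖summatory χ t‖ ≤ (r : ℝ) ^ (2 * δ) * t ^ (1 - 2 * δ) := by
      have hr := norm_summatory_le hχ t
      have hr' := norm_summatory_le_self χ ht0.le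
      calc ‖summatory χ t‖
          = ‖summatory χ t‖ ^ (2 * δ) * ‖summatory χ t‖ ^ (1 - 2 * δ) := by
            rw [← Real.rpow_add' (norm_nonneg _) (by norm_num)]
            norm_num
        _ ≤ _ := by
            gcongr
            · linarith
    calc ‖summatory χ t‖ * t ^ (-(s + 1)).re
        ≤ ((r : ℝ) ^ (2 * δ) * t ^ (1 - 2 * δ)) * t ^ (-2 + δ) := by
          gcongr
          · exact ht.le
          · simp only [neg_re, add_re, one_re]
            linarith
      _ = _ := by
          rw [mul_assoc, ← Real.rpow_add ht0]
          congr 2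
          ring

theorem norm_deriv_LFunction_le {r : ℕ} [NeZero r] {χ : DirichletCharacter ℂ r} (hχ : χ ≠ 1)
    {δ : ℝ} (hδ : 0 < δ) (hδ' : δ ≤ 1 / 4) {s : ℂ} (hs : 1 - δ ≤ s.re) :
    ‖deriv (LFunction χ) s‖ ≤ (‖s‖ + 1) * ((r : ℝ) ^ (4 * δ) / (2 * δ)) / δ := by
  refine norm_deriv_le_of_forall_mem_sphere_norm_le hδ
    (differentiable_LFunction hχ).diffContOnCl fun z hz => ?_
  have hz' : ‖z - s‖ = δ := by simpa [dist_eq_norm] using hz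
  have h1 : 1 - 2 * δ ≤ z.re := by
    have := (abs_le.1 ((abs_re_le_norm (z - s)).trans hz'.le)).1
    rw [sub_re] at this
    linarith
  refine (norm_LFunction_le hχ (δ := 2 * δ) (by linarith) (by linarith) h1).trans ?_
  rw [show 2 * (2 * δ) = 4 * δ by ring]
  gcongr
  calc ‖z‖ = ‖s + (z - s)‖ := by ring_nf
    _ ≤ ‖s‖ + δ := hz' ▸ norm_add_le _ _
    _ ≤ ‖s‖ + 1 := by linarith

end DirichletCharacter

end

section

open Complex

theorem norm_sum_Ico_antitone_mul_le {f : ℕ → ℝ} {g : ℕ → ℂ} {a : ℕ} {Q : ℝ}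
    (hf : AntitoneOn f (Set.Ici a)) (hf0 : ∀ n, a ≤ n → 0 ≤ f n)
    (hg : ∀ b, ‖∑ k ∈ Finset.Ico a b, g k‖ ≤ Q) {b : ℕ} (hab : a ≤ b) :
    ‖∑ k ∈ Finset.Ico a b, (f k : ℂ) * g k‖ ≤ f a * Q := by
  have key : ∀ b, a ≤ b → ‖∑ k ∈ Finset.Ico a b, (f k : ℂ) * g k
      - (f b : ℂ) * ∑ k ∈ Finset.Ico a b, g k‖ ≤ (f a - f b) * Q := by
    intro b hab
    induction b, hab using Nat.le_induction with
    | base => simp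
    | succ b hab ih =>
      have h1 : f (b + 1) ≤ f b :=
        hf (Set.mem_Ici.2 hab) (Set.mem_Ici.2 (by omega)) (Nat.le_succ b)
      rw [Finset.sum_Ico_succ_top hab, Finset.sum_Ico_succ_top hab]
      have h2 : ‖((f b - f (b + 1) : ℝ) : ℂ) * ∑ k ∈ Finset.Ico a (b + 1), g k‖
          ≤ (f b - f (b + 1)) * Q := by
        rw [norm_mul, norm_real, Real.norm_of_nonneg (by linarith)]
        exact mul_le_mul_of_nonneg_left (hg _) (by linarith)
      rw [Finset.sum_Ico_succ_top hab] at h2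
      refine le_trans (le_of_eq ?_) ((norm_add_le_of_le ih h2).trans (le_of_eq (by ring)))
      congr 1
      push_cast
      ring
  have h1 := key b hab
  have h2 : ‖(f b : ℂ) * ∑ k ∈ Finset.Ico a b, g k‖ ≤ f b * Q := by
    rw [norm_mul, norm_real, Real.norm_of_nonneg (hf0 b hab)]
    exact mul_le_mul_of_nonneg_left (hg _) (hf0 b hab)
  have h3 := norm_add_le_of_le h1 h2
  rw [sub_add_cancel] at h3
  linarith

theorem sum_norm_sum_mul_sq_le {ι : Type*} (s : Finset ι) (N : Finset ℕ) (a : ℕ → ℂ)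
    (e : ι → ℕ → ℂ) {B : ℝ} (hB0 : 0 ≤ B)
    (hB : ∀ i ∈ s, ∑ j ∈ s, ‖∑ n ∈ N, e i n * (starRingEnd ℂ) (e j n)‖ ≤ B) :
    ∑ i ∈ s, ‖∑ n ∈ N, a n * e i n‖ ^ 2 ≤ B * ∑ n ∈ N, ‖a n‖ ^ 2 := by
  set S : ι → ℂ := fun i => ∑ n ∈ N, a n * e i n with hS
  set T : ℕ → ℂ := fun n => ∑ i ∈ s, (starRingEnd ℂ) (S i) * e i n with hT
  set X : ℝ := ∑ i ∈ s, ‖S i‖ ^ 2 with hX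
  have hX0 : 0 ≤ X := Finset.sum_nonneg fun i _ => by positivity
  have h1 : (X : ℂ) = ∑ n ∈ N, a n * T n := by
    simp only [hX, hT, Finset.mul_sum, ofReal_sum]
    rw [Finset.sum_comm]
    refine Finset.sum_congr rfl fun i _ => ?_
    rw [ofReal_pow, ← Complex.conj_mul']
    conv_lhs => rw [hS, Finset.mul_sum]
    exact Finset.sum_congr rfl fun n _ => by ring
  have h2 : X ^ 2 ≤ (∑ n ∈ N, ‖a n‖ ^ 2) * ∑ n ∈ N, ‖T n‖ ^ 2 := by
    have h3 : X ≤ ∑ n ∈ N, ‖a n‖ * ‖T n‖ := by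
      calc X = ‖(X : ℂ)‖ := by rw [norm_real, Real.norm_of_nonneg hX0]
        _ ≤ _ := by
          rw [h1]
          exact norm_sum_le_of_le _ fun n _ => (norm_mul _ _).le
    exact (pow_le_pow_left₀ hX0 h3 2).trans (Finset.sum_mul_sq_le_sq_mul_sq _ _ _)
  have h4 : ∑ n ∈ N, ‖T n‖ ^ 2 ≤ B * X := by
    have h5 : ((∑ n ∈ N, ‖T n‖ ^ 2 : ℝ) : ℂ) = ∑ i ∈ s, ∑ j ∈ s,
        (starRingEnd ℂ) (S i) * S j * ∑ n ∈ N, e i n * (starRingEnd ℂ) (e j n) := by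
      have h10 : ∀ n, ((‖T n‖ : ℂ)) ^ 2 = ∑ i ∈ s, ∑ j ∈ s,
          (starRingEnd ℂ) (S i) * S j * (e i n * (starRingEnd ℂ) (e j n)) := by
        intro n
        rw [← Complex.mul_conj', hT]
        simp only [map_sum, map_mul, conj_conj]
        rw [Finset.sum_mul_sum]
        exact Finset.sum_congr rfl fun i _ => Finset.sum_congr rfl fun j _ => by ring
      simp only [ofReal_sum, ofReal_pow, h10, Finset.mul_sum]
      rw [Finset.sum_comm]
      exact Finset.sum_congr rfl fun i _ => Finset.sum_comm
    have h6 : ∑ n ∈ N, ‖T n‖ ^ 2 ≤ ∑ i ∈ s, ∑ j ∈ s,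
        ‖S i‖ * ‖S j‖ * ‖∑ n ∈ N, e i n * (starRingEnd ℂ) (e j n)‖ := by
      calc ∑ n ∈ N, ‖T n‖ ^ 2 = ‖((∑ n ∈ N, ‖T n‖ ^ 2 : ℝ) : ℂ)‖ := by
            rw [norm_real, Real.norm_of_nonneg (Finset.sum_nonneg fun i _ => by positivity)]
        _ ≤ _ := by
          rw [h5]
          refine norm_sum_le_of_le _ fun i _ => norm_sum_le_of_le _ fun j _ => ?_
          rw [norm_mul, norm_mul, RCLike.norm_conj]
    have hsymm : ∀ i j, ‖∑ n ∈ N, e j n * (starRingEnd ℂ) (e i n)‖ =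
        ‖∑ n ∈ N, e i n * (starRingEnd ℂ) (e j n)‖ := by
      intro i j
      rw [← RCLike.norm_conj, map_sum]
      simp [mul_comm]
    have h7 : ∑ i ∈ s, ∑ j ∈ s, ‖S i‖ ^ 2 * ‖∑ n ∈ N, e i n * (starRingEnd ℂ) (e j n)‖
        ≤ B * X := by
      rw [hX, Finset.mul_sum]
      refine Finset.sum_le_sum fun i hi => ?_
      rw [← Finset.mul_sum, mul_comm B]
      exact mul_le_mul_of_nonneg_left (hB i hi) (by positivity)
    have h8 : ∑ i ∈ s, ∑ j ∈ s, ‖S j‖ ^ 2 * ‖∑ n ∈ N, e i n * (starRingEnd ℂ) (e j n)‖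
        ≤ B * X := by
      rw [Finset.sum_comm]
      simpa only [hsymm] using h7
    have h9 : ∑ i ∈ s, ∑ j ∈ s, ‖S i‖ * ‖S j‖ * ‖∑ n ∈ N, e i n * (starRingEnd ℂ) (e j n)‖
        ≤ (∑ i ∈ s, ∑ j ∈ s, ‖S i‖ ^ 2 * ‖∑ n ∈ N, e i n * (starRingEnd ℂ) (e j n)‖ +
          ∑ i ∈ s, ∑ j ∈ s, ‖S j‖ ^ 2 * ‖∑ n ∈ N, e i n * (starRingEnd ℂ) (e j n)‖) / 2 := by
      rw [← Finset.sum_add_distrib, Finset.sum_div]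
      refine Finset.sum_le_sum fun i _ => ?_
      rw [← Finset.sum_add_distrib, Finset.sum_div]
      refine Finset.sum_le_sum fun j _ => ?_
      nlinarith [mul_nonneg (sq_nonneg (‖S i‖ - ‖S j‖))
        (norm_nonneg (∑ n ∈ N, e i n * (starRingEnd ℂ) (e j n)))]
    linarith
  have hA0 : 0 ≤ ∑ n ∈ N, ‖a n‖ ^ 2 := Finset.sum_nonneg fun i _ => by positivity
  rcases hX0.eq_or_lt with h | h
  · rw [← h]
    exact mul_nonneg hB0 hA0
  · have : X * X ≤ (B * ∑ n ∈ N, ‖a n‖ ^ 2) * X := by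
      nlinarith [mul_le_mul_of_nonneg_left h4 hA0]
    exact le_of_mul_le_mul_right this h

theorem sum_norm_weighted_sum_sq_le {ι : Type*} [DecidableEq ι] (s : Finset ι) (c : ι → ℕ → ℂ)
    (hc : ∀ i n, ‖c i n‖ ≤ 1) {Q : ℝ} (hQ0 : 0 ≤ Q)
    (hQ : ∀ i ∈ s, ∀ j ∈ s, i ≠ j → ∀ a b,
      ‖∑ n ∈ Finset.Ico a b, c i n * (starRingEnd ℂ) (c j n)‖ ≤ Q)
    {w : ℕ → ℝ} {y : ℕ} (hw : AntitoneOn w (Set.Ici y)) (hw0 : ∀ n, y ≤ n → 0 ≤ w n)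
    (b : ℕ → ℂ) {z : ℕ} (hyz : y ≤ z) :
    ∑ i ∈ s, ‖∑ n ∈ Finset.Ico y z, b n * (w n : ℂ) * c i n‖ ^ 2 ≤
      (∑ n ∈ Finset.Ico y z, w n + s.card * (w y * Q)) *
        ∑ n ∈ Finset.Ico y z, ‖b n‖ ^ 2 * w n := by
  have h := sum_norm_sum_mul_sq_le s (Finset.Ico y z) (fun n => b n * (√(w n) : ℂ))
    (fun i n => (√(w n) : ℂ) * c i n) (B := ∑ n ∈ Finset.Ico y z, w n + s.card * (w y * Q))
    (add_nonneg (Finset.sum_nonneg fun n hn => hw0 n (Finset.mem_Ico.1 hn).1)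
      (mul_nonneg (Nat.cast_nonneg _) (mul_nonneg (hw0 y le_rfl) hQ0))) ?_
  · refine le_trans (le_of_eq ?_) (h.trans (le_of_eq ?_))
    · refine Finset.sum_congr rfl fun i _ => ?_
      congr 2
      refine Finset.sum_congr rfl fun n hn => ?_
      have h1 : ((√(w n) : ℝ) : ℂ) * (√(w n) : ℝ) = (w n : ℂ) := by
        rw [← ofReal_mul, Real.mul_self_sqrt (hw0 n (Finset.mem_Ico.1 hn).1)]
      rw [← h1]
      ring
    · congr 1
      refine Finset.sum_congr rfl fun n hn => ?_
      rw [norm_mul, norm_real, mul_pow, Real.norm_of_nonneg (Real.sqrt_nonneg _),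
        Real.sq_sqrt (hw0 n (Finset.mem_Ico.1 hn).1)]
  · intro i hi
    have hij : ∀ j, ∑ n ∈ Finset.Ico y z, (√(w n) : ℂ) * c i n *
        (starRingEnd ℂ) ((√(w n) : ℂ) * c j n) =
        ∑ n ∈ Finset.Ico y z, (w n : ℂ) * (c i n * (starRingEnd ℂ) (c j n)) := by
      intro j
      refine Finset.sum_congr rfl fun n hn => ?_
      have h1 : ((√(w n) : ℝ) : ℂ) * (√(w n) : ℝ) = (w n : ℂ) := by
        rw [← ofReal_mul, Real.mul_self_sqrt (hw0 n (Finset.mem_Ico.1 hn).1)]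
      rw [map_mul, conj_ofReal, ← h1]
      ring
    simp only [hij]
    rw [← Finset.add_sum_erase _ _ hi]
    have hQj : ∀ j ∈ s.erase i, ‖∑ n ∈ Finset.Ico y z,
        (w n : ℂ) * (c i n * (starRingEnd ℂ) (c j n))‖ ≤ w y * Q := fun j hj =>
      norm_sum_Ico_antitone_mul_le hw hw0 (fun b => hQ i hi j (Finset.mem_of_mem_erase hj)
        (Finset.ne_of_mem_erase hj).symm y b) hyz
    refine add_le_add ?_ ?_
    · refine norm_sum_le_of_le _ fun n hn => ?_
      rw [norm_mul, norm_real, Real.norm_of_nonneg (hw0 n (Finset.mem_Ico.1 hn).1), norm_mul,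
        RCLike.norm_conj]
      exact mul_le_of_le_one_right (hw0 n (Finset.mem_Ico.1 hn).1)
        (mul_le_one₀ (hc _ _) (norm_nonneg _) (hc _ _))
    · refine (Finset.sum_le_sum hQj).trans ?_
      rw [Finset.sum_const, nsmul_eq_mul]
      refine mul_le_mul_of_nonneg_right ?_ (mul_nonneg (hw0 y le_rfl) hQ0)
      exact_mod_cast Finset.card_le_card (Finset.erase_subset _ _)

end

section

open Complex

theorem tsum_rpow_neg_le {σ : ℝ} (hσ : 1 < σ) : ∑' n : ℕ, (n : ℝ) ^ (-σ) ≤ σ / (σ - 1) := by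
  have hsum : Summable fun n : ℕ => (n : ℝ) ^ (-σ) := Real.summable_nat_rpow.2 (by linarith)
  have h := ZetaAsymptotics.zeta_limit_aux1 hσ
  have h0 : 0 ≤ ZetaAsymptotics.termTSum σ :=
    tsum_nonneg fun n => ZetaAsymptotics.term_nonneg (n + 1) σ
  rw [hsum.tsum_eq_zero_add]
  have h1 : ∀ n : ℕ, ((n + 1 : ℕ) : ℝ) ^ (-σ) = 1 / (n + 1 : ℝ) ^ σ := fun n => by
    rw [Real.rpow_neg (by positivity), one_div]
    push_cast
    rfl
  simp only [h1, Nat.cast_zero]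
  rw [Real.zero_rpow (by linarith)]
  have h2 : σ / (σ - 1) = 1 + 1 / (σ - 1) := by
    field_simp [sub_ne_zero.2 hσ.ne']
    ring
  have : 0 ≤ σ * ZetaAsymptotics.termTSum σ := by positivity
  rw [h2]
  linarith

open ArithmeticFunction in
theorem card_divisors_sq_le (n : ℕ) :
    n.divisors.card ^ 2 ≤ ((zeta * zeta) * (zeta * zeta) : ArithmeticFunction ℕ) n := by
  have hd : ∀ m : ℕ, (zeta * zeta : ArithmeticFunction ℕ) m = m.divisors.card := fun m => by
    rw [mul_zeta_apply, Finset.sum_congr rfl (g := fun _ => 1), Finset.sum_const, smul_eq_mul,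
      mul_one]
    intro i hi
    exact zeta_apply_ne (Nat.pos_of_mem_divisors hi).ne'
  rw [ArithmeticFunction.mul_apply (f := zeta * zeta) (g := zeta * zeta)]
  rw [sq]
  have h1 : n.divisors.card ≤ n.divisorsAntidiagonal.card := by
    rw [← Nat.image_fst_divisorsAntidiagonal]
    exact Finset.card_image_le
  calc n.divisors.card * n.divisors.card ≤ ∑ p ∈ n.divisorsAntidiagonal, n.divisors.card := by
        rw [Finset.sum_const, smul_eq_mul]
        exact Nat.mul_le_mul_right _ h1
    _ ≤ _ := by
        refine Finset.sum_le_sum fun p hp => ?_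
        rw [hd, hd, ← (Nat.mem_divisorsAntidiagonal.1 hp).1, Nat.divisors_mul]
        exact Finset.card_mul_le

open ArithmeticFunction in
theorem summable_card_divisors_sq {σ : ℝ} (hσ : 1 < σ) :
    Summable (fun n : ℕ => (n.divisors.card : ℝ) ^ 2 * (n : ℝ) ^ (-σ)) ∧
    ∑' n : ℕ, (n.divisors.card : ℝ) ^ 2 * (n : ℝ) ^ (-σ) ≤ (σ / (σ - 1)) ^ 4 := by
  have hσ' : 1 < (σ : ℂ).re := by simpa
  set ζ₁ : ArithmeticFunction ℂ := ((zeta : ArithmeticFunction ℕ) : ArithmeticFunction ℂ) with hζ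
  have hs1 : LSeriesSummable (fun n => ζ₁ n) σ := by
    simpa [hζ] using LSeriesSummable_zeta_iff.2 hσ'
  have hs2 := LSeriesSummable_mul hs1 hs1
  have hs4 := LSeriesSummable_mul hs2 hs2
  set D4 : ArithmeticFunction ℕ := (zeta * zeta) * (zeta * zeta) with hD4
  have hcast : (ζ₁ * ζ₁) * (ζ₁ * ζ₁) = (D4 : ArithmeticFunction ℂ) := by
    rw [hD4, natCoe_mul, natCoe_mul]
  have hterm : ∀ n, LSeries.term (fun n => ((ζ₁ * ζ₁) * (ζ₁ * ζ₁)) n) σ n =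
      ((D4 n * (n : ℝ) ^ (-σ) : ℝ) : ℂ) := fun n => by
    rw [hcast, LSeries.term]
    split_ifs with h
    · subst h; simp
    · rw [natCoe_apply, ofReal_mul, Real.rpow_neg (Nat.cast_nonneg n), ofReal_inv,
        ofReal_cpow (Nat.cast_nonneg n), div_eq_mul_inv]
      simp
  have hz : LSeries (fun n => ζ₁ n) σ = ((∑' n : ℕ, (n : ℝ) ^ (-σ) : ℝ) : ℂ) := by
    rw [ofReal_tsum]
    refine tsum_congr fun n => ?_
    rw [LSeries.term]
    split_ifs with h
    · subst h
      rw [Nat.cast_zero, Real.zero_rpow (by linarith), ofReal_zero]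
    · rw [hζ, natCoe_apply, zeta_apply_ne h, Real.rpow_neg (Nat.cast_nonneg n), ofReal_inv,
        ofReal_cpow (Nat.cast_nonneg n), Nat.cast_one, one_div]
      simp
  have habs : LSeries.abscissaOfAbsConv (fun n => ζ₁ n) < ((σ : ℂ).re : EReal) := by
    obtain ⟨τ, h1, h2⟩ := exists_between hσ
    have : LSeriesSummable (fun n => ζ₁ n) τ := by
      simpa [hζ] using LSeriesSummable_zeta_iff.2 (by simpa : 1 < (τ : ℂ).re)
    refine this.abscissaOfAbsConv_le.trans_lt ?_
    simpa using h2
  have habs2 : LSeries.abscissaOfAbsConv (fun n => (ζ₁ * ζ₁) n) < ((σ : ℂ).re : EReal) := by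
    obtain ⟨τ, h1, h2⟩ := exists_between hσ
    have : LSeriesSummable (fun n => ζ₁ n) τ := by
      simpa [hζ] using LSeriesSummable_zeta_iff.2 (by simpa : 1 < (τ : ℂ).re)
    refine (LSeriesSummable_mul this this).abscissaOfAbsConv_le.trans_lt ?_
    simpa using h2
  have hval : LSeries (fun n => ((ζ₁ * ζ₁) * (ζ₁ * ζ₁)) n) σ =
      (((∑' n : ℕ, (n : ℝ) ^ (-σ)) ^ 4 : ℝ) : ℂ) := by
    rw [LSeries_mul habs2 habs2, LSeries_mul habs habs, hz]
    push_cast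
    ring
  have hsumD : Summable fun n : ℕ => (D4 n * (n : ℝ) ^ (-σ) : ℝ) := by
    have := hs4
    rw [LSeriesSummable, funext hterm] at this
    exact Complex.summable_ofReal.1 this
  have htsumD : ∑' n : ℕ, (D4 n * (n : ℝ) ^ (-σ) : ℝ) = (∑' n : ℕ, (n : ℝ) ^ (-σ)) ^ 4 := by
    rw [LSeries, tsum_congr hterm, ← ofReal_tsum] at hval
    exact_mod_cast hval
  have hle : ∀ n : ℕ, (n.divisors.card : ℝ) ^ 2 * (n : ℝ) ^ (-σ) ≤ D4 n * (n : ℝ) ^ (-σ) := by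
    intro n
    refine mul_le_mul_of_nonneg_right ?_ (by positivity)
    exact_mod_cast card_divisors_sq_le n
  have hsum := Summable.of_nonneg_of_le (fun n => by positivity) hle hsumD
  refine ⟨hsum, (hsum.tsum_le_tsum hle hsumD).trans ?_⟩
  rw [htsumD]
  exact pow_le_pow_left₀ (tsum_nonneg fun n => by positivity) (tsum_rpow_neg_le hσ) 4

namespace DirichletCharacter

/-- For distinct pairs of primitive characters, `χ * conj χ'` is a nonprincipal character. -/
theorem exists_mul_conj_eq {p q : Σ r : ℕ, DirichletCharacter ℂ r} [NeZero p.1] [NeZero q.1]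
    (hp : p.2.IsPrimitive) (hq : q.2.IsPrimitive) (hpq : p ≠ q) :
    ∃ ψ : DirichletCharacter ℂ (p.1 * q.1), ψ ≠ 1 ∧
      ∀ n : ℕ, ψ n = p.2 n * (starRingEnd ℂ) (q.2 n) := by
  obtain ⟨r, χ⟩ := p
  obtain ⟨r', χ'⟩ := q
  dsimp only at *
  have : NeZero (r * r') := ⟨mul_ne_zero (NeZero.ne r) (NeZero.ne r')⟩
  refine ⟨changeLevel (dvd_mul_right r r') χ * (changeLevel (dvd_mul_left r' r) χ')⁻¹, ?_, ?_⟩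
  · intro h
    rw [mul_inv_eq_one] at h
    have hr : r = r' := by
      have h1 := congrArg conductor h
      rw [conductor_changeLevel, conductor_changeLevel] at h1
      exact hp.symm.trans (h1.trans hq)
    subst hr
    exact hpq (by rw [changeLevel_injective _ h])
  · intro n
    rw [MulChar.mul_apply, ← MulChar.star_eq_inv, MulChar.star_apply]
    by_cases hn : IsUnit (n : ZMod (r * r'))
    · obtain ⟨u, hu⟩ := hn
      rw [← hu, changeLevel_eq_cast_of_dvd, changeLevel_eq_cast_of_dvd, hu,
        ZMod.cast_natCast (dvd_mul_right r r'), ZMod.cast_natCast (dvd_mul_left r' r)]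
      rfl
    · rw [MulChar.map_nonunit _ hn, zero_mul]
      rw [ZMod.isUnit_iff_coprime, Nat.coprime_mul_iff_right, not_and_or,
        ← ZMod.isUnit_iff_coprime, ← ZMod.isUnit_iff_coprime] at hn
      rcases hn with hn | hn <;> rw [MulChar.map_nonunit _ hn] <;> simp

theorem finite_primitive (D : ℕ) :
    {p : Σ r : ℕ, DirichletCharacter ℂ r | (1 < p.1 ∧ p.1 ≤ D) ∧ p.2.IsPrimitive}.Finite := by
  refine Set.Finite.subset (Set.Finite.biUnion (Set.finite_Icc 1 D)
    (t := fun r => Set.range (Sigma.mk r : DirichletCharacter ℂ r → _)) fun r hr => ?_) ?_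
  · have : NeZero r := ⟨by have := hr.1; omega⟩
    exact Set.finite_range _
  · rintro ⟨r, χ⟩ h
    exact Set.mem_biUnion (show r ∈ Set.Icc 1 D from ⟨h.1.1.le, h.1.2⟩) ⟨χ, rfl⟩

/-- The primitive Dirichlet characters of conductor in `(1, D]`. -/
noncomputable def primitiveUpTo (D : ℕ) : Finset (Σ r : ℕ, DirichletCharacter ℂ r) :=
  (finite_primitive D).toFinset

theorem mem_primitiveUpTo {D : ℕ} {p : Σ r : ℕ, DirichletCharacter ℂ r} :
    p ∈ primitiveUpTo D ↔ (1 < p.1 ∧ p.1 ≤ D) ∧ p.2.IsPrimitive := by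
  simp [primitiveUpTo]

theorem ne_one_of_isPrimitive {r : ℕ} {χ : DirichletCharacter ℂ r} (hr : 1 < r)
    (hχ : χ.IsPrimitive) : χ ≠ 1 := by
  rintro rfl
  have : NeZero r := ⟨by omega⟩
  rw [isPrimitive_def, conductor_one] at hχ
  omega

theorem card_primitiveUpTo_le (D : ℕ) : (primitiveUpTo D).card ≤ D ^ 2 := by
  classical
  calc (primitiveUpTo D).card
      ≤ ∑ r ∈ Finset.Icc 1 D, ((primitiveUpTo D).filter fun p => p.1 = r).card := by
        refine (Finset.card_eq_sum_card_fiberwise fun p hp => ?_).le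
        have := (mem_primitiveUpTo.1 hp).1
        exact Finset.mem_coe.2 (Finset.mem_Icc.2 ⟨this.1.le, this.2⟩)
    _ ≤ ∑ r ∈ Finset.Icc 1 D, D := by
        refine Finset.sum_le_sum fun r hr => ?_
        obtain ⟨h1, h2⟩ := Finset.mem_Icc.1 hr
        have : NeZero r := ⟨by omega⟩
        have : Fintype (DirichletCharacter ℂ r) := Fintype.ofFinite _
        calc ((primitiveUpTo D).filter fun p => p.1 = r).card
            ≤ ((Finset.univ : Finset (DirichletCharacter ℂ r)).image
                fun χ => (⟨r, χ⟩ : Σ r : ℕ, DirichletCharacter ℂ r)).card := by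
              refine Finset.card_le_card fun p hp => ?_
              obtain ⟨s, χ⟩ := p
              obtain rfl : s = r := (Finset.mem_filter.1 hp).2
              exact Finset.mem_image.2 ⟨χ, Finset.mem_univ _, rfl⟩
          _ ≤ Fintype.card (DirichletCharacter ℂ r) := Finset.card_image_le
          _ = r.totient := by
              rw [← Nat.card_eq_fintype_card, card_eq_totient_of_hasEnoughRootsOfUnity]
          _ ≤ D := (Nat.totient_le r).trans h2
    _ = D ^ 2 := by simp [sq]

theorem norm_sum_mul_conj_le {D : ℕ} {p q : Σ r : ℕ, DirichletCharacter ℂ r}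
    (hp : p ∈ primitiveUpTo D) (hq : q ∈ primitiveUpTo D) (hpq : p ≠ q) (a b : ℕ) :
    ‖∑ n ∈ Finset.Ico a b, p.2 n * (starRingEnd ℂ) (q.2 n)‖ ≤ (D : ℝ) ^ 2 := by
  obtain ⟨⟨hp1, hp2⟩, hp3⟩ := mem_primitiveUpTo.1 hp
  obtain ⟨⟨hq1, hq2⟩, hq3⟩ := mem_primitiveUpTo.1 hq
  have : NeZero p.1 := ⟨by omega⟩
  have : NeZero q.1 := ⟨by omega⟩
  have : NeZero (p.1 * q.1) := ⟨mul_ne_zero (NeZero.ne _) (NeZero.ne _)⟩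
  obtain ⟨ψ, hψ, h⟩ := exists_mul_conj_eq hp3 hq3 hpq
  simp only [← h]
  refine (norm_sum_Ico_le hψ a b).trans ?_
  rw [sq]
  exact_mod_cast Nat.mul_le_mul hp2 hq2

end DirichletCharacter

end

section

open Complex

namespace DirichletCharacter

theorem sum_norm_LSeries_sq_le {D y : ℕ} (hy : D ^ 4 ≤ y) {b : ℕ → ℂ}
    (hb : ∀ n, ‖b n‖ ≤ n.divisors.card) (hb0 : ∀ n ≤ y, b n = 0) {s : ℂ} (hs : 1 < s.re) :
    ∑ p ∈ primitiveUpTo D, ‖LSeries (fun n => b n * p.2 n) s‖ ^ 2 ≤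
      (s.re / (s.re - 1) + 1) * (s.re / (s.re - 1)) ^ 4 := by
  classical
  set σ := s.re with hσ
  have hw : AntitoneOn (fun n : ℕ => (n : ℝ) ^ (-σ)) (Set.Ici (y + 1)) := by
    intro m hm n hn hmn
    have hm : 0 < m := Nat.lt_of_lt_of_le (Nat.succ_pos y) hm
    exact Real.rpow_le_rpow_of_nonpos (by exact_mod_cast hm) (by exact_mod_cast hmn) (by linarith)
  have hterm : ∀ p : Σ r : ℕ, DirichletCharacter ℂ r, ∀ n : ℕ,
      LSeries.term (fun n => b n * p.2 n) s n =
        (b n * (n : ℂ) ^ (-(s.im * I))) * (((n : ℝ) ^ (-σ) : ℝ) : ℂ) * p.2 n := by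
    intro p n
    rcases eq_or_ne n 0 with rfl | hn
    · simp [hb0 0 (Nat.zero_le _)]
    · have hn' : (n : ℂ) ≠ 0 := Nat.cast_ne_zero.2 hn
      rw [LSeries.term_of_ne_zero hn, ofReal_cpow (Nat.cast_nonneg n), ofReal_natCast, div_eq_mul_inv,
        ← cpow_neg, mul_assoc (b n) (_ ^ _) (_ ^ _), ← cpow_add _ _ hn']
      have : -(s.im * I) + ((-σ : ℝ) : ℂ) = -s := by
        conv_rhs => rw [← re_add_im s]
        rw [hσ]
        push_cast
        ring
      rw [this]
      ring
  have hb' : ∀ n : ℕ, ‖b n * (n : ℂ) ^ (-(s.im * I))‖ ≤ n.divisors.card := by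
    intro n
    rcases n.eq_zero_or_pos with rfl | hn
    · simp [hb0 0 (Nat.zero_le _)]
    · rw [norm_mul, norm_natCast_cpow_of_pos hn]
      simpa using hb n
  have hsumd := summable_card_divisors_sq hs
  have hsummable : ∀ p : Σ r : ℕ, DirichletCharacter ℂ r,
      Summable (LSeries.term (fun n => b n * p.2 n) s) := by
    intro p
    refine Summable.of_norm_bounded hsumd.1 fun n => ?_
    rw [hterm, norm_mul, norm_mul, norm_real, Real.norm_of_nonneg (by positivity)]
    calc _ ≤ (n.divisors.card : ℝ) * (n : ℝ) ^ (-s.re) * 1 := by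
          gcongr
          · exact hb' n
          · exact p.2.norm_le_one _
      _ ≤ _ := by
        rw [mul_one]
        gcongr
        exact_mod_cast Nat.le_self_pow two_ne_zero _
  have hlim : Filter.Tendsto (fun z : ℕ => ∑ p ∈ primitiveUpTo D,
      ‖∑ n ∈ Finset.range z, LSeries.term (fun n => b n * p.2 n) s n‖ ^ 2) Filter.atTop
      (nhds (∑ p ∈ primitiveUpTo D, ‖LSeries (fun n => b n * p.2 n) s‖ ^ 2)) :=
    tendsto_finsetSum _ fun p _ => ((hsummable p).hasSum.tendsto_sum_nat.norm.pow 2)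
  refine le_of_tendsto hlim ?_
  filter_upwards [Filter.eventually_ge_atTop (y + 1)] with z hz
  have hrange : ∀ p : Σ r : ℕ, DirichletCharacter ℂ r,
      ∑ n ∈ Finset.range z, LSeries.term (fun n => b n * p.2 n) s n =
      ∑ n ∈ Finset.Ico (y + 1) z,
        (b n * (n : ℂ) ^ (-(s.im * I))) * (((n : ℝ) ^ (-σ) : ℝ) : ℂ) * p.2 n := by
    intro p
    rw [← Finset.sum_range_add_sum_Ico _ hz, Finset.sum_eq_zero, zero_add]
    · exact Finset.sum_congr rfl fun n _ => hterm p n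
    · intro n hn
      rw [hterm, hb0 n (by have := Finset.mem_range.1 hn; omega)]
      simp
  simp only [hrange]
  have hmain := sum_norm_weighted_sum_sq_le (primitiveUpTo D) (fun p n => p.2 n)
    (fun p n => p.2.norm_le_one _) (Q := (D : ℝ) ^ 2) (by positivity)
    (fun p hp q hq hpq a b => norm_sum_mul_conj_le hp hq hpq a b) hw
    (fun n _ => by positivity) (fun n => b n * (n : ℂ) ^ (-(s.im * I))) hz
  refine hmain.trans (mul_le_mul ?_ ?_ ?_ ?_)
  · refine add_le_add ?_ ?_
    · refine le_trans ?_ (tsum_rpow_neg_le hs)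
      exact (Real.summable_nat_rpow.2 (by linarith)).sum_le_tsum _ fun n _ => by positivity
    · have h1 : ((primitiveUpTo D).card : ℝ) ≤ (D : ℝ) ^ 2 := by
        exact_mod_cast card_primitiveUpTo_le D
      have h2 : ((y + 1 : ℕ) : ℝ) ^ (-σ) ≤ ((y + 1 : ℕ) : ℝ) ^ (-1 : ℝ) :=
        Real.rpow_le_rpow_of_exponent_le (by simp) (by linarith)
      have h3 : (D : ℝ) ^ 4 ≤ ((y + 1 : ℕ) : ℝ) := by
        exact_mod_cast hy.trans (Nat.le_succ y)
      calc _ ≤ (D : ℝ) ^ 2 * (((y + 1 : ℕ) : ℝ) ^ (-1 : ℝ) * (D : ℝ) ^ 2) := by gcongr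
        _ = (D : ℝ) ^ 4 * ((y + 1 : ℕ) : ℝ)⁻¹ := by rw [Real.rpow_neg_one]; ring
        _ ≤ 1 := by
          rw [← div_eq_mul_inv]
          exact (div_le_one (by positivity)).2 h3
  · refine le_trans (Finset.sum_le_sum fun n _ => ?_)
      ((hsumd.1.sum_le_tsum (Finset.Ico (y + 1) z) fun n _ => by positivity).trans hsumd.2)
    gcongr
    exact hb' n
  · exact Finset.sum_nonneg fun n _ => by positivity
  · have : 0 < s.re - 1 := by linarith
    positivity

open ArithmeticFunction in
/-- The Möbius function truncated to `n ≤ y`. -/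
noncomputable def truncatedMoebius (y : ℕ) : ArithmeticFunction ℂ :=
  ⟨fun n => if n ≤ y then (moebius n : ℂ) else 0, by simp⟩

/-- The Dirichlet polynomial `∑_{m ≤ y} μ(m) χ(m) m^{-s}`. -/
noncomputable def mollifier (y : ℕ) {r : ℕ} (χ : DirichletCharacter ℂ r) (s : ℂ) : ℂ :=
  ∑ m ∈ Finset.Icc 1 y, (ArithmeticFunction.moebius m : ℂ) * χ m * (m : ℂ) ^ (-s)

/-- The coefficients of `1 - L(s, χ) M(s, χ)`, without the character. -/
noncomputable def mollifierError (y n : ℕ) : ℂ :=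
  LSeries.delta n -
    (truncatedMoebius y *
      ((ArithmeticFunction.zeta : ArithmeticFunction ℕ) : ArithmeticFunction ℂ)) n

open ArithmeticFunction in
theorem mollifierError_apply_of_le {y n : ℕ} (hn : n ≤ y) : mollifierError y n = 0 := by
  have h : (truncatedMoebius y * ((zeta : ArithmeticFunction ℕ) : ArithmeticFunction ℂ)) n =
      (((moebius : ArithmeticFunction ℤ) : ArithmeticFunction ℂ) *
        ((zeta : ArithmeticFunction ℕ) : ArithmeticFunction ℂ)) n := by
    rw [ArithmeticFunction.mul_apply, ArithmeticFunction.mul_apply]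
    refine Finset.sum_congr rfl fun p hp => ?_
    have h1 : p.1 ≤ y := (Nat.divisor_le (Nat.fst_mem_divisors_of_mem_antidiagonal hp)).trans hn
    simp [truncatedMoebius, h1]
  rw [mollifierError, h, coe_moebius_mul_coe_zeta, one_apply, LSeries.delta, sub_self]

open ArithmeticFunction in
theorem norm_mollifierError_le {y : ℕ} (hy : 1 ≤ y) (n : ℕ) :
    ‖mollifierError y n‖ ≤ n.divisors.card := by
  rcases le_or_gt n y with h | h
  · rw [mollifierError_apply_of_le h, norm_zero]
    positivity
  · rw [mollifierError, LSeries.delta, if_neg (by omega), zero_sub, norm_neg, coe_mul_zeta_apply]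
    refine (norm_sum_le_of_le _ (f := fun i => truncatedMoebius y i) (n := fun _ => 1) fun i _ => ?_).trans ?_
    · simp only [truncatedMoebius, coe_mk]
      split_ifs
      · rw [norm_intCast]
        exact_mod_cast abs_moebius_le_one
      · simp
    · simp

open ArithmeticFunction in
theorem one_sub_LSeries_mul_mollifier {y r : ℕ} (χ : DirichletCharacter ℂ r) {s : ℂ}
    (hs : 1 < s.re) : 1 - LSeries (fun n => χ n) s * mollifier y χ s =
      LSeries (fun n => mollifierError y n * χ n) s := by
  have hM : mollifier y χ s = LSeries (fun n => truncatedMoebius y n * χ n) s := by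
    rw [LSeries, tsum_eq_sum (s := Finset.Icc 1 y)]
    · refine Finset.sum_congr rfl fun n hn => ?_
      obtain ⟨h1, h2⟩ := Finset.mem_Icc.1 hn
      rw [LSeries.term_of_ne_zero (by omega), cpow_neg, div_eq_mul_inv]
      simp [truncatedMoebius, h2]
    · intro n hn
      rcases eq_or_ne n 0 with rfl | h0
      · simp
      · rw [LSeries.term_of_ne_zero h0]
        have : ¬ n ≤ y := fun h => hn (Finset.mem_Icc.2 ⟨Nat.one_le_iff_ne_zero.2 h0, h⟩)
        simp [truncatedMoebius, this]
  have hMs : LSeriesSummable (fun n => truncatedMoebius y n * χ n) s := by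
    refine summable_of_ne_finset_zero (s := Finset.Icc 1 y) fun n hn => ?_
    rcases eq_or_ne n 0 with rfl | h0
    · simp
    · rw [LSeries.term_of_ne_zero h0]
      have : ¬ n ≤ y := fun h => hn (Finset.mem_Icc.2 ⟨Nat.one_le_iff_ne_zero.2 h0, h⟩)
      simp [truncatedMoebius, this]
  have hL := LSeriesSummable_of_one_lt_re χ hs
  have hconv : (fun n => (truncatedMoebius y * ((zeta : ArithmeticFunction ℕ) :
      ArithmeticFunction ℂ)) n * χ n) =
      LSeries.convolution (fun n => truncatedMoebius y n * χ n) (fun n => χ n) := by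
    ext n
    rw [coe_mul_zeta_apply, LSeries.convolution_def, Finset.sum_mul,
      ← Nat.sum_divisorsAntidiagonal (fun i _ => truncatedMoebius y i * χ n)]
    refine Finset.sum_congr rfl fun p hp => ?_
    rw [← (Nat.mem_divisorsAntidiagonal.1 hp).1, Nat.cast_mul, map_mul, mul_assoc]
  have hsplit : (fun n => mollifierError y n * χ n) = (LSeries.delta * fun n : ℕ => χ n) -
      LSeries.convolution (fun n => truncatedMoebius y n * χ n) (fun n => χ n) := by
    rw [← hconv]
    ext n
    simp [mollifierError, sub_mul]
  have hdelta : (LSeries.delta * fun n : ℕ => χ n) = LSeries.delta := by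
    ext n
    rcases eq_or_ne n 1 with rfl | hn
    · simp
    · simp [LSeries.delta, hn]
  have hds : LSeriesSummable LSeries.delta s := by
    refine summable_of_ne_finset_zero (s := {1}) fun n hn => ?_
    rw [LSeries.term]
    simp_all [LSeries.delta]
  rw [hsplit, hdelta, LSeries_sub hds (hMs.convolution hL), LSeries_delta,
    LSeries_convolution' hMs hL, hM, mul_comm]
  rfl

end DirichletCharacter

end

section

open Complex

namespace DirichletCharacter

open ArithmeticFunction in
/-- The Dirichlet series `∑ χ(n) Λ(n) n^{-s}`. -/
noncomputable def vonMangoldtSeries {r : ℕ} (χ : DirichletCharacter ℂ r) : ℂ → ℂ :=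
  LSeries ((fun n : ℕ => χ n) * fun n => (vonMangoldt n : ℂ))

open ArithmeticFunction in
/-- The sum `∑ χ(n) Λ(n) (log n)^J / n^2`. -/
noncomputable def twistedSum (J : ℕ) {r : ℕ} (χ : DirichletCharacter ℂ r) : ℂ :=
  ∑' n : ℕ, χ n * ((vonMangoldt n * (Real.log n ^ J / n ^ 2) : ℝ) : ℂ)

open ArithmeticFunction in
theorem abscissaOfAbsConv_twist_vonMangoldt_lt {r : ℕ} (χ : DirichletCharacter ℂ r) {s : ℂ}
    (hs : 1 < s.re) :
    LSeries.abscissaOfAbsConv ((fun n : ℕ => χ n) * fun n => (vonMangoldt n : ℂ)) < s.re := by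
  obtain ⟨σ, h1, h2⟩ := exists_between hs
  have := (LSeriesSummable_twist_vonMangoldt χ (s := (σ : ℂ)) (by simpa using h1))
  exact this.abscissaOfAbsConv_le.trans_lt (by exact_mod_cast h2)

open ArithmeticFunction in
theorem norm_twistedSum_eq (J : ℕ) {r : ℕ} (χ : DirichletCharacter ℂ r) :
    ‖twistedSum J χ‖ = ‖iteratedDeriv J (vonMangoldtSeries χ) 2‖ := by
  have hs : (1 : ℝ) < (2 : ℂ).re := by simp
  rw [vonMangoldtSeries, LSeries_iteratedDeriv J (abscissaOfAbsConv_twist_vonMangoldt_lt χ hs),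
    norm_mul, norm_pow, norm_neg, norm_one, one_pow, one_mul, twistedSum, LSeries]
  congr 2
  funext n
  rcases eq_or_ne n 0 with rfl | hn
  · simp
  have hiter : ∀ (J : ℕ) (f : ℕ → ℂ), LSeries.logMul^[J] f n = (Complex.log n) ^ J * f n := by
    intro J
    induction J with
    | zero => simp
    | succ J ih =>
      intro f
      rw [Function.iterate_succ_apply, ih, pow_succ]
      ring
  rw [LSeries.term_of_ne_zero hn, hiter, ← natCast_log]
  push_cast
  rw [show (n : ℂ) ^ (2 : ℂ) = (n : ℂ) ^ 2 by exact_mod_cast cpow_natCast (n : ℂ) 2]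
  simp only [Pi.mul_apply]
  ring

theorem differentiableOn_vonMangoldtSeries {r : ℕ} (χ : DirichletCharacter ℂ r) :
    DifferentiableOn ℂ (vonMangoldtSeries χ) {s | 1 < s.re} :=
  (LSeries_analyticOnNhd _).differentiableOn.mono
    fun _ hs => abscissaOfAbsConv_twist_vonMangoldt_lt χ hs

theorem vonMangoldtSeries_eq {r : ℕ} [NeZero r] (χ : DirichletCharacter ℂ r) {s : ℂ}
    (hs : 1 < s.re) : vonMangoldtSeries χ s = -deriv (LFunction χ) s / LFunction χ s := by
  rw [vonMangoldtSeries, LSeries_twist_vonMangoldt_eq χ hs, LFunction_eq_LSeries χ hs,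
    deriv_LFunction_eq_deriv_LSeries χ hs]

open ArithmeticFunction in
theorem norm_vonMangoldtSeries_le {r : ℕ} (χ : DirichletCharacter ℂ r) {J : ℕ} (hJ : 1 ≤ J) {s : ℂ}
    (hs : 1 + 1 / (J : ℝ) ≤ s.re) : ‖vonMangoldtSeries χ s‖ ≤ 6 * (J : ℝ) ^ 2 := by
  have hJ0 : (1 : ℝ) ≤ J := by exact_mod_cast hJ
  set ε : ℝ := 1 / (2 * J) with hε
  have hε0 : 0 < ε := by positivity
  have hεJ : 1 / (J : ℝ) = 2 * ε := by rw [hε]; field_simp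
  have hsum : Summable fun n : ℕ => (n : ℝ) ^ (-(1 + ε)) :=
    Real.summable_nat_rpow.2 (by linarith)
  have hterm : ∀ n : ℕ, ‖LSeries.term ((fun n : ℕ => χ n) * fun n => (vonMangoldt n : ℂ)) s n‖ ≤
      1 / ε * (n : ℝ) ^ (-(1 + ε)) := by
    intro n
    rcases n.eq_zero_or_pos with rfl | hn
    · simp only [LSeries.term_zero, norm_zero]; positivity
    have hn1 : (1 : ℝ) ≤ n := by exact_mod_cast hn
    rw [LSeries.norm_term_eq, if_neg hn.ne', Pi.mul_apply, norm_mul, norm_real,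
      Real.norm_of_nonneg vonMangoldt_nonneg, div_eq_mul_inv, ← Real.rpow_neg (by positivity)]
    calc ‖χ n‖ * vonMangoldt n * (n : ℝ) ^ (-s.re)
        ≤ 1 * ((n : ℝ) ^ ε / ε) * (n : ℝ) ^ (-(1 + 2 * ε)) := by
          gcongr
          · exact χ.norm_le_one _
          · exact vonMangoldt_le_log.trans (Real.log_le_rpow_div (by positivity) hε0)
          · linarith
      _ = 1 / ε * (n : ℝ) ^ (-(1 + ε)) := by
          rw [show -(1 + ε) = ε + -(1 + 2 * ε) by ring, Real.rpow_add (by positivity)]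
          ring
  refine (tsum_of_norm_bounded (hsum.mul_left (1 / ε)).hasSum hterm).trans ?_
  rw [tsum_mul_left]
  calc 1 / ε * ∑' n : ℕ, (n : ℝ) ^ (-(1 + ε)) ≤ 1 / ε * ((1 + ε) / (1 + ε - 1)) := by
        gcongr
        exact tsum_rpow_neg_le (by linarith)
    _ = 2 * J * (2 * J + 1) := by rw [hε]; field_simp; ring
    _ ≤ 6 * (J : ℝ) ^ 2 := by nlinarith

theorem sum_norm_iteratedDeriv_le {ι : Type*} {s : Finset ι} {H : ι → ℂ → ℂ} {c : ℂ} {R C : ℝ}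
    (n : ℕ) (hR : 0 < R) (hH : ∀ i ∈ s, DiffContOnCl ℂ (H i) (Metric.ball c R))
    (hC : ∀ z ∈ Metric.sphere c R, ∑ i ∈ s, ‖H i z‖ ≤ C) :
    ∑ i ∈ s, ‖iteratedDeriv n (H i) c‖ ≤ n.factorial * C / R ^ n := by
  choose η hη1 hη2 using fun i => RCLike.exists_norm_eq_mul_self (iteratedDeriv n (H i) c)
  have hcd : ∀ i ∈ s, ContDiffAt ℂ n (H i) c := fun i hi =>
    ((hH i hi).differentiableOn.analyticAt (Metric.ball_mem_nhds c hR)).contDiffAt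
  have key : iteratedDeriv n (fun z => ∑ i ∈ s, η i * H i z) c =
      ((∑ i ∈ s, ‖iteratedDeriv n (H i) c‖ : ℝ) : ℂ) := by
    rw [iteratedDeriv_fun_sum fun i hi => contDiffAt_const.mul (hcd i hi)]
    push_cast
    refine Finset.sum_congr rfl fun i _ => ?_
    rw [iteratedDeriv_const_mul_field]
    exact (hη2 i).symm
  have hd : DiffContOnCl ℂ (fun z => ∑ i ∈ s, η i * H i z) (Metric.ball c R) := by
    refine ⟨DifferentiableOn.fun_sum fun i hi => (hH i hi).differentiableOn.const_mul _,
      continuousOn_finsetSum _ fun i hi => continuousOn_const.mul (hH i hi).continuousOn⟩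
  have h := norm_iteratedDeriv_le_of_forall_mem_sphere_norm_le n hR hd (C := C) fun z hz => by
    refine (norm_sum_le _ _).trans ((Finset.sum_le_sum fun i _ => ?_).trans (hC z hz))
    rw [norm_mul, hη1, one_mul]
  rw [key, norm_real, Real.norm_of_nonneg (by positivity)] at h
  exact h

theorem differentiable_mollifier (y : ℕ) {r : ℕ} (χ : DirichletCharacter ℂ r) :
    Differentiable ℂ (mollifier y χ) := by
  unfold mollifier
  refine Differentiable.fun_sum fun m hm => ?_
  have hm : (m : ℂ) ≠ 0 := Nat.cast_ne_zero.2 (by have := (Finset.mem_Icc.1 hm).1; omega)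
  exact (differentiable_const _).mul (differentiable_neg.const_cpow (Or.inl hm))

theorem norm_mollifier_le (y : ℕ) {r : ℕ} (χ : DirichletCharacter ℂ r) {s : ℂ} (hs : 0 ≤ s.re) :
    ‖mollifier y χ s‖ ≤ y := by
  unfold mollifier
  refine (norm_sum_le_of_le _ (n := fun _ => 1) fun m hm => ?_).trans (by simp)
  have hm : 1 ≤ m := (Finset.mem_Icc.1 hm).1
  rw [norm_mul, norm_mul, norm_natCast_cpow_of_pos hm]
  have h1 : ‖(ArithmeticFunction.moebius m : ℂ)‖ ≤ 1 := by
    rw [norm_intCast]; exact_mod_cast ArithmeticFunction.abs_moebius_le_one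
  have h2 : (m : ℝ) ^ (-s).re ≤ 1 :=
    Real.rpow_le_one_of_one_le_of_nonpos (by exact_mod_cast hm) (by simpa using hs)
  calc _ ≤ 1 * 1 * (1 : ℝ) := by
        gcongr
        exact χ.norm_le_one _
    _ = 1 := by norm_num

/-- The part of the logarithmic derivative that the mollifier makes entire. -/
noncomputable def mollifiedPart (y : ℕ) {r : ℕ} [NeZero r] (χ : DirichletCharacter ℂ r) (s : ℂ) : ℂ :=
  deriv (LFunction χ) s * mollifier y χ s * (2 - LFunction χ s * mollifier y χ s)

theorem differentiable_mollifiedPart (y : ℕ) {r : ℕ} [NeZero r] {χ : DirichletCharacter ℂ r}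
    (hχ : χ ≠ 1) : Differentiable ℂ (mollifiedPart y χ) := by
  have h1 := differentiable_LFunction hχ
  have h2 := differentiable_mollifier y χ
  have h3 : Differentiable ℂ (deriv (LFunction χ)) := h1.deriv
  exact (h3.mul h2).mul ((differentiable_const _).sub (h1.mul h2))

theorem norm_mollifiedPart_le {y r : ℕ} [NeZero r] (hy : 1 ≤ y) {χ : DirichletCharacter ℂ r}
    (hχ : χ ≠ 1) {s : ℂ} (hs : s ∈ Metric.sphere (2 : ℂ) (5 / 4)) :
    ‖mollifiedPart y χ s‖ ≤ 510 * (r : ℝ) ^ 2 * y ^ 2 := by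
  have hs' : ‖s - 2‖ = 5 / 4 := by simpa [dist_eq_norm] using hs
  have hre : 3 / 4 ≤ s.re := by
    have := (abs_re_le_norm (s - 2)).trans_eq hs'
    rw [sub_re, re_ofNat] at this
    linarith [(abs_le.1 this).1]
  have hn : ‖s‖ ≤ 13 / 4 := by
    have : ‖s‖ ≤ ‖s - 2‖ + ‖(2 : ℂ)‖ := by simpa using norm_add_le (s - 2) 2
    rw [hs', norm_ofNat] at this
    linarith
  have hr : (1 : ℝ) ≤ r := by exact_mod_cast NeZero.one_le
  have hy' : (1 : ℝ) ≤ y := by exact_mod_cast hy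
  have h1 : ‖LFunction χ s‖ ≤ 13 * r := by
    refine (norm_LFunction_le hχ (δ := 1 / 4) (by norm_num) (by norm_num) (by linarith)).trans ?_
    have : (r : ℝ) ^ (2 * (1 / 4) : ℝ) ≤ r := by
      conv_rhs => rw [← Real.rpow_one (r : ℝ)]
      exact Real.rpow_le_rpow_of_exponent_le hr (by norm_num)
    calc ‖s‖ * ((r : ℝ) ^ (2 * (1 / 4) : ℝ) / (1 / 4)) ≤ 13 / 4 * (r / (1 / 4)) := by gcongr
      _ = 13 * r := by ring
  have h2 : ‖deriv (LFunction χ) s‖ ≤ 34 * r := by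
    refine (norm_deriv_LFunction_le hχ (δ := 1 / 4) (by norm_num) (by norm_num)
      (by linarith)).trans ?_
    have : (r : ℝ) ^ (4 * (1 / 4) : ℝ) = r := by norm_num
    rw [this]
    calc (‖s‖ + 1) * (r / (2 * (1 / 4))) / (1 / 4) ≤ (13 / 4 + 1) * (r / (2 * (1 / 4))) / (1 / 4) := by
          gcongr
      _ = 34 * r := by ring
  have h3 : ‖mollifier y χ s‖ ≤ y := norm_mollifier_le y χ (by linarith)
  rw [mollifiedPart, norm_mul, norm_mul]
  calc _ ≤ 34 * r * y * (2 + 13 * r * y : ℝ) := by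
        gcongr
        refine (norm_sub_le _ _).trans ?_
        rw [norm_mul, norm_ofNat]
        gcongr
    _ ≤ 34 * r * y * (2 * (r * y) + 13 * r * y : ℝ) := by
        gcongr
        nlinarith
    _ = 510 * (r : ℝ) ^ 2 * y ^ 2 := by ring

theorem vonMangoldtSeries_add_mollifiedPart (y : ℕ) {r : ℕ} [NeZero r]
    (χ : DirichletCharacter ℂ r) {s : ℂ} (hs : 1 < s.re) :
    vonMangoldtSeries χ s + mollifiedPart y χ s =
      vonMangoldtSeries χ s * LSeries (fun n => mollifierError y n * χ n) s ^ 2 := by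
  have h0 : LFunction χ s ≠ 0 := by
    rw [LFunction_eq_LSeries χ hs]
    exact LSeries_ne_zero_of_one_lt_re χ hs
  have hd : deriv (LFunction χ) s = -(vonMangoldtSeries χ s * LFunction χ s) := by
    rw [vonMangoldtSeries_eq χ hs]
    field_simp
  rw [← one_sub_LSeries_mul_mollifier χ hs, mollifiedPart, hd, ← LFunction_eq_LSeries χ hs]
  ring

theorem sum_norm_iteratedDeriv_add_le {D J : ℕ} (hJ : 2 ≤ J) (hD : 1 ≤ D)
    (G : (Σ r : ℕ, DirichletCharacter ℂ r) → ℂ → ℂ)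
    (hG : ∀ p ∈ primitiveUpTo D, Differentiable ℂ (G p))
    (hGs : ∀ p ∈ primitiveUpTo D, ∀ s : ℂ, 1 < s.re → vonMangoldtSeries p.2 s + G p s =
      vonMangoldtSeries p.2 s * LSeries (fun n => mollifierError (D ^ 4) n * p.2 n) s ^ 2) :
    ∑ p ∈ primitiveUpTo D, ‖iteratedDeriv J (fun s => vonMangoldtSeries p.2 s + G p s) 2‖ ≤
      J.factorial * (1000 * (J : ℝ) ^ 7) := by
  have hJ2 : (2 : ℝ) ≤ J := by exact_mod_cast hJ
  have hJi : 1 / (J : ℝ) ≤ 1 / 2 := by gcongr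
  have hJp : 0 < 1 / (J : ℝ) := by positivity
  have hre : ∀ s : ℂ, ‖s - 2‖ ≤ 1 - 1 / (J : ℝ) → 1 + 1 / (J : ℝ) ≤ s.re := by
    intro s hs
    have := (abs_re_le_norm (s - 2)).trans hs
    rw [sub_re, re_ofNat] at this
    linarith [(abs_le.1 this).1]
  refine (sum_norm_iteratedDeriv_le J (R := 1 - 1 / J)
    (C := 6 * (J : ℝ) ^ 2 * ((J + 2) * (J + 1) ^ 4)) (by linarith) ?_ ?_).trans ?_
  · intro p hp
    refine DifferentiableOn.diffContOnCl (DifferentiableOn.mono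
      ((differentiableOn_vonMangoldtSeries p.2).add (hG p hp).differentiableOn) ?_)
    intro s hs
    have hs := Metric.closure_ball_subset_closedBall hs
    have := hre s (by simpa [dist_eq_norm] using hs)
    show 1 < s.re
    linarith
  · intro s hs
    have hs1 := hre s (by simpa [dist_eq_norm] using (Metric.mem_sphere.1 hs).le)
    have hs2 : 1 < s.re := by linarith
    have hratio : s.re / (s.re - 1) ≤ J + 1 := by
      rw [div_le_iff₀ (by linarith)]
      have : 1 ≤ J * (s.re - 1) := by
        calc (1 : ℝ) = J * (1 / J) := by field_simp
          _ ≤ J * (s.re - 1) := by gcongr; linarith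
      linarith
    have hratio0 : 0 ≤ s.re / (s.re - 1) := div_nonneg (by linarith) (by linarith)
    calc _ ≤ ∑ p ∈ primitiveUpTo D, 6 * (J : ℝ) ^ 2 *
            ‖LSeries (fun n => mollifierError (D ^ 4) n * p.2 n) s‖ ^ 2 := by
          refine Finset.sum_le_sum fun p hp => ?_
          rw [hGs p hp s hs2, norm_mul, norm_pow]
          gcongr
          exact norm_vonMangoldtSeries_le p.2 (by omega) hs1
      _ ≤ 6 * (J : ℝ) ^ 2 * ((s.re / (s.re - 1) + 1) * (s.re / (s.re - 1)) ^ 4) := by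
          rw [← Finset.mul_sum]
          gcongr
          exact sum_norm_LSeries_sq_le le_rfl (norm_mollifierError_le (Nat.one_le_pow _ _ hD))
            (fun n hn => mollifierError_apply_of_le hn) hs2
      _ ≤ 6 * (J : ℝ) ^ 2 * ((J + 2) * (J + 1) ^ 4) := by
          have : s.re / (s.re - 1) + 1 ≤ J + 2 := by linarith
          gcongr
  · have h4 : 1 / 9 ≤ (1 - 1 / (J : ℝ)) ^ J := by
      have h1 : Real.exp (-(2 / J)) ≤ 1 - 1 / (J : ℝ) := by
        rw [Real.exp_neg, inv_le_comm₀ (Real.exp_pos _) (by linarith)]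
        refine le_trans ?_ (Real.add_one_le_exp _)
        rw [inv_le_iff_one_le_mul₀ (by linarith)]
        have : 2 / (J : ℝ) = 2 * (1 / J) := by ring
        rw [this]
        nlinarith
      calc (1 / 9 : ℝ) ≤ Real.exp (-2) := by
            rw [Real.exp_neg, one_div]
            gcongr
            have := Real.exp_one_lt_d9
            rw [show (2 : ℝ) = 1 + 1 by norm_num, Real.exp_add]
            nlinarith [Real.exp_pos 1]
        _ = Real.exp (-(2 / J)) ^ J := by
            rw [← Real.exp_nat_mul]
            congr 1
            field_simp
        _ ≤ _ := by gcongr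
    have hpos : (0 : ℝ) < J.factorial := by positivity
    rw [mul_div_assoc]
    gcongr
    rw [div_le_iff₀ (by positivity)]
    calc 6 * (J : ℝ) ^ 2 * ((J + 2) * (J + 1) ^ 4)
        ≤ 6 * (J : ℝ) ^ 2 * ((J + J) * (J + J / 2) ^ 4) := by gcongr; linarith
      _ ≤ 1000 * (J : ℝ) ^ 7 * (1 / 9) := by nlinarith [pow_pos (by positivity : (0 : ℝ) < J) 7]
      _ ≤ _ := by gcongr

theorem sum_norm_twistedSum_large_le {D J : ℕ} (hJ : 2 ≤ J) (hD : 1 ≤ D) {Y : ℝ} (hY : 0 < Y) :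
    ∑ p ∈ primitiveUpTo D with Y < p.1, (p.1 : ℝ) ^ (-(1 / 2) : ℝ) * ‖twistedSum J p.2‖ ≤
      J.factorial * (1000 * (J : ℝ) ^ 7 * Y ^ (-(1 / 2) : ℝ) +
        510 * (D : ℝ) ^ 12 * (4 / 5) ^ J) := by
  classical
  set G : (Σ r : ℕ, DirichletCharacter ℂ r) → ℂ → ℂ := fun p s =>
    if h : p.1 = 0 then 0 else haveI : NeZero p.1 := ⟨h⟩; mollifiedPart (D ^ 4) p.2 s with hGdef
  have hD4 : 1 ≤ D ^ 4 := Nat.one_le_pow _ _ hD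
  have hGeq : ∀ p ∈ primitiveUpTo D, ∃ h : NeZero p.1, p.2 ≠ 1 ∧ G p = mollifiedPart (D ^ 4) p.2 := by
    intro p hp
    obtain ⟨⟨h1, -⟩, h2⟩ := mem_primitiveUpTo.1 hp
    refine ⟨⟨by omega⟩, ne_one_of_isPrimitive h1 h2, ?_⟩
    funext s
    simp only [hGdef, dif_neg (show ¬ p.1 = 0 by omega)]
  have hG : ∀ p ∈ primitiveUpTo D, Differentiable ℂ (G p) := by
    intro p hp
    obtain ⟨h, h1, h2⟩ := hGeq p hp
    rw [h2]
    exact differentiable_mollifiedPart _ h1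
  have hbound : ∀ p ∈ primitiveUpTo D, ‖iteratedDeriv J (G p) 2‖ ≤
      J.factorial * (510 * (D : ℝ) ^ 10 * (4 / 5) ^ J) := by
    intro p hp
    obtain ⟨h, h1, h2⟩ := hGeq p hp
    have hpD : p.1 ≤ D := (mem_primitiveUpTo.1 hp).1.2
    refine (norm_iteratedDeriv_le_of_forall_mem_sphere_norm_le J (R := 5 / 4) (by norm_num)
      (hG p hp).diffContOnCl (C := 510 * (D : ℝ) ^ 10) ?_).trans_eq ?_
    · intro s hs
      rw [h2]
      refine (norm_mollifiedPart_le hD4 h1 hs).trans ?_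
      calc 510 * (p.1 : ℝ) ^ 2 * ((D ^ 4 : ℕ) : ℝ) ^ 2 ≤ 510 * (D : ℝ) ^ 2 * ((D ^ 4 : ℕ) : ℝ) ^ 2 := by
            gcongr
        _ = 510 * (D : ℝ) ^ 10 := by push_cast; ring
    · rw [show (5 / 4 : ℝ) = (4 / 5)⁻¹ by norm_num, inv_pow, div_inv_eq_mul]
      ring
  have hsplit : ∀ p ∈ primitiveUpTo D, ‖twistedSum J p.2‖ ≤
      ‖iteratedDeriv J (fun s => vonMangoldtSeries p.2 s + G p s) 2‖ +
        J.factorial * (510 * (D : ℝ) ^ 10 * (4 / 5) ^ J) := by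
    intro p hp
    have hF : ContDiffAt ℂ J (vonMangoldtSeries p.2) 2 :=
      ((differentiableOn_vonMangoldtSeries p.2).analyticAt
        ((isOpen_lt continuous_const continuous_re).mem_nhds (by simp))).contDiffAt
    have hGc : ContDiffAt ℂ J (G p) 2 := ((hG p hp).analyticAt 2).contDiffAt
    rw [norm_twistedSum_eq, iteratedDeriv_fun_add hF hGc]
    calc _ = ‖(iteratedDeriv J (vonMangoldtSeries p.2) 2 + iteratedDeriv J (G p) 2) -
          iteratedDeriv J (G p) 2‖ := by rw [add_sub_cancel_right]
      _ ≤ _ := (norm_sub_le _ _).trans (by gcongr; exact hbound p hp)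
  have hmain := sum_norm_iteratedDeriv_add_le hJ hD G hG (by
    intro p hp s hs
    obtain ⟨h, h1, h2⟩ := hGeq p hp
    rw [h2]
    exact vonMangoldtSeries_add_mollifiedPart _ _ hs)
  calc ∑ p ∈ primitiveUpTo D with Y < p.1, (p.1 : ℝ) ^ (-(1 / 2) : ℝ) * ‖twistedSum J p.2‖
      ≤ ∑ p ∈ primitiveUpTo D with Y < p.1, (Y ^ (-(1 / 2) : ℝ) *
          ‖iteratedDeriv J (fun s => vonMangoldtSeries p.2 s + G p s) 2‖ +
          J.factorial * (510 * (D : ℝ) ^ 10 * (4 / 5) ^ J)) := by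
        refine Finset.sum_le_sum fun p hp => ?_
        obtain ⟨hp, hpY⟩ := Finset.mem_filter.1 hp
        have hp1 : (1 : ℝ) ≤ p.1 := by exact_mod_cast (mem_primitiveUpTo.1 hp).1.1.le
        have e1 : (p.1 : ℝ) ^ (-(1 / 2) : ℝ) ≤ Y ^ (-(1 / 2) : ℝ) :=
          Real.rpow_le_rpow_of_nonpos hY hpY.le (by norm_num)
        have e2 : (p.1 : ℝ) ^ (-(1 / 2) : ℝ) ≤ 1 :=
          Real.rpow_le_one_of_one_le_of_nonpos hp1 (by norm_num)
        calc _ ≤ (p.1 : ℝ) ^ (-(1 / 2) : ℝ) * _ := by gcongr; exact hsplit p hp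
          _ = _ := mul_add _ _ _
          _ ≤ _ := by
            have : (0 : ℝ) ≤ J.factorial * (510 * (D : ℝ) ^ 10 * (4 / 5) ^ J) := by positivity
            exact add_le_add (by gcongr) (mul_le_of_le_one_left this e2)
    _ ≤ ∑ p ∈ primitiveUpTo D, (Y ^ (-(1 / 2) : ℝ) *
          ‖iteratedDeriv J (fun s => vonMangoldtSeries p.2 s + G p s) 2‖ +
          J.factorial * (510 * (D : ℝ) ^ 10 * (4 / 5) ^ J)) :=
        Finset.sum_le_sum_of_subset_of_nonneg (Finset.filter_subset _ _) fun _ _ _ => by positivity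
    _ = Y ^ (-(1 / 2) : ℝ) * ∑ p ∈ primitiveUpTo D,
          ‖iteratedDeriv J (fun s => vonMangoldtSeries p.2 s + G p s) 2‖ +
          (primitiveUpTo D).card * (J.factorial * (510 * (D : ℝ) ^ 10 * (4 / 5) ^ J)) := by
        rw [Finset.sum_add_distrib, ← Finset.mul_sum, Finset.sum_const, nsmul_eq_mul]
    _ ≤ Y ^ (-(1 / 2) : ℝ) * (J.factorial * (1000 * (J : ℝ) ^ 7)) +
          (D : ℝ) ^ 2 * (J.factorial * (510 * (D : ℝ) ^ 10 * (4 / 5) ^ J)) := by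
        gcongr
        exact_mod_cast card_primitiveUpTo_le D
    _ = _ := by ring

end DirichletCharacter

end

section

open Complex

namespace DirichletCharacter

theorem one_le_norm_local_factor {u : ℝ} (hu0 : 0 ≤ u) (hu1 : u < 1) {a b : ℂ} (ha : ‖a‖ ≤ 1)
    (hb : ‖b‖ ≤ 1) :
    1 ≤ ‖(1 - (u : ℂ))⁻¹‖ ^ 3 * ‖(1 - a * u)⁻¹‖ ^ 2 * ‖(1 - b * u)⁻¹‖ ^ 2 *
      ‖(1 - a * (starRingEnd ℂ) b * u)⁻¹‖ ^ 2 := by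
  have hlt : ∀ {z : ℂ}, ‖z‖ ≤ 1 → ‖z * u‖ < 1 := by
    intro z hz
    rw [norm_mul, norm_real, Real.norm_of_nonneg hu0]
    exact (mul_le_of_le_one_left hu0 hz).trans_lt hu1
  have hab : ‖a * (starRingEnd ℂ) b‖ ≤ 1 := by
    rw [norm_mul, RCLike.norm_conj]
    exact mul_le_one₀ ha (norm_nonneg _) hb
  have hexp : ∀ {z : ℂ}, ‖z‖ ≤ 1 → ‖(1 - z * u)⁻¹‖ = Real.exp ((-log (1 - z * u)).re) := by
    intro z hz
    have : 1 - z * u ≠ 0 := by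
      intro h
      have := hlt hz
      rw [← sub_eq_zero.1 h] at this
      simp at this
    rw [neg_re, log_re, Real.exp_neg, Real.exp_log (norm_pos_iff.2 this), norm_inv]
  have h1 : ‖(1 - (u : ℂ))⁻¹‖ = Real.exp ((-log (1 - 1 * (u : ℂ))).re) := by
    rw [← hexp (by simp), one_mul]
  rw [h1, hexp ha, hexp hb, hexp hab, ← Real.exp_nat_mul, ← Real.exp_nat_mul, ← Real.exp_nat_mul,
    ← Real.exp_nat_mul, ← Real.exp_add, ← Real.exp_add, ← Real.exp_add, Real.one_le_exp_iff]
  have hS : ∀ {z : ℂ}, ‖z‖ ≤ 1 →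
      HasSum (fun n : ℕ => ((z * u) ^ n / n).re) ((-log (1 - z * u)).re) := fun hz =>
    (hasSum_re (hasSum_taylorSeries_neg_log (hlt hz)))
  have := (((hS (z := 1) (by simp)).mul_left ((3 : ℕ) : ℝ)).add
    ((hS ha).mul_left ((2 : ℕ) : ℝ))).add ((hS hb).mul_left ((2 : ℕ) : ℝ)) |>.add
    ((hS hab).mul_left ((2 : ℕ) : ℝ))
  refine this.nonneg fun n => ?_
  have hre : ∀ z : ℂ, ((z * u) ^ n / n).re = u ^ n / n * (z ^ n).re := by
    intro z
    rw [mul_pow, mul_div_assoc, mul_comm, ← ofReal_natCast, ← ofReal_pow, ← ofReal_div,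
      re_ofReal_mul]
  rw [hre, hre, hre, hre, one_pow, mul_pow, ← map_pow]
  have hA : ‖a ^ n‖ ^ 2 ≤ 1 := by
    rw [norm_pow]; exact pow_le_one₀ (by positivity) (pow_le_one₀ (norm_nonneg _) ha)
  have hB : ‖b ^ n‖ ^ 2 ≤ 1 := by
    rw [norm_pow]; exact pow_le_one₀ (by positivity) (pow_le_one₀ (norm_nonneg _) hb)
  generalize a ^ n = A at *
  generalize b ^ n = B at *
  rw [← normSq_eq_norm_sq, normSq_apply] at hA hB
  have : 0 ≤ u ^ n / n := by positivity
  simp only [one_re, mul_re, conj_re, conj_im]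
  push_cast
  have h2 : 0 ≤ 3 + 2 * A.re + 2 * B.re + 2 * (A.re * B.re - A.im * -B.im) := by
    nlinarith [sq_nonneg (1 + A.re + B.re), sq_nonneg (A.im + B.im)]
  calc 0 ≤ u ^ n / n * (3 + 2 * A.re + 2 * B.re + 2 * (A.re * B.re - A.im * -B.im)) := by positivity
    _ = _ := by ring

/-- A nonnegativity inequality for products of `L`-functions attached to two characters. -/
theorem one_le_norm_product {r₁ r₂ r : ℕ} [NeZero r₁] [NeZero r₂] [NeZero r]
    (χ₁ : DirichletCharacter ℂ r₁) (χ₂ : DirichletCharacter ℂ r₂) (ψ : DirichletCharacter ℂ r)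
    (hψ : ∀ n : ℕ, ψ n = χ₁ n * (starRingEnd ℂ) (χ₂ n)) {σ : ℝ} (hσ : 1 < σ) :
    1 ≤ ‖riemannZeta σ‖ ^ 3 * ‖LFunction χ₁ σ‖ ^ 2 * ‖LFunction χ₂ σ‖ ^ 2 *
      ‖LFunction ψ σ‖ ^ 2 := by
  have hs : 1 < (σ : ℂ).re := by simpa using hσ
  rw [LFunction_eq_LSeries _ hs, LFunction_eq_LSeries _ hs, LFunction_eq_LSeries _ hs]
  have h0 := riemannZeta_eulerProduct_hasProd hs
  have h1 := LSeries_eulerProduct_hasProd χ₁ hs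
  have h2 := LSeries_eulerProduct_hasProd χ₂ hs
  have h3 := LSeries_eulerProduct_hasProd ψ hs
  have := (((h0.norm).pow 3).mul ((h1.norm).pow 2)).mul ((h2.norm).pow 2) |>.mul ((h3.norm).pow 2)
  refine ge_of_tendsto' this fun s => ?_
  refine Finset.one_le_prod fun p _ => ?_
  have hp : 1 < (p : ℝ) := by exact_mod_cast p.2.one_lt
  have hu : ((p : ℕ) : ℂ) ^ (-(σ : ℂ)) = (((p : ℝ) ^ (-σ) : ℝ) : ℂ) := by
    rw [ofReal_cpow (by positivity)]
    simp
  rw [hu, hψ]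
  exact one_le_norm_local_factor (by positivity) (Real.rpow_lt_one_of_one_lt_of_neg hp (by linarith))
    (χ₁.norm_le_one _) (χ₂.norm_le_one _)

/-- A common bound for `L(s, χ)` and `L'(s, χ)` with `χ` of level at most `M`, near `s = 1`. -/
noncomputable def LFunctionBound (δ M : ℝ) : ℝ := 2 * M ^ (4 * δ) / δ ^ 2

section bounds

variable {r : ℕ} [NeZero r] {χ : DirichletCharacter ℂ r} {δ M : ℝ} {s : ℂ}

theorem norm_LFunction_le_bound (hχ : χ ≠ 1) (hM : (r : ℝ) ≤ M) (hδ : 0 < δ) (hδ' : δ ≤ 1 / 4)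
    (hs : 1 - δ ≤ s.re) (hs' : ‖s‖ ≤ 3) : ‖LFunction χ s‖ ≤ LFunctionBound δ M := by
  have hr : (1 : ℝ) ≤ r := by exact_mod_cast NeZero.one_le
  have hM1 : 1 ≤ M := hr.trans hM
  refine (norm_LFunction_le hχ hδ (by linarith) hs).trans ?_
  calc ‖s‖ * ((r : ℝ) ^ (2 * δ) / δ) ≤ 3 * (M ^ (4 * δ) / δ) := by
        gcongr
        calc (r : ℝ) ^ (2 * δ) ≤ M ^ (2 * δ) := by gcongr
          _ ≤ M ^ (4 * δ) := by gcongr; norm_num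
    _ = M ^ (4 * δ) / δ ^ 2 * (3 * δ) := by field_simp
    _ ≤ M ^ (4 * δ) / δ ^ 2 * 2 := by gcongr; linarith
    _ = _ := by rw [LFunctionBound]; ring

theorem norm_deriv_LFunction_le_bound (hχ : χ ≠ 1) (hM : (r : ℝ) ≤ M) (hδ : 0 < δ)
    (hδ' : δ ≤ 1 / 4) (hs : 1 - δ ≤ s.re) (hs' : ‖s‖ ≤ 3) :
    ‖deriv (LFunction χ) s‖ ≤ LFunctionBound δ M := by
  refine (norm_deriv_LFunction_le hχ hδ hδ' hs).trans ?_
  calc (‖s‖ + 1) * ((r : ℝ) ^ (4 * δ) / (2 * δ)) / δ ≤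
      (3 + 1) * (M ^ (4 * δ) / (2 * δ)) / δ := by gcongr
    _ = _ := by rw [LFunctionBound]; field_simp; ring

theorem norm_LFunction_sub_le (hχ : χ ≠ 1) (hM : (r : ℝ) ≤ M) (hδ : 0 < δ) (hδ' : δ ≤ 1 / 4)
    (hs : 1 - δ ≤ s.re) (hs' : ‖s‖ ≤ 3) :
    ‖LFunction χ s - LFunction χ 1‖ ≤ LFunctionBound δ M * ‖s - 1‖ := by
  have hconv : Convex ℝ ({z : ℂ | 1 - δ ≤ z.re} ∩ Metric.closedBall 0 3) :=
    (convex_halfSpace_re_ge _).inter (convex_closedBall _ _)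
  refine hconv.norm_image_sub_le_of_norm_deriv_le (f := LFunction χ)
    (fun z _ => (differentiable_LFunction hχ).differentiableAt) (fun z hz => ?_) ?_ ?_
  · exact norm_deriv_LFunction_le_bound hχ hM hδ hδ' hz.1 (by simpa using hz.2)
  · exact ⟨by simpa using hδ.le, by simp⟩
  · exact ⟨hs, by simpa using hs'⟩

end bounds

theorem norm_riemannZeta_le {σ : ℝ} (hσ : 1 < σ) : ‖riemannZeta σ‖ ≤ σ / (σ - 1) := by
  have hs : 1 < (σ : ℂ).re := by simpa using hσ
  rw [zeta_eq_tsum_one_div_nat_cpow hs]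
  refine le_trans ?_ (tsum_rpow_neg_le hσ)
  refine tsum_of_norm_bounded (Real.summable_nat_rpow.2 (by linarith)).hasSum fun n => ?_
  rcases n.eq_zero_or_pos with rfl | hn
  · rw [Nat.cast_zero, zero_cpow (by exact_mod_cast (by linarith : σ ≠ 0)), div_zero, norm_zero]
    positivity
  · rw [norm_div, norm_one, norm_natCast_cpow_of_pos hn, ofReal_re, Real.rpow_neg (by positivity),
      one_div]

/-- Two primitive characters cannot both have a small value at `1`. -/
theorem eq_of_norm_LFunction_one_le {Q δ x : ℝ} (hδ : 0 < δ) (hδ' : δ ≤ 1 / 4) (hx : 0 < x)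
    (hx1 : x ≤ 1) (hsmall : 8 * x * (1 + LFunctionBound δ (Q ^ 2)) ^ 6 < 1) {r₁ r₂ : ℕ}
    [NeZero r₁] [NeZero r₂] {χ₁ : DirichletCharacter ℂ r₁} {χ₂ : DirichletCharacter ℂ r₂}
    (hr₁ : 1 < r₁) (hr₂ : 1 < r₂) (hQ₁ : (r₁ : ℝ) ≤ Q) (hQ₂ : (r₂ : ℝ) ≤ Q)
    (hχ₁ : χ₁.IsPrimitive) (hχ₂ : χ₂.IsPrimitive)
    (h₁ : ‖LFunction χ₁ 1‖ ≤ x) (h₂ : ‖LFunction χ₂ 1‖ ≤ x) :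
    (⟨r₁, χ₁⟩ : Σ r : ℕ, DirichletCharacter ℂ r) = ⟨r₂, χ₂⟩ := by
  by_contra hne
  obtain ⟨ψ, hψ, hψ'⟩ := exists_mul_conj_eq (p := ⟨r₁, χ₁⟩) (q := ⟨r₂, χ₂⟩) hχ₁ hχ₂ hne
  dsimp only at ψ hψ hψ'
  have : NeZero (r₁ * r₂) := ⟨mul_ne_zero (NeZero.ne r₁) (NeZero.ne r₂)⟩
  set B := LFunctionBound δ (Q ^ 2) with hB
  have hQ1 : 1 ≤ Q := le_trans (by exact_mod_cast hr₁.le) hQ₁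
  have hQsq : Q ≤ Q ^ 2 := by nlinarith
  have hB0 : 0 ≤ B := by rw [hB, LFunctionBound]; positivity
  have hre : 1 - δ ≤ (((1 + x : ℝ) : ℂ)).re := by rw [ofReal_re]; linarith
  have hnorm : ‖((1 + x : ℝ) : ℂ)‖ ≤ 3 := by
    rw [norm_real, Real.norm_of_nonneg (by linarith)]; linarith
  have hsub : ‖((1 + x : ℝ) : ℂ) - 1‖ = x := by
    rw [← ofReal_one, ← ofReal_sub, norm_real, Real.norm_of_nonneg (by linarith)]; ring
  have hL : ∀ {r : ℕ} [NeZero r] {χ : DirichletCharacter ℂ r}, χ ≠ 1 → (r : ℝ) ≤ Q →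
      ‖LFunction χ 1‖ ≤ x → ‖LFunction χ ((1 + x : ℝ) : ℂ)‖ ≤ x * (1 + B) := by
    intro r _ χ hχ hr h
    have := norm_LFunction_sub_le hχ (hr.trans hQsq) hδ hδ' hre hnorm
    rw [hsub] at this
    calc _ = ‖(LFunction χ ((1 + x : ℝ) : ℂ) - LFunction χ 1) + LFunction χ 1‖ := by
          rw [sub_add_cancel]
      _ ≤ B * x + x := (norm_add_le _ _).trans (add_le_add this h)
      _ = _ := by ring
  have hψB : ‖LFunction ψ ((1 + x : ℝ) : ℂ)‖ ≤ 1 + B := by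
    refine (norm_LFunction_le_bound hψ (M := Q ^ 2) ?_ hδ hδ' hre hnorm).trans (by linarith)
    push_cast
    rw [pow_two]
    gcongr
  have hζ : ‖riemannZeta ((1 + x : ℝ) : ℂ)‖ ≤ 2 / x := by
    refine (norm_riemannZeta_le (by linarith)).trans ?_
    rw [add_sub_cancel_left]
    gcongr
    linarith
  have key := one_le_norm_product χ₁ χ₂ ψ hψ' (σ := 1 + x) (by linarith)
  have : (1 : ℝ) ≤ (2 / x) ^ 3 * (x * (1 + B)) ^ 2 * (x * (1 + B)) ^ 2 * (1 + B) ^ 2 := by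
    refine key.trans ?_
    gcongr
    · exact hL (ne_one_of_isPrimitive hr₁ hχ₁) hQ₁ h₁
    · exact hL (ne_one_of_isPrimitive hr₂ hχ₂) hQ₂ h₂
  have e : (2 / x) ^ 3 * (x * (1 + B)) ^ 2 * (x * (1 + B)) ^ 2 * (1 + B) ^ 2 =
      8 * x * (1 + B) ^ 6 := by
    field_simp; ring
  linarith

open Filter Topology

theorem tendsto_mul_LFunctionBound (A : ℕ) {δ : ℝ} (hδ : 0 < δ) (hδA : δ * (1000 * (A + 1)) = 1) :
    Tendsto (fun J : ℕ => 8 * (J : ℝ) ^ (-(1 / 16) : ℝ) *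
      (1 + LFunctionBound δ ((((J + 1 : ℕ) : ℝ) ^ A) ^ 2)) ^ 6) atTop (𝓝 0) := by
  set K : ℝ := 1 + 2 / δ ^ 2 with hK
  have hK0 : 0 < K := by positivity
  have hlim : Tendsto (fun J : ℕ => 8 * (K * 2) ^ 6 * (J : ℝ) ^ (-(29 / 2000) : ℝ)) atTop (𝓝 0) := by
    have := ((tendsto_rpow_neg_atTop (y := 29 / 2000) (by norm_num)).comp
      (tendsto_natCast_atTop_atTop (R := ℝ))).const_mul (8 * (K * 2) ^ 6)
    simpa using this
  refine squeeze_zero' (Eventually.of_forall fun J => ?_) ?_ hlim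
  · rw [LFunctionBound]; positivity
  filter_upwards [eventually_ge_atTop 1] with J hJ
  have hJ1 : (1 : ℝ) ≤ J := by exact_mod_cast hJ
  have hJ0 : (0 : ℝ) < J := by linarith
  have h2J : ((J + 1 : ℕ) : ℝ) ≤ 2 * J := by push_cast; linarith
  have hexp : ((((J + 1 : ℕ) : ℝ) ^ A) ^ 2) ^ (4 * δ) ≤ 2 * (J : ℝ) ^ (1 / 125 : ℝ) := by
    have hA : (A : ℝ) * 2 * (4 * δ) ≤ 1 / 125 := by nlinarith
    calc ((((J + 1 : ℕ) : ℝ) ^ A) ^ 2) ^ (4 * δ) = ((J + 1 : ℕ) : ℝ) ^ ((A : ℝ) * 2 * (4 * δ)) := by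
          rw [← pow_mul, ← Real.rpow_natCast, ← Real.rpow_mul (by positivity)]
          push_cast
          rfl
      _ ≤ ((J + 1 : ℕ) : ℝ) ^ (1 / 125 : ℝ) := by
          gcongr
          push_cast; linarith
      _ ≤ (2 * J : ℝ) ^ (1 / 125 : ℝ) := by gcongr
      _ = 2 ^ (1 / 125 : ℝ) * (J : ℝ) ^ (1 / 125 : ℝ) := Real.mul_rpow (by norm_num) hJ0.le
      _ ≤ 2 ^ (1 : ℝ) * (J : ℝ) ^ (1 / 125 : ℝ) := by gcongr <;> norm_num
      _ = _ := by rw [Real.rpow_one]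
  have hB : 1 + LFunctionBound δ ((((J + 1 : ℕ) : ℝ) ^ A) ^ 2) ≤ K * 2 * (J : ℝ) ^ (1 / 125 : ℝ) := by
    have h1 : 1 ≤ (J : ℝ) ^ (1 / 125 : ℝ) := Real.one_le_rpow hJ1 (by norm_num)
    rw [LFunctionBound, hK]
    calc _ ≤ 1 + 2 * (2 * (J : ℝ) ^ (1 / 125 : ℝ)) / δ ^ 2 := by gcongr
      _ ≤ (J : ℝ) ^ (1 / 125 : ℝ) * 2 + 2 * (2 * (J : ℝ) ^ (1 / 125 : ℝ)) / δ ^ 2 := by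
        gcongr; linarith
      _ = _ := by ring
  calc _ ≤ 8 * (J : ℝ) ^ (-(1 / 16) : ℝ) * (K * 2 * (J : ℝ) ^ (1 / 125 : ℝ)) ^ 6 := by
        have : 0 ≤ LFunctionBound δ ((((J + 1 : ℕ) : ℝ) ^ A) ^ 2) := by rw [LFunctionBound]; positivity
        gcongr
    _ = 8 * (K * 2) ^ 6 * ((J : ℝ) ^ (-(1 / 16) : ℝ) * ((J : ℝ) ^ (1 / 125 : ℝ)) ^ 6) := by ring
    _ = _ := by
        rw [← Real.rpow_mul_natCast hJ0.le, ← Real.rpow_add hJ0]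
        norm_num

/-- For infinitely many `J`, no primitive character of conductor in `(1, J^A]` has a small
value at `1`. -/
theorem frequently_le_norm_LFunction_one (A : ℕ) : ∃ᶠ J : ℕ in atTop, ∀ (r : ℕ) [NeZero r]
    (χ : DirichletCharacter ℂ r), 1 < r → r ≤ J ^ A → χ.IsPrimitive →
      (J : ℝ) ^ (-(1 / 16) : ℝ) ≤ ‖LFunction χ 1‖ := by
  set δ : ℝ := 1 / (1000 * (A + 1)) with hδdef
  have hδ : 0 < δ := by positivity
  have hδA : δ * (1000 * (A + 1)) = 1 := by rw [hδdef]; field_simp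
  have hδ' : δ ≤ 1 / 4 := by
    rw [hδdef]; gcongr; nlinarith [(Nat.cast_nonneg A : (0 : ℝ) ≤ A)]
  intro hbad
  have hev := (hbad.and ((tendsto_mul_LFunctionBound A hδ hδA).eventually_lt_const one_pos)).and
    (eventually_ge_atTop 1)
  obtain ⟨J₀, hJ₀⟩ := eventually_atTop.1 hev
  have hex : ∀ J ≥ J₀, ∃ p : Σ r : ℕ, DirichletCharacter ℂ r, ∃ _ : NeZero p.1, 1 < p.1 ∧
      p.1 ≤ J ^ A ∧ p.2.IsPrimitive ∧ ‖LFunction p.2 1‖ < (J : ℝ) ^ (-(1 / 16) : ℝ) := by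
    intro J hJ
    have := (hJ₀ J hJ).1.1
    push Not at this
    obtain ⟨r, h, χ, h1, h2, h3, h4⟩ := this
    exact ⟨⟨r, χ⟩, h, h1, h2, h3, h4⟩
  choose! P hP using hex
  have hmono : ∀ J ≥ J₀, ((J + 1 : ℕ) : ℝ) ^ (-(1 / 16) : ℝ) ≤ (J : ℝ) ^ (-(1 / 16) : ℝ) := by
    intro J hJ
    have : 1 ≤ J := (hJ₀ J hJ).2
    exact Real.rpow_le_rpow_of_nonpos (by exact_mod_cast this) (by push_cast; linarith) (by norm_num)
  have hstep : ∀ J ≥ J₀, P (J + 1) = P J := by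
    intro J hJ
    obtain ⟨i1, h1, h2, h3, h4⟩ := hP (J + 1) (by omega)
    obtain ⟨i2, g1, g2, g3, g4⟩ := hP J hJ
    have hJ1 : (1 : ℝ) ≤ J := by exact_mod_cast (hJ₀ J hJ).2
    refine eq_of_norm_LFunction_one_le hδ hδ' (x := (J : ℝ) ^ (-(1 / 16) : ℝ)) (by positivity)
      (Real.rpow_le_one_of_one_le_of_nonpos hJ1 (by norm_num)) (hJ₀ J hJ).1.2 h1 g1 ?_ ?_ h3 g3
      (h4.le.trans (hmono J hJ)) g4.le
    · exact_mod_cast h2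
    · exact_mod_cast g2.trans (Nat.pow_le_pow_left (Nat.le_succ J) A)
  have hconst : ∀ J ≥ J₀, P J = P J₀ := by
    intro J hJ
    induction J, hJ using Nat.le_induction with
    | base => rfl
    | succ J hJ ih => rw [hstep J hJ, ih]
  obtain ⟨i, h1, h2, h3, h4⟩ := hP J₀ le_rfl
  have hlt : ∀ J ≥ J₀, ‖LFunction (P J₀).2 1‖ ≤ (J : ℝ) ^ (-(1 / 16) : ℝ) := by
    intro J hJ
    obtain ⟨i', -, -, -, g4⟩ := hP J hJ
    have e := hconst J hJ
    generalize P J = p at *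
    subst e
    exact g4.le
  have hzero : ‖LFunction (P J₀).2 1‖ ≤ 0 := by
    refine ge_of_tendsto ((tendsto_rpow_neg_atTop (y := 1 / 16) (by norm_num)).comp
      (tendsto_natCast_atTop_atTop (R := ℝ))) ?_
    filter_upwards [eventually_ge_atTop J₀] with J hJ using hlt J hJ
  exact LFunction_apply_one_ne_zero (ne_one_of_isPrimitive h1 h3) (norm_le_zero_iff.1 hzero)

end DirichletCharacter

end

section

open Complex Filter Topology

namespace DirichletCharacter

theorem norm_twistedSum_le_of_le_norm_LFunction_one {r : ℕ} [NeZero r]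
    {χ : DirichletCharacter ℂ r} {δ M ρ η : ℝ} {J : ℕ} (hχ : χ ≠ 1) (hM : (r : ℝ) ≤ M) (hJ : 1 ≤ J)
    (hδ : δ ≤ 1 / 4) (hJρ : 1 / (J : ℝ) ≤ ρ) (hρδ : ρ ≤ δ) (hη : 0 < η)
    (hL : η ≤ ‖LFunction χ 1‖) (hB : LFunctionBound δ M * (3 * √ρ) ≤ η / 2) :
    ‖twistedSum J χ‖ ≤
      J.factorial * (6 * (J : ℝ) ^ 2 + 2 * LFunctionBound δ M / η) / (1 + ρ) ^ J := by
  have hJ0 : (0 : ℝ) < 1 / J := by positivity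
  have hρ : 0 < ρ := hJ0.trans_le hJρ
  have hδ0 : 0 < δ := hρ.trans_le hρδ
  have hM0 : 0 ≤ M := (Nat.cast_nonneg r).trans hM
  have hBnn : 0 ≤ LFunctionBound δ M := by rw [LFunctionBound]; positivity
  have hsq : √ρ ≤ 1 / 2 := by
    rw [Real.sqrt_le_left (by norm_num)]; linarith
  have hgeom : ∀ s : ℂ, ‖s - 2‖ ≤ 1 + ρ → s.re < 1 + ρ →
      1 - δ ≤ s.re ∧ ‖s - 1‖ ≤ 3 * √ρ ∧ ‖s‖ ≤ 3 := by
    intro s hs hs'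
    have h1 : 1 - ρ ≤ s.re := by
      have := (abs_re_le_norm (s - 2)).trans hs
      rw [sub_re, re_ofNat] at this
      linarith [(abs_le.1 this).1]
    have h2 : ‖s - 1‖ ≤ 3 * √ρ := by
      refine abs_le_of_sq_le_sq' ?_ (by positivity) |>.2
      have h3 : ‖s - 2‖ ^ 2 ≤ (1 + ρ) ^ 2 := by gcongr
      rw [← normSq_eq_norm_sq, normSq_apply] at h3 ⊢
      simp only [sub_re, sub_im, re_ofNat, im_ofNat, one_re, one_im] at h3 ⊢
      rw [mul_pow, Real.sq_sqrt hρ.le]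
      nlinarith
    refine ⟨by linarith, h2, ?_⟩
    have := norm_add_le (s - 1) 1
    rw [sub_add_cancel, norm_one] at this
    linarith
  have hlow : ∀ s : ℂ, ‖s - 2‖ ≤ 1 + ρ → s.re < 1 + ρ → η / 2 ≤ ‖LFunction χ s‖ := by
    intro s hs hs'
    obtain ⟨h1, h2, h3⟩ := hgeom s hs hs'
    have h4 := norm_LFunction_sub_le hχ hM hδ0 hδ h1 h3
    have h5 : LFunctionBound δ M * ‖s - 1‖ ≤ η / 2 := le_trans (by gcongr) hB
    have h6 := norm_sub_norm_le (LFunction χ 1) (LFunction χ s)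
    rw [norm_sub_rev] at h6
    linarith
  have hne : ∀ s : ℂ, ‖s - 2‖ ≤ 1 + ρ → LFunction χ s ≠ 0 := by
    intro s hs
    rcases lt_or_ge s.re (1 + ρ) with h | h
    · exact norm_pos_iff.1 (lt_of_lt_of_le (by positivity) (hlow s hs h))
    · exact LFunction_ne_zero_of_one_le_re χ (Or.inl hχ) (by linarith)
  have hd := differentiable_LFunction hχ
  have hev : vonMangoldtSeries χ =ᶠ[𝓝 2] fun s => -deriv (LFunction χ) s / LFunction χ s := by
    filter_upwards [(isOpen_lt continuous_const continuous_re).mem_nhds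
      (show (1 : ℝ) < (2 : ℂ).re by simp)] with s hs using vonMangoldtSeries_eq χ hs
  rw [norm_twistedSum_eq, hev.iteratedDeriv_eq]
  refine norm_iteratedDeriv_le_of_forall_mem_sphere_norm_le J (by linarith) ?_ ?_
  · refine DifferentiableOn.diffContOnCl fun s hs => ?_
    have hs := Metric.closure_ball_subset_closedBall hs
    rw [Metric.mem_closedBall, dist_eq_norm] at hs
    exact ((hd.deriv s).neg.div (hd s) (hne s hs)).differentiableWithinAt
  · intro s hs
    rw [Metric.mem_sphere, dist_eq_norm] at hs
    have hA : 0 ≤ 6 * (J : ℝ) ^ 2 := by positivity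
    have hA' : 0 ≤ 2 * LFunctionBound δ M / η := by positivity
    rcases lt_or_ge s.re (1 + ρ) with h | h
    · obtain ⟨h1, h2, h3⟩ := hgeom s hs.le h
      rw [norm_div, norm_neg]
      calc _ ≤ LFunctionBound δ M / (η / 2) := by
            gcongr
            · exact norm_deriv_LFunction_le_bound hχ hM hδ0 hδ h1 h3
            · exact hlow s hs.le h
        _ = 2 * LFunctionBound δ M / η := by field_simp
        _ ≤ _ := by linarith
    · rw [← vonMangoldtSeries_eq χ (by linarith)]
      exact (norm_vonMangoldtSeries_le χ hJ (by linarith)).trans (by linarith)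

theorem exp_half_le_one_add_pow {J : ℕ} (hJ : 1 ≤ J) :
    Real.exp (√J / 2) ≤ (1 + (J : ℝ) ^ (-(1 / 2) : ℝ)) ^ J := by
  have hJ0 : (0 : ℝ) < J := by exact_mod_cast hJ
  have hJ1 : (1 : ℝ) ≤ J := by exact_mod_cast hJ
  set ρ := (J : ℝ) ^ (-(1 / 2) : ℝ) with hρ
  have hρ0 : 0 < ρ := by positivity
  have hρ1 : ρ ≤ 1 := Real.rpow_le_one_of_one_le_of_nonpos hJ1 (by norm_num)
  have h : √J / 2 = J * (ρ / 2) := by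
    rw [Real.sqrt_eq_rpow, hρ, ← mul_div_assoc]
    nth_rewrite 2 [← Real.rpow_one (J : ℝ)]
    rw [← Real.rpow_add hJ0]
    norm_num
  rw [h, Real.exp_nat_mul]
  gcongr
  have := Real.exp_bound' (x := ρ / 2) (by positivity) (by linarith) (n := 1) (by norm_num)
  simp at this
  linarith

theorem eventually_sum_small_le (A B : ℕ) : ∀ᶠ J : ℕ in atTop,
    (∀ (r : ℕ) [NeZero r] (χ : DirichletCharacter ℂ r), 1 < r → r ≤ J ^ A → χ.IsPrimitive →
      (J : ℝ) ^ (-(1 / 16) : ℝ) ≤ ‖LFunction χ 1‖) →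
    ∑ p ∈ primitiveUpTo (J ^ A), (p.1 : ℝ) ^ (-(1 / 2) : ℝ) * ‖twistedSum J p.2‖ ≤
      J.factorial * (1 / (3 * (J : ℝ) ^ B)) := by
  set δ : ℝ := 1 / (1000 * (A + 1)) with hδdef
  have hδ : 0 < δ := by positivity
  have hδA : δ * (1000 * (A + 1)) = 1 := by rw [hδdef]; field_simp
  have hδ' : δ ≤ 1 / 4 := by
    rw [hδdef]; gcongr; nlinarith [(Nat.cast_nonneg A : (0 : ℝ) ≤ A)]
  have hcast := tendsto_natCast_atTop_atTop (R := ℝ)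
  have hlim1 := (tendsto_mul_LFunctionBound A hδ hδA).eventually_lt_const one_pos
  have hlim2 : ∀ᶠ J : ℕ in atTop, (J : ℝ) ^ (-(1 / 2) : ℝ) ≤ δ :=
    ((tendsto_rpow_neg_atTop (y := 1 / 2) (by norm_num)).comp hcast).eventually_le_const hδ
  have hlim3 : ∀ᶠ J : ℕ in atTop, (6 : ℝ) ≤ (J : ℝ) ^ (1 / 8 : ℝ) :=
    ((tendsto_rpow_atTop (y := 1 / 8) (by norm_num)).comp hcast).eventually_ge_atTop 6
  have hlim4 : ∀ᶠ J : ℕ in atTop,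
      8 * (J : ℝ) ^ (2 * A + 2 + B) / Real.exp (√J / 2) ≤ 1 / 3 := by
    have h1 : Tendsto (fun J : ℕ => √(J : ℝ) / 2) atTop atTop :=
      (Real.tendsto_sqrt_atTop.comp hcast).atTop_div_const (by norm_num)
    have h2 := ((Real.tendsto_pow_mul_exp_neg_atTop_nhds_zero
      (2 * (2 * A + 2 + B))).comp h1).const_mul (8 * 4 ^ (2 * A + 2 + B))
    rw [mul_zero] at h2
    filter_upwards [h2.eventually_le_const (show (0 : ℝ) < 1 / 3 by norm_num)] with J hJ
    refine le_trans (le_of_eq ?_) hJ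
    rw [Function.comp, pow_mul, Real.exp_neg, div_pow, Real.sq_sqrt (Nat.cast_nonneg J), div_pow]
    norm_num
    field_simp
  filter_upwards [hlim1, hlim2, hlim3, hlim4, eventually_ge_atTop 1] with J h1 h2 h3 h4 hJ hgood
  have hJ1 : (1 : ℝ) ≤ J := by exact_mod_cast hJ
  have hJ0 : (0 : ℝ) < J := by linarith
  set Bd := LFunctionBound δ ((J : ℝ) ^ A) with hBd
  have hBd0 : 0 ≤ Bd := by rw [hBd, LFunctionBound]; positivity
  have hBd1 : Bd ≤ (J : ℝ) ^ (1 / 16 : ℝ) := by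
    have hmono : Bd ≤ LFunctionBound δ ((((J + 1 : ℕ) : ℝ) ^ A) ^ 2) := by
      rw [hBd, LFunctionBound, LFunctionBound]
      gcongr
      calc (J : ℝ) ^ A ≤ ((J + 1 : ℕ) : ℝ) ^ A := by gcongr; linarith
        _ ≤ _ := by
          rw [pow_two]
          exact le_mul_of_one_le_left (by positivity) (one_le_pow₀ (by push_cast; linarith))
    set B' := LFunctionBound δ ((((J + 1 : ℕ) : ℝ) ^ A) ^ 2)
    have hB'0 : 0 ≤ B' := hBd0.trans hmono
    have h5 : 1 + B' ≤ (1 + B') ^ 6 := le_self_pow₀ (by linarith) (by norm_num)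
    have h6 : (J : ℝ) ^ (-(1 / 16) : ℝ) * (J : ℝ) ^ (1 / 16 : ℝ) = 1 := by
      rw [← Real.rpow_add hJ0]; norm_num
    have h7 : (0 : ℝ) < (J : ℝ) ^ (1 / 16 : ℝ) := by positivity
    have h8 : (0 : ℝ) < (J : ℝ) ^ (-(1 / 16) : ℝ) := by positivity
    have h9 : (J : ℝ) ^ (-(1 / 16) : ℝ) * (1 + B') ^ 6 ≤ 1 := by
      nlinarith [mul_nonneg h8.le (by positivity : 0 ≤ (1 + B') ^ 6)]
    have h10 : (1 + B') ^ 6 ≤ (J : ℝ) ^ (1 / 16 : ℝ) := by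
      calc (1 + B') ^ 6 = (J : ℝ) ^ (1 / 16 : ℝ) * ((J : ℝ) ^ (-(1 / 16) : ℝ) * (1 + B') ^ 6) := by
            rw [← mul_assoc, mul_comm ((J : ℝ) ^ (1 / 16 : ℝ)), h6, one_mul]
        _ ≤ (J : ℝ) ^ (1 / 16 : ℝ) * 1 := by gcongr
        _ = _ := mul_one _
    linarith
  have hterm : ∀ p ∈ primitiveUpTo (J ^ A), (p.1 : ℝ) ^ (-(1 / 2) : ℝ) * ‖twistedSum J p.2‖ ≤
      J.factorial * (8 * (J : ℝ) ^ 2) / Real.exp (√J / 2) := by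
    intro p hp
    obtain ⟨⟨hp1, hp2⟩, hp3⟩ := mem_primitiveUpTo.1 hp
    have : NeZero p.1 := ⟨by omega⟩
    have hp1' : (1 : ℝ) ≤ p.1 := by exact_mod_cast hp1.le
    have e2 : (p.1 : ℝ) ^ (-(1 / 2) : ℝ) ≤ 1 :=
      Real.rpow_le_one_of_one_le_of_nonpos hp1' (by norm_num)
    have hmain := norm_twistedSum_le_of_le_norm_LFunction_one (ne_one_of_isPrimitive hp1 hp3)
      (M := (J : ℝ) ^ A) (δ := δ) (ρ := (J : ℝ) ^ (-(1 / 2) : ℝ)) (η := (J : ℝ) ^ (-(1 / 16) : ℝ))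
      (J := J) (by exact_mod_cast hp2) hJ hδ' ?_ h2 (by positivity) (hgood p.1 p.2 hp1 hp2 hp3) ?_
    · refine (mul_le_of_le_one_left (norm_nonneg _) e2).trans (hmain.trans ?_)
      gcongr
      · calc 6 * (J : ℝ) ^ 2 + 2 * Bd / (J : ℝ) ^ (-(1 / 16) : ℝ)
            ≤ 6 * (J : ℝ) ^ 2 + 2 * (J : ℝ) ^ (1 / 16 : ℝ) / (J : ℝ) ^ (-(1 / 16) : ℝ) := by gcongr
          _ = 6 * (J : ℝ) ^ 2 + 2 * (J : ℝ) ^ (1 / 8 : ℝ) := by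
              rw [mul_div_assoc, ← Real.rpow_sub hJ0]; norm_num
          _ ≤ 6 * (J : ℝ) ^ 2 + 2 * (J : ℝ) ^ (2 : ℝ) := by
              gcongr
              norm_num
          _ = _ := by rw [Real.rpow_two]; ring
      · exact exp_half_le_one_add_pow hJ
    · rw [one_div, ← Real.rpow_neg_one]
      exact Real.rpow_le_rpow_of_exponent_le hJ1 (by norm_num)
    · rw [← hBd, Real.sqrt_eq_rpow, ← Real.rpow_mul hJ0.le]
      have e : (J : ℝ) ^ (-(1 / 16) : ℝ) =
          (J : ℝ) ^ (1 / 8 : ℝ) * ((J : ℝ) ^ (1 / 16 : ℝ) * (J : ℝ) ^ (-(1 / 4) : ℝ)) := by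
        rw [← Real.rpow_add hJ0, ← Real.rpow_add hJ0]; norm_num
      rw [e]
      have : (0 : ℝ) < (J : ℝ) ^ (1 / 16 : ℝ) * (J : ℝ) ^ (-(1 / 4) : ℝ) := by positivity
      calc Bd * (3 * (J : ℝ) ^ (-(1 / 2) * (1 / 2) : ℝ)) ≤
            (J : ℝ) ^ (1 / 16 : ℝ) * (3 * (J : ℝ) ^ (-(1 / 2) * (1 / 2) : ℝ)) := by gcongr
        _ = 6 * ((J : ℝ) ^ (1 / 16 : ℝ) * (J : ℝ) ^ (-(1 / 4) : ℝ)) / 2 := by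
            norm_num; ring
        _ ≤ _ := by gcongr
  refine (Finset.sum_le_card_nsmul _ _ _ hterm).trans ?_
  rw [nsmul_eq_mul]
  have hcard : ((primitiveUpTo (J ^ A)).card : ℝ) ≤ (J : ℝ) ^ (2 * A) := by
    have := card_primitiveUpTo_le (J ^ A)
    rw [← pow_mul, mul_comm A 2] at this
    exact_mod_cast this
  calc _ ≤ (J : ℝ) ^ (2 * A) * (J.factorial * (8 * (J : ℝ) ^ 2) / Real.exp (√J / 2)) := by gcongr
    _ = J.factorial * ((8 * (J : ℝ) ^ (2 * A + 2 + B) / Real.exp (√J / 2)) / (J : ℝ) ^ B) := by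
        field_simp
        ring
    _ ≤ J.factorial * (1 / 3 / (J : ℝ) ^ B) := by gcongr
    _ = _ := by rw [div_div]

/-- The total contribution of the primitive characters is small for infinitely many `J`. -/
theorem frequently_sum_norm_twistedSum_le (B W : ℕ) (hW : 1 ≤ W) : ∃ᶠ J : ℕ in atTop,
    ∑ p ∈ primitiveUpTo (W * ⌊Real.exp (J / 1000)⌋₊ ^ 2),
      (p.1 : ℝ) ^ (-(1 / 2) : ℝ) * ‖twistedSum J p.2‖ ≤ J.factorial / (J : ℝ) ^ B := by
  classical
  set A := 2 * B + 16 with hA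
  have hlim : ∀ᶠ J : ℕ in atTop,
      510 * (W : ℝ) ^ 12 * ((J : ℝ) ^ B * (22 / 25) ^ J) ≤ 1 / 3 := by
    have := (tendsto_pow_const_mul_const_pow_of_abs_lt_one B
      (show |(22 / 25 : ℝ)| < 1 by rw [abs_of_pos] <;> norm_num)).const_mul (510 * (W : ℝ) ^ 12)
    rw [mul_zero] at this
    exact this.eventually_le_const (by norm_num)
  refine ((frequently_le_norm_LFunction_one A).and_eventually
    ((eventually_sum_small_le A B).and ((eventually_ge_atTop 3000).and hlim))).mono ?_
  rintro J ⟨hgood, hsmall, hJ, hlim⟩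
  have hJ' : (3000 : ℝ) ≤ J := by exact_mod_cast hJ
  have hJ0 : (0 : ℝ) < J := by linarith
  set D := W * ⌊Real.exp (J / 1000)⌋₊ ^ 2 with hD
  have hfl : 1 ≤ ⌊Real.exp (J / 1000)⌋₊ := by
    rw [Nat.one_le_floor_iff]
    exact Real.one_le_exp (by positivity)
  have hD1 : 1 ≤ D := Nat.mul_pos hW (pow_pos hfl 2)
  have hlarge := sum_norm_twistedSum_large_le (D := D) (J := J) (by omega) hD1
    (Y := (J : ℝ) ^ A) (by positivity)
  have hD12 : (D : ℝ) ^ 12 * (4 / 5) ^ J ≤ (W : ℝ) ^ 12 * (22 / 25) ^ J := by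
    have h1 : (D : ℝ) ≤ W * Real.exp (J / 1000) ^ 2 := by
      rw [hD]
      push_cast
      gcongr
      exact Nat.floor_le (by positivity)
    have h2 : Real.exp (J / 1000) ^ 24 ≤ (11 / 10) ^ J := by
      have : Real.exp (24 / 1000) ≤ 11 / 10 := by
        have := Real.exp_bound' (x := 24 / 1000) (by norm_num) (by norm_num) (n := 1) (by norm_num)
        norm_num at this
        linarith
      calc Real.exp (J / 1000) ^ 24 = Real.exp (24 / 1000) ^ J := by
            rw [← Real.exp_nat_mul, ← Real.exp_nat_mul]
            congr 1
            push_cast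
            ring
        _ ≤ _ := by gcongr
    calc (D : ℝ) ^ 12 * (4 / 5) ^ J ≤ (W * Real.exp (J / 1000) ^ 2) ^ 12 * (4 / 5) ^ J := by gcongr
      _ = (W : ℝ) ^ 12 * Real.exp (J / 1000) ^ 24 * (4 / 5) ^ J := by ring
      _ ≤ (W : ℝ) ^ 12 * (11 / 10) ^ J * (4 / 5) ^ J := by gcongr
      _ = (W : ℝ) ^ 12 * (22 / 25) ^ J := by
          rw [mul_assoc, ← mul_pow]; norm_num
  have hY : ((J : ℝ) ^ A) ^ (-(1 / 2) : ℝ) = 1 / (J : ℝ) ^ (B + 8) := by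
    rw [← Real.rpow_natCast, ← Real.rpow_mul hJ0.le, one_div ((J : ℝ) ^ (B + 8)),
      ← Real.rpow_natCast, ← Real.rpow_neg hJ0.le, hA]
    congr 1
    push_cast
    ring
  rw [← Finset.sum_filter_add_sum_filter_not _ (fun p => (J : ℝ) ^ A < p.1)]
  have h1 : ∑ p ∈ primitiveUpTo D with ¬ (J : ℝ) ^ A < p.1,
      (p.1 : ℝ) ^ (-(1 / 2) : ℝ) * ‖twistedSum J p.2‖ ≤ J.factorial * (1 / (3 * (J : ℝ) ^ B)) := by
    refine le_trans (Finset.sum_le_sum_of_subset_of_nonneg ?_ fun _ _ _ => by positivity)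
      (hsmall hgood)
    intro p hp
    obtain ⟨hp, hp'⟩ := Finset.mem_filter.1 hp
    obtain ⟨h1, h2⟩ := mem_primitiveUpTo.1 hp
    exact mem_primitiveUpTo.2 ⟨⟨h1.1, by exact_mod_cast not_lt.1 hp'⟩, h2⟩
  have h2 : 1000 * (J : ℝ) ^ 7 * (1 / (J : ℝ) ^ (B + 8)) ≤ 1 / (3 * (J : ℝ) ^ B) := by
    rw [show 1000 * (J : ℝ) ^ 7 * (1 / (J : ℝ) ^ (B + 8)) = 1000 / J * (1 / (J : ℝ) ^ B) by
      rw [pow_add]; field_simp; try ring]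
    have : 1000 / (J : ℝ) ≤ 1 / 3 := by
      rw [div_le_iff₀ hJ0]; linarith
    calc _ ≤ 1 / 3 * (1 / (J : ℝ) ^ B) := by gcongr
      _ = _ := by field_simp
  have h3 : 510 * (D : ℝ) ^ 12 * (4 / 5) ^ J ≤ 1 / (3 * (J : ℝ) ^ B) := by
    calc 510 * (D : ℝ) ^ 12 * (4 / 5) ^ J = 510 * ((D : ℝ) ^ 12 * (4 / 5) ^ J) := by ring
      _ ≤ 510 * ((W : ℝ) ^ 12 * (22 / 25) ^ J) := by gcongr
      _ = 510 * (W : ℝ) ^ 12 * ((J : ℝ) ^ B * (22 / 25) ^ J) / (J : ℝ) ^ B := by field_simp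
      _ ≤ 1 / 3 / (J : ℝ) ^ B := by gcongr
      _ = _ := by rw [div_div]
  rw [hY] at hlarge
  calc _ ≤ J.factorial * (1 / (3 * (J : ℝ) ^ B) + 1 / (3 * (J : ℝ) ^ B)) +
        J.factorial * (1 / (3 * (J : ℝ) ^ B)) := add_le_add (hlarge.trans (by gcongr)) h1
    _ = _ := by field_simp; ring

end DirichletCharacter

end

section

open Complex Filter Topology

namespace DirichletCharacter

/-- The regular part of the logarithmic derivative of the zeta function. -/
theorem vonMangoldtSeries_one_eq {s : ℂ} (hs : 1 < s.re) :
    vonMangoldtSeries (1 : DirichletCharacter ℂ 1) s =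
      (1 * s - 1)⁻¹ + -deriv (LFunctionTrivChar₁ 1) s / LFunctionTrivChar₁ 1 s := by
  have hs1 : s ≠ 1 := by rintro rfl; simp at hs
  have h0 : LFunction (1 : DirichletCharacter ℂ 1) s ≠ 0 :=
    LFunction_ne_zero_of_one_le_re _ (Or.inr hs1) hs.le
  have hs1' : s - 1 ≠ 0 := sub_ne_zero.2 hs1
  rw [vonMangoldtSeries_eq _ hs, deriv_LFunctionTrivChar₁_apply_of_ne_one _ hs1,
    LFunctionTrivChar₁, Function.update_of_ne hs1]
  simp only [LFunctionTrivChar]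
  field_simp
  ring

theorem LFunctionTrivChar₁_ne_zero_of_one_le_re {s : ℂ} (hs : 1 ≤ s.re) :
    LFunctionTrivChar₁ 1 s ≠ 0 := by
  rcases eq_or_ne s 1 with rfl | h
  · exact LFunctionTrivChar₁_apply_one_ne_zero _
  · rw [LFunctionTrivChar₁, Function.update_of_ne h, mul_ne_zero_iff]
    exact ⟨sub_ne_zero_of_ne h, LFunction_ne_zero_of_one_le_re _ (Or.inr h) hs⟩

theorem eventually_le_norm_twistedSum_one :
    ∀ᶠ J : ℕ in atTop, (J.factorial : ℝ) / 2 ≤ ‖twistedSum J (1 : DirichletCharacter ℂ 1)‖ := by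
  set Z := LFunctionTrivChar₁ 1 with hZ
  have hZd : Differentiable ℂ Z := differentiable_LFunctionTrivChar₁ 1
  set U : Set ℂ := {s | Z s ≠ 0} with hU
  have hUo : IsOpen U := isOpen_ne_fun hZd.continuous continuous_const
  have hsub : Metric.closedBall (2 : ℂ) 1 ⊆ U := by
    intro s hs
    refine LFunctionTrivChar₁_ne_zero_of_one_le_re ?_
    have := (abs_re_le_norm (s - 2)).trans (by simpa [dist_eq_norm] using hs)
    rw [sub_re, re_ofNat] at this
    linarith [(abs_le.1 this).1]
  obtain ⟨δ, hδ, hδU⟩ := (isCompact_closedBall (2 : ℂ) 1).exists_cthickening_subset_open hUo hsub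
  rw [cthickening_closedBall hδ.le (by norm_num)] at hδU
  set G : ℂ → ℂ := fun s => -deriv Z s / Z s with hG
  have hGd : DifferentiableOn ℂ G U := fun s hs =>
    ((hZd.deriv s).neg.div (hZd s) hs).differentiableWithinAt
  have hGc : DiffContOnCl ℂ G (Metric.ball 2 (δ + 1)) :=
    DifferentiableOn.diffContOnCl
      (hGd.mono (Metric.closure_ball_subset_closedBall.trans hδU))
  obtain ⟨C, hC⟩ := (isCompact_closedBall (2 : ℂ) (δ + 1)).exists_bound_of_continuousOn
    (hGd.continuousOn.mono hδU)
  have hbound : ∀ J : ℕ, ‖iteratedDeriv J G 2‖ ≤ J.factorial * C / (δ + 1) ^ J := fun J =>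
    norm_iteratedDeriv_le_of_forall_mem_sphere_norm_le J (by linarith) hGc
      fun z hz => hC z (Metric.sphere_subset_closedBall hz)
  have hlim : Tendsto (fun J : ℕ => C * ((δ + 1)⁻¹) ^ J) atTop (𝓝 (C * 0)) :=
    (tendsto_pow_atTop_nhds_zero_of_lt_one (by positivity)
      (inv_lt_one_of_one_lt₀ (by linarith))).const_mul C
  rw [mul_zero] at hlim
  filter_upwards [hlim.eventually (eventually_le_nhds (show (0 : ℝ) < 1 / 2 by norm_num))] with J hJ
  have hGa : ContDiffAt ℂ J G 2 :=
    (hGd.analyticAt (hUo.mem_nhds (hsub (Metric.mem_closedBall_self (by norm_num))))).contDiffAt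
  have hinv : ContDiffAt ℂ J (fun s : ℂ => (1 * s - 1)⁻¹) 2 :=
    ((contDiffAt_const.mul contDiffAt_id).sub contDiffAt_const).inv (by norm_num)
  have heq : vonMangoldtSeries (1 : DirichletCharacter ℂ 1) =ᶠ[𝓝 2]
      fun s => (1 * s - 1)⁻¹ + G s := by
    filter_upwards [(isOpen_lt continuous_const continuous_re).mem_nhds
      (show (2 : ℂ) ∈ {s : ℂ | (1 : ℝ) < s.re} by simp)] with s hs
    exact vonMangoldtSeries_one_eq hs
  rw [norm_twistedSum_eq, heq.iteratedDeriv_eq, iteratedDeriv_fun_add hinv hGa,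
    iteratedDeriv_eq_iterate (f := fun s : ℂ => (1 * s - 1)⁻¹), iter_deriv_inv_linear_sub]
  have h1 : ‖(-1 : ℂ) ^ J * (J.factorial : ℂ) * 1 ^ J * (1 * 2 - 1) ^ (-1 - J : ℤ)‖ = J.factorial := by
    norm_num
  have h2 : ‖iteratedDeriv J G 2‖ ≤ J.factorial * (1 / 2) := by
    refine (hbound J).trans ?_
    rw [mul_div_assoc, div_eq_mul_inv C, ← inv_pow]
    gcongr
  have h3 := norm_sub_le_norm_add ((-1 : ℂ) ^ J * (J.factorial : ℂ) * 1 ^ J * (1 * 2 - 1) ^ (-1 - J : ℤ))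
    (iteratedDeriv J G 2)
  rw [h1] at h3
  refine le_trans ?_ h3
  linarith

open ArithmeticFunction in
theorem eventually_le_tsum_vonMangoldt :
    ∀ᶠ J : ℕ in atTop, (J.factorial : ℝ) / 2 ≤
      ∑' n : ℕ, vonMangoldt n * (Real.log n ^ J / n ^ 2) := by
  filter_upwards [eventually_le_norm_twistedSum_one] with J hJ
  refine hJ.trans_eq ?_
  have : twistedSum J (1 : DirichletCharacter ℂ 1) =
      ((∑' n : ℕ, vonMangoldt n * (Real.log n ^ J / n ^ 2) : ℝ) : ℂ) := by
    rw [twistedSum, ofReal_tsum]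
    congr 1
    funext n
    rw [MulChar.one_apply (isUnit_of_subsingleton _), one_mul]
  rw [this, norm_real, Real.norm_of_nonneg]
  exact tsum_nonneg fun n => mul_nonneg vonMangoldt_nonneg
    (div_nonneg (pow_nonneg (Real.log_natCast_nonneg n) _) (by positivity))

end DirichletCharacter

end

namespace TupleSieve

theorem sum_prod_mul_sq_succ {T Z : Type*} [Fintype T] [Fintype Z] {n : ℕ}
    (q : Fin (n + 1) → Z → ℝ) (D : Fin (n + 1) → Z → T → ℝ) (a : (Fin (n + 1) → T) → ℝ) :
    ∑ x : Fin (n + 1) → Z, (∏ l, q l (x l)) * (∑ t, a t * ∏ l, D l (x l) (t l)) ^ 2 =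
      ∑ z : Z, ∑ x : Fin n → Z, q 0 z * (∏ l : Fin n, q l.succ (x l)) *
        (∑ t₀, ∑ t : Fin n → T, a (Fin.cons t₀ t) * D 0 z t₀ *
          ∏ l : Fin n, D l.succ (x l) (t l)) ^ 2 := by
  rw [← (Fin.consEquiv fun _ => Z).sum_comp, Fintype.sum_prod_type]
  refine Finset.sum_congr rfl fun z _ => Finset.sum_congr rfl fun x _ => ?_
  rw [← (Fin.consEquiv fun _ => T).sum_comp, Fintype.sum_prod_type]
  simp only [Fin.consEquiv_apply, Fin.prod_univ_succ, Fin.cons_zero, Fin.cons_succ, mul_assoc]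
  rfl

/-- Inequalities between diagonalised quadratic forms tensorise. -/
theorem sum_prod_mul_sq_le {T X Y : Type*} [Fintype T] [Fintype X] [Fintype Y] {n : ℕ}
    {w : Fin n → X → ℝ} {v : Fin n → Y → ℝ} {A : Fin n → X → T → ℝ} {B : Fin n → Y → T → ℝ}
    (hw : ∀ l x, 0 ≤ w l x) (hv : ∀ l y, 0 ≤ v l y)
    (h : ∀ l (u : T → ℝ), ∑ x, w l x * (∑ t, u t * A l x t) ^ 2 ≤
      ∑ y, v l y * (∑ t, u t * B l y t) ^ 2) (a : (Fin n → T) → ℝ) :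
    ∑ x : Fin n → X, (∏ l, w l (x l)) * (∑ t, a t * ∏ l, A l (x l) (t l)) ^ 2 ≤
      ∑ y : Fin n → Y, (∏ l, v l (y l)) * (∑ t, a t * ∏ l, B l (y l) (t l)) ^ 2 := by
  induction n with
  | zero => simp
  | succ n ih =>
    rw [sum_prod_mul_sq_succ w A a, sum_prod_mul_sq_succ v B a]
    calc ∑ z : X, ∑ x : Fin n → X, w 0 z * (∏ l, w l.succ (x l)) *
          (∑ t₀, ∑ t : Fin n → T, a (Fin.cons t₀ t) * A 0 z t₀ *
            ∏ l : Fin n, A l.succ (x l) (t l)) ^ 2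
        = ∑ z : X, w 0 z * ∑ x : Fin n → X, (∏ l, w l.succ (x l)) *
          (∑ t : Fin n → T, (∑ t₀, a (Fin.cons t₀ t) * A 0 z t₀) *
            ∏ l : Fin n, A l.succ (x l) (t l)) ^ 2 := by
          refine Finset.sum_congr rfl fun z _ => ?_
          rw [Finset.mul_sum]
          refine Finset.sum_congr rfl fun x _ => ?_
          rw [Finset.sum_comm, mul_assoc]
          simp_rw [Finset.sum_mul]
      _ ≤ ∑ z : X, w 0 z * ∑ y : Fin n → Y, (∏ l, v l.succ (y l)) *
          (∑ t : Fin n → T, (∑ t₀, a (Fin.cons t₀ t) * A 0 z t₀) *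
            ∏ l : Fin n, B l.succ (y l) (t l)) ^ 2 := by
          gcongr with z
          · exact hw 0 z
          · exact ih (fun l => hw l.succ) (fun l => hv l.succ) (fun l => h l.succ) _
      _ = ∑ y : Fin n → Y, (∏ l, v l.succ (y l)) * ∑ z : X, w 0 z *
          (∑ t₀, (∑ t : Fin n → T, a (Fin.cons t₀ t) * ∏ l : Fin n, B l.succ (y l) (t l)) *
            A 0 z t₀) ^ 2 := by
          simp_rw [Finset.mul_sum]
          rw [Finset.sum_comm]
          refine Finset.sum_congr rfl fun y _ => Finset.sum_congr rfl fun z _ => ?_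
          rw [mul_left_comm]
          congr 3
          simp_rw [Finset.sum_mul]
          rw [Finset.sum_comm]
          refine Finset.sum_congr rfl fun t _ => Finset.sum_congr rfl fun t' _ => ?_
          ring
      _ ≤ ∑ y : Fin n → Y, (∏ l, v l.succ (y l)) * ∑ z : Y, v 0 z *
          (∑ t₀, (∑ t : Fin n → T, a (Fin.cons t₀ t) * ∏ l : Fin n, B l.succ (y l) (t l)) *
            B 0 z t₀) ^ 2 := by
          gcongr with y
          · exact Finset.prod_nonneg fun l _ => hv _ _
          · exact h 0 _
      _ = _ := by
          simp_rw [Finset.mul_sum]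
          rw [Finset.sum_comm]
          refine Finset.sum_congr rfl fun y _ => Finset.sum_congr rfl fun z _ => ?_
          rw [← mul_assoc, mul_comm (∏ l : Fin n, v l.succ (z l))]
          congr 2
          simp_rw [Finset.sum_mul]
          refine Finset.sum_congr rfl fun t _ => Finset.sum_congr rfl fun t' _ => ?_
          ring

variable {k : ℕ}

/-- The local factors of the sieve weights at a prime `p`. The value `some j` records divisibility
of the `j`-th linear form, the value `none` that no linear form is divisible. -/
noncomputable def localFactor (p : ℕ) (t x : Option (Fin k)) : ℝ :=
  t.elim 1 fun j => 1 - if x = some j then (p - 1 : ℝ) else 0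

/-- The local density of integers. -/
noncomputable def intWeight (p : ℕ) (x : Option (Fin k)) : ℝ :=
  x.elim (1 - k / p : ℝ) fun _ => 1 / p

/-- The local density of integers for which the `i`-th linear form is prime. -/
noncomputable def primeWeight (i : Fin k) (p : ℕ) (x : Option (Fin k)) : ℝ :=
  x.elim (1 - (k - 1) / (p - 1) : ℝ) fun j => if j = i then 0 else 1 / (p - 1)

theorem intWeight_nonneg {p : ℕ} (hp : k ≤ p) (x : Option (Fin k)) : 0 ≤ intWeight p x := by
  have : (k : ℝ) ≤ p := by exact_mod_cast hp
  rcases x with _ | j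
  · simp only [intWeight, Option.elim]
    have := div_le_one_of_le₀ this (by positivity)
    linarith
  · simp only [intWeight, Option.elim]
    positivity

theorem primeWeight_nonneg {p : ℕ} (hp : k ≤ p) (i : Fin k) (x : Option (Fin k)) :
    0 ≤ primeWeight i p x := by
  have h1 : (k : ℝ) ≤ p := by exact_mod_cast hp
  have h2 : (1 : ℝ) ≤ k := by exact_mod_cast i.pos
  have h3 : (0 : ℝ) ≤ p - 1 := by linarith
  rcases x with _ | j
  · simp only [primeWeight, Option.elim]
    have := div_le_one_of_le₀ (show (k : ℝ) - 1 ≤ p - 1 by linarith) h3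
    linarith
  · simp only [primeWeight, Option.elim]
    split_ifs <;> positivity

theorem sum_mul_localFactor_none (p : ℕ) (u : Option (Fin k) → ℝ) :
    ∑ t, u t * localFactor p t none = u none + ∑ j, u (some j) := by
  simp [Fintype.sum_option, localFactor]

theorem sum_mul_localFactor_some (p : ℕ) (u : Option (Fin k) → ℝ) (i : Fin k) :
    ∑ t, u t * localFactor p t (some i) = u none + ∑ j, u (some j) - (p - 1) * u (some i) := by
  simp only [Fintype.sum_option, localFactor, Option.elim, mul_one, mul_sub, Finset.sum_sub_distrib,
    Option.some.injEq]
  simp only [mul_ite, mul_zero, Finset.sum_ite_eq, Finset.mem_univ, if_true]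
  ring

theorem sum_intWeight_mul_sq_le {p : ℕ} (hp0 : 0 < p) (hp : 2 * k ≤ p) (u : Option (Fin k) → ℝ) :
    ∑ x, intWeight p x * (∑ t, u t * localFactor p t x) ^ 2 ≤
      ∑ x, (x.elim (1 + 1 / (p : ℝ) ^ 2) fun _ => (p : ℝ)) * u x ^ 2 := by
  have hp0' : (0 : ℝ) < p := by exact_mod_cast hp0
  have hp1 : (1 : ℝ) ≤ p := by exact_mod_cast hp0
  have hpk : 2 * (k : ℝ) ≤ p := by exact_mod_cast hp
  rw [Fintype.sum_option (f := fun x => intWeight p x * (∑ t, u t * localFactor p t x) ^ 2),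
    Fintype.sum_option (f := fun x : Option (Fin k) =>
      (x.elim (1 + 1 / (p : ℝ) ^ 2) fun _ => (p : ℝ)) * u x ^ 2)]
  simp only [intWeight, Option.elim, ← Finset.mul_sum]
  rw [sum_mul_localFactor_none]
  simp_rw [sum_mul_localFactor_some]
  set u₀ := u none
  set S := ∑ j, u (some j) with hS
  set Q := ∑ j, u (some j) ^ 2 with hQ
  have hCS : S ^ 2 ≤ k * Q := by
    simpa using sq_sum_le_card_mul_sum_sq (s := Finset.univ) (f := fun j => u (some j))
  have hQ0 : 0 ≤ Q := Finset.sum_nonneg fun _ _ => sq_nonneg _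
  have e : ∑ x, (u₀ + S - (p - 1) * u (some x)) ^ 2 =
      k * (u₀ + S) ^ 2 - 2 * (p - 1) * (u₀ + S) * S + (p - 1) ^ 2 * Q := by
    rw [hQ]
    conv_rhs => rw [hS]
    rw [Finset.mul_sum, Finset.mul_sum, ← hS]
    have : (k : ℝ) * (u₀ + S) ^ 2 = ∑ _j : Fin k, (u₀ + S) ^ 2 := by simp
    rw [this, ← Finset.sum_sub_distrib, ← Finset.sum_add_distrib]
    refine Finset.sum_congr rfl fun j _ => ?_
    ring
  rw [e]
  have e2 : (1 - k / p) * (u₀ + S) ^ 2 + 1 / p * (k * (u₀ + S) ^ 2 - 2 * (p - 1) * (u₀ + S) * S +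
      (p - 1) ^ 2 * Q) = u₀ ^ 2 + 2 / p * u₀ * S - (1 - 2 / p) * S ^ 2 + (p - 2 + 1 / p) * Q := by
    field_simp
    ring
  rw [e2]
  have h1 : 2 / p * u₀ * S ≤ 1 / (p : ℝ) ^ 2 * u₀ ^ 2 + S ^ 2 := by
    have := sq_nonneg (1 / p * u₀ - S)
    have e3 : (1 / p * u₀ - S) ^ 2 = 1 / (p : ℝ) ^ 2 * u₀ ^ 2 + S ^ 2 - 2 / p * u₀ * S := by
      field_simp
      ring
    linarith
  have h2 : 2 / p * S ^ 2 ≤ Q := by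
    rw [div_mul_eq_mul_div, div_le_iff₀ hp0']
    nlinarith
  have h3 : 1 / (p : ℝ) * Q ≤ 1 * Q := by
    gcongr
    rw [div_le_one hp0']
    exact hp1
  linarith

theorem le_sum_primeWeight_mul_sq {p : ℕ} (hp : k + 1 ≤ p) (i : Fin k) (u : Option (Fin k) → ℝ) :
    ∑ y : Option (Fin k), (y.elim (1 : ℝ) fun j => if j = i then 0 else (p - k : ℝ)) *
        (∑ t, u t * y.elim (if t = none ∨ t = some i then (1 : ℝ) else 0)
          fun j => if t = some j then 1 else 0) ^ 2 ≤
      ∑ x, primeWeight i p x * (∑ t, u t * localFactor p t x) ^ 2 := by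
  have hp1 : (k : ℝ) + 1 ≤ p := by exact_mod_cast hp
  have hk1 : (1 : ℝ) ≤ k := by exact_mod_cast i.pos
  have hp0 : (0 : ℝ) < p - 1 := by linarith
  have hne : (p : ℝ) - 1 ≠ 0 := hp0.ne'
  rw [Fintype.sum_option (f := fun x => primeWeight i p x * (∑ t, u t * localFactor p t x) ^ 2),
    Fintype.sum_option]
  simp only [primeWeight, Option.elim]
  rw [sum_mul_localFactor_none]
  simp_rw [sum_mul_localFactor_some]
  have hs : ∀ F : Fin k → ℝ, ∑ j, F j = F i + ∑ j ∈ Finset.univ.erase i, F j := fun F =>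
    (Finset.add_sum_erase _ _ (Finset.mem_univ i)).symm
  simp only [Fintype.sum_option, mul_ite, mul_one, mul_zero, reduceCtorEq, false_or, if_true,
    Option.some.injEq, Finset.sum_ite_eq', Finset.mem_univ, or_false, one_mul]
  rw [hs (fun j => u (some j)), hs, hs]
  simp only [if_true, zero_mul, zero_add]
  have hcongr : ∀ c : ℝ, ∀ F : Fin k → ℝ, ∑ j ∈ Finset.univ.erase i, (if j = i then 0 else c) * F j =
      c * ∑ j ∈ Finset.univ.erase i, F j := fun c F => by
    rw [Finset.mul_sum]
    refine Finset.sum_congr rfl fun j hj => ?_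
    rw [if_neg (Finset.ne_of_mem_erase hj)]
  rw [hcongr, hcongr]
  set u₀ := u none
  set v := u (some i)
  set S := ∑ j ∈ Finset.univ.erase i, u (some j) with hS
  set Q := ∑ j ∈ Finset.univ.erase i, u (some j) ^ 2 with hQ
  have hcard : ((Finset.univ.erase i).card : ℝ) = k - 1 := by
    rw [Finset.card_erase_of_mem (Finset.mem_univ i), Finset.card_univ, Fintype.card_fin,
      Nat.cast_pred i.pos]
  have hCS : S ^ 2 ≤ (k - 1) * Q := by
    rw [← hcard]
    exact sq_sum_le_card_mul_sum_sq
  have e : ∑ x ∈ Finset.univ.erase i, (u₀ + (v + S) - (p - 1) * u (some x)) ^ 2 =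
      (k - 1) * (u₀ + (v + S)) ^ 2 - 2 * (p - 1) * (u₀ + (v + S)) * S + (p - 1) ^ 2 * Q := by
    rw [hQ]
    conv_rhs => rw [hS]
    rw [Finset.mul_sum, Finset.mul_sum, ← hS]
    have : ((k : ℝ) - 1) * (u₀ + (v + S)) ^ 2 =
        ∑ _j ∈ Finset.univ.erase i, (u₀ + (v + S)) ^ 2 := by
      rw [Finset.sum_const, nsmul_eq_mul, hcard]
    rw [this, ← Finset.sum_sub_distrib, ← Finset.sum_add_distrib]
    refine Finset.sum_congr rfl fun j _ => ?_
    ring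
  rw [e]
  have e2 : (1 - (k - 1) / (p - 1)) * (u₀ + (v + S)) ^ 2 + 1 / (p - 1) * ((k - 1) *
      (u₀ + (v + S)) ^ 2 - 2 * (p - 1) * (u₀ + (v + S)) * S + (p - 1) ^ 2 * Q) =
      (u₀ + v) ^ 2 - S ^ 2 + (p - 1) * Q := by
    field_simp
    ring
  rw [e2]
  nlinarith

end TupleSieve

namespace TupleSieve

variable {k n : ℕ}

/-- The set of indices where `α` takes the value `some j`. -/
def fiber (α : Fin n → Option (Fin k)) (j : Fin k) : Finset (Fin n) :=
  Finset.univ.filter fun l => α l = some j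

@[simp]
theorem mem_fiber {α : Fin n → Option (Fin k)} {j : Fin k} {l : Fin n} :
    l ∈ fiber α j ↔ α l = some j := by
  simp [fiber]

theorem fiber_injective : Function.Injective (fiber : (Fin n → Option (Fin k)) → _) := by
  intro α β h
  funext l
  refine Option.ext fun j => ?_
  have : l ∈ fiber α j ↔ l ∈ fiber β j := by rw [h]
  simpa using this

theorem exists_fiber_eq {B : Fin k → Finset (Fin n)}
    (hB : ∀ j j', j ≠ j' → ∀ l, l ∈ B j → l ∉ B j') : ∃ α, fiber α = B := by
  classical
  refine ⟨fun l => if h : ∃ j, l ∈ B j then some h.choose else none, ?_⟩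
  funext j
  ext l
  rw [mem_fiber]
  constructor
  · intro h
    split_ifs at h with h'
    rw [← Option.some_injective _ h]
    exact h'.choose_spec
  · intro h
    have h' : ∃ j, l ∈ B j := ⟨j, h⟩
    rw [dif_pos h']
    by_contra hne
    exact hB _ j (fun e => hne (by rw [e])) l h'.choose_spec h

theorem prod_prod_fiber {M : Type*} [CommMonoid M] (α : Fin n → Option (Fin k)) (F : Fin n → M) :
    ∏ j, ∏ l ∈ fiber α j, F l = ∏ l, (α l).elim 1 fun _ => F l := by
  simp_rw [fiber, Finset.prod_filter]
  rw [Finset.prod_comm]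
  refine Finset.prod_congr rfl fun l _ => ?_
  rcases α l with _ | j <;> simp

theorem sum_sum_fiber {M : Type*} [AddCommMonoid M] (α : Fin n → Option (Fin k)) (F : Fin n → M) :
    ∑ j, ∑ l ∈ fiber α j, F l = ∑ l, (α l).elim 0 fun _ => F l := by
  simp_rw [fiber, Finset.sum_filter]
  rw [Finset.sum_comm]
  refine Finset.sum_congr rfl fun l _ => ?_
  rcases α l with _ | j <;> simp

theorem sum_prod_mul_prod_le {ι : Type*} [Fintype ι] [DecidableEq ι] {X : Type*} [Fintype X]
    {W u : ι → X → ℝ} {e : ι → ℝ}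
    (hW : ∀ m B, 0 ≤ W m B) (hu : ∀ m B, 0 ≤ u m B)
    (h : ∀ m, ∑ B, W m B * u m B ≤ e m * ∑ B, W m B) :
    ∑ B : ι → X, (∏ m, W m (B m)) * ∏ m, u m (B m) ≤ (∏ m, e m) * ∏ m, ∑ B, W m B := by
  simp_rw [← Finset.prod_mul_distrib]
  rw [← Fintype.prod_sum (fun m B => W m B * u m B)]
  exact Finset.prod_le_prod
    (fun m _ => Finset.sum_nonneg fun B _ => mul_nonneg (hW m B) (hu m B)) fun m _ => h m

/-- A tuple of finite sets is good if the sets are pairwise disjoint and of small total weight. -/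
def GoodTuple (c : Fin n → ℝ) (B : Fin k → Finset (Fin n)) : Prop :=
  (∀ j j', j ≠ j' → ∀ l, l ∈ B j → l ∉ B j') ∧ ∑ j, ∑ l ∈ B j, c l ≤ 1

/-- The number of coincidences between distinct members of a tuple of sets. -/
noncomputable def overlapCount (B : Fin k → Finset (Fin n)) : ℝ :=
  ∑ x ∈ (Finset.univ : Finset (Fin k)).offDiag, ∑ l, if l ∈ B x.1 ∧ l ∈ B x.2 then (1 : ℝ) else 0

theorem overlapCount_nonneg (B : Fin k → Finset (Fin n)) : 0 ≤ overlapCount B :=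
  Finset.sum_nonneg fun _ _ => Finset.sum_nonneg fun _ _ => by split_ifs <;> norm_num

theorem one_le_overlapCount {B : Fin k → Finset (Fin n)} {j j' : Fin k} (hne : j ≠ j') {l : Fin n}
    (hl : l ∈ B j) (hl' : l ∈ B j') : 1 ≤ overlapCount B := by
  have h0 : ∀ x : Fin k × Fin k, ∀ l : Fin n,
      (0 : ℝ) ≤ if l ∈ B x.1 ∧ l ∈ B x.2 then (1 : ℝ) else 0 := fun x l => by
    split_ifs <;> norm_num
  have e1 := Finset.single_le_sum (s := Finset.univ) (fun l _ => h0 (j, j') l) (Finset.mem_univ l)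
  have hmem : ((j, j') : Fin k × Fin k) ∈ (Finset.univ : Finset (Fin k)).offDiag :=
    Finset.mem_offDiag.2 ⟨Finset.mem_univ j, Finset.mem_univ j', hne⟩
  have e2 := Finset.single_le_sum (s := (Finset.univ : Finset (Fin k)).offDiag)
    (fun x _ => Finset.sum_nonneg fun l (_ : l ∈ Finset.univ) => h0 x l) hmem
  refine le_trans (le_of_eq ?_) (e1.trans e2)
  exact (if_pos ⟨hl, hl'⟩).symm

open Classical in
theorem one_sub_le_indicator_goodTuple {c : Fin n → ℝ} (hc : ∀ l, 0 ≤ c l)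
    (B : Fin k → Finset (Fin n)) :
    1 - overlapCount B - ∑ j, ∑ l ∈ B j, c l ≤ if GoodTuple c B then 1 else 0 := by
  have hs1 := overlapCount_nonneg B
  have hs2 : 0 ≤ ∑ j, ∑ l ∈ B j, c l :=
    Finset.sum_nonneg fun _ _ => Finset.sum_nonneg fun _ _ => hc _
  split_ifs with hg
  · linarith
  · rw [GoodTuple, not_and_or] at hg
    rcases hg with hg | hg
    · push Not at hg
      obtain ⟨j, j', hne, l, hl, hl'⟩ := hg
      linarith [one_le_overlapCount hne hl hl']
    · linarith

open Classical in
theorem le_sum_goodTuple {W : Fin k → Finset (Fin n) → ℝ} {c q : Fin n → ℝ} {e : ℝ}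
    (hW : ∀ m B, 0 ≤ W m B) (hc : ∀ l, 0 ≤ c l)
    (h1 : ∀ m l, ∑ B, W m B * (if l ∈ B then 1 else 0) ≤ q l * ∑ B, W m B)
    (h2 : ∀ m, ∑ B, W m B * ∑ l ∈ B, c l ≤ e * ∑ B, W m B) :
    (1 - k ^ 2 * ∑ l, q l ^ 2 - k * e) * ∏ m, ∑ B, W m B ≤
      ∑ B : Fin k → Finset (Fin n) with GoodTuple c B, ∏ m, W m (B m) := by
  set P := ∏ m, ∑ B, W m B with hP
  have hP0 : 0 ≤ P := Finset.prod_nonneg fun m _ => Finset.sum_nonneg fun B _ => hW m B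
  have hpair : ∀ x ∈ (Finset.univ : Finset (Fin k)).offDiag, ∀ l,
      ∑ B : Fin k → Finset (Fin n), (∏ m, W m (B m)) *
        (if l ∈ B x.1 ∧ l ∈ B x.2 then (1 : ℝ) else 0) ≤ q l ^ 2 * P := by
    intro x hx l
    have hne := (Finset.mem_offDiag.1 hx).2.2
    have key : ∀ f : Fin k → ℝ, (∏ m, if m = x.1 ∨ m = x.2 then f m else 1) = f x.1 * f x.2 := by
      intro f
      rw [← Finset.prod_filter, show (Finset.univ.filter fun m => m = x.1 ∨ m = x.2) = {x.1, x.2} by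
        ext; simp, Finset.prod_pair hne]
    have := sum_prod_mul_prod_le (W := W)
      (u := fun m B => if m = x.1 ∨ m = x.2 then (if l ∈ B then 1 else 0) else 1)
      (e := fun m => if m = x.1 ∨ m = x.2 then q l else 1) hW
      (fun m B => by split_ifs <;> norm_num) (fun m => by
        split_ifs
        · exact h1 m l
        · simp)
    rw [key] at this
    simp_rw [key] at this
    refine le_trans (le_of_eq (Finset.sum_congr rfl fun B _ => ?_)) (this.trans_eq (by rw [sq]))
    rw [ite_and]
    split_ifs <;> simp
  have hlin : ∀ j, ∑ B : Fin k → Finset (Fin n), (∏ m, W m (B m)) * ∑ l ∈ B j, c l ≤ e * P := by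
    intro j
    have key : ∀ f : Fin k → ℝ, (∏ m, if m = j then f m else 1) = f j := fun f => by simp
    have := sum_prod_mul_prod_le (W := W) (u := fun m B => if m = j then ∑ l ∈ B, c l else 1)
      (e := fun m => if m = j then e else 1) hW
      (fun m B => by
        split_ifs
        · exact Finset.sum_nonneg fun l _ => hc l
        · norm_num) (fun m => by
        split_ifs
        · exact h2 m
        · simp)
    rw [key] at this
    simp_rw [key] at this
    exact this
  have htot : ∑ B : Fin k → Finset (Fin n), ∏ m, W m (B m) = P :=
    (Fintype.prod_sum (fun m B => W m B)).symm
  calc (1 - k ^ 2 * ∑ l, q l ^ 2 - k * e) * P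
      ≤ P - ∑ x ∈ (Finset.univ : Finset (Fin k)).offDiag, ∑ l, q l ^ 2 * P - ∑ _j : Fin k, e * P := by
        rw [Finset.sum_const, Finset.sum_const, Finset.card_univ, Fintype.card_fin, nsmul_eq_mul,
          nsmul_eq_mul, ← Finset.sum_mul]
        have h3 : (((Finset.univ : Finset (Fin k)).offDiag.card : ℕ) : ℝ) ≤ (k : ℝ) ^ 2 := by
          have : (Finset.univ : Finset (Fin k)).offDiag.card ≤ k ^ 2 := by
            rw [Finset.offDiag_card, Finset.card_univ, Fintype.card_fin, sq]
            exact Nat.sub_le _ _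
          exact_mod_cast this
        have h4 : 0 ≤ (∑ l, q l ^ 2) * P := mul_nonneg (Finset.sum_nonneg fun _ _ => sq_nonneg _) hP0
        nlinarith [mul_le_mul_of_nonneg_right h3 h4]
    _ ≤ ∑ B : Fin k → Finset (Fin n), (∏ m, W m (B m)) - ∑ x ∈ (Finset.univ : Finset (Fin k)).offDiag,
          ∑ l, ∑ B : Fin k → Finset (Fin n), (∏ m, W m (B m)) *
            (if l ∈ B x.1 ∧ l ∈ B x.2 then (1 : ℝ) else 0) -
          ∑ j, ∑ B : Fin k → Finset (Fin n), (∏ m, W m (B m)) * ∑ l ∈ B j, c l := by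
        rw [htot]
        gcongr with x hx l _ j
        · exact hpair x hx l
        · exact hlin j
    _ = ∑ B : Fin k → Finset (Fin n), (∏ m, W m (B m)) *
        (1 - overlapCount B - ∑ j, ∑ l ∈ B j, c l) := by
        simp_rw [overlapCount, mul_sub, mul_one, Finset.sum_sub_distrib, Finset.mul_sum]
        congr 1
        · congr 1
          rw [Finset.sum_comm (s := Finset.univ (α := Fin k → Finset (Fin n)))]
          refine Finset.sum_congr rfl fun x _ => ?_
          rw [Finset.sum_comm]
        · rw [Finset.sum_comm]
    _ ≤ ∑ B : Fin k → Finset (Fin n), (∏ m, W m (B m)) * if GoodTuple c B then 1 else 0 := by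
        gcongr with B
        · exact Finset.prod_nonneg fun m _ => hW _ _
        · exact one_sub_le_indicator_goodTuple hc B
    _ = _ := by
        rw [Finset.sum_filter]
        simp

theorem sum_filter_mem_le {F : Finset (Fin n) → ℝ} (hF : ∀ A, 0 ≤ F A) {l : Fin n} {c : ℝ}
    (hc : ∀ A, l ∈ A → F A ≤ c * F (A.erase l)) (hc0 : 0 ≤ c) :
    ∑ A, F A * (if l ∈ A then 1 else 0) ≤ c * ∑ A, F A := by
  simp_rw [mul_ite, mul_one, mul_zero]
  rw [← Finset.sum_filter]
  calc ∑ A with l ∈ A, F A ≤ ∑ A with l ∈ A, c * F (A.erase l) :=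
        Finset.sum_le_sum fun A hA => hc A (Finset.mem_filter.1 hA).2
    _ = c * ∑ A ∈ (Finset.univ.filter fun A : Finset (Fin n) => l ∈ A).image fun A => A.erase l, F A := by
        rw [← Finset.mul_sum, Finset.sum_image]
        intro A hA B hB h
        have hA := (Finset.mem_filter.1 hA).2
        have hB := (Finset.mem_filter.1 hB).2
        rw [← Finset.insert_erase hA, ← Finset.insert_erase hB]
        exact congrArg _ h
    _ ≤ _ := by
        exact mul_le_mul_of_nonneg_left
          (Finset.sum_le_sum_of_subset_of_nonneg (Finset.subset_univ _) fun A _ _ => hF A) hc0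

end TupleSieve

namespace TupleSieve

variable {k n : ℕ}

theorem one_sub_sum_le_prod_one_sub {ι : Type*} (s : Finset ι) {f : ι → ℝ}
    (h0 : ∀ i ∈ s, 0 ≤ f i) (h1 : ∀ i ∈ s, f i ≤ 1) :
    1 - ∑ i ∈ s, f i ≤ ∏ i ∈ s, (1 - f i) := by
  classical
  induction s using Finset.induction_on with
  | empty => simp
  | insert a s ha ih =>
    rw [Finset.sum_insert ha, Finset.prod_insert ha]
    have ih := ih (fun i hi => h0 i (Finset.mem_insert_of_mem hi))
      (fun i hi => h1 i (Finset.mem_insert_of_mem hi))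
    have ha0 := h0 a (Finset.mem_insert_self a s)
    have ha1 := h1 a (Finset.mem_insert_self a s)
    have hs : 0 ≤ ∑ i ∈ s, f i := Finset.sum_nonneg fun i hi => h0 i (Finset.mem_insert_of_mem hi)
    nlinarith [mul_le_mul_of_nonneg_left ih (sub_nonneg.2 ha1)]

/-- The product of the moduli indexed by a finite set. -/
noncomputable def modProd (p : Fin n → ℕ) (A : Finset (Fin n)) : ℝ := ∏ l ∈ A, (p l : ℝ)

/-- The total modulus of an assignment. -/
noncomputable def size (p : Fin n → ℕ) (α : Fin n → Option (Fin k)) : ℝ :=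
  ∏ l, (α l).elim 1 fun _ => (p l : ℝ)

theorem prod_modProd_fiber (p : Fin n → ℕ) (α : Fin n → Option (Fin k)) :
    ∏ j, modProd p (fiber α j) = size p α :=
  prod_prod_fiber α fun l => (p l : ℝ)

/-- The diagonalised sieve coefficients. -/
noncomputable def coeff (p : Fin n → ℕ) (G : Finset (Fin n) → ℝ) (R : ℝ)
    (α : Fin n → Option (Fin k)) : ℝ :=
  if size p α ≤ R then ∏ j, G (fiber α j) / modProd p (fiber α j) else 0

/-- The linear form in the local factors with coefficients `a`. -/
noncomputable def sieveForm (p : Fin n → ℕ) (a : (Fin n → Option (Fin k)) → ℝ)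
    (x : Fin n → Option (Fin k)) : ℝ :=
  ∑ t, a t * ∏ l, localFactor (p l) (t l) (x l)

/-- The mean square of the sieve form in the model of all integers. -/
noncomputable def intMean (p : Fin n → ℕ) (a : (Fin n → Option (Fin k)) → ℝ) : ℝ :=
  ∑ x : Fin n → Option (Fin k), (∏ l, intWeight (p l) (x l)) * sieveForm p a x ^ 2

/-- The mean square of the sieve form in the model where the `i`th shift is prime. -/
noncomputable def primeMean (i : Fin k) (p : Fin n → ℕ) (a : (Fin n → Option (Fin k)) → ℝ) : ℝ :=
  ∑ x : Fin n → Option (Fin k), (∏ l, primeWeight i (p l) (x l)) * sieveForm p a x ^ 2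

/-- The hypotheses on the moduli and the smoothing function. -/
structure Admissible (k : ℕ) (p : Fin n → ℕ) (G : Finset (Fin n) → ℝ) (R : ℝ) : Prop where
  one_lt : 1 < R
  pos : ∀ l, 0 < p l
  two_mul_le : ∀ l, 2 * k ≤ p l
  nonneg : ∀ A, 0 ≤ G A
  erase : ∀ A, ∀ l ∈ A, G A ≤ G (A.erase l)
  supp : ∀ A, G A ≠ 0 → modProd p A ^ 2 ≤ R
  sum_sq : ∑ l, (1 / (p l : ℝ)) ^ 2 ≤ 1 / (8 * (k : ℝ) ^ 2)
  sum_log : ∑ A, G A ^ 2 / modProd p A * ∑ l ∈ A, Real.log (p l) ≤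
    Real.log R / (8 * k) * ∑ A, G A ^ 2 / modProd p A

theorem modProd_pos {p : Fin n → ℕ} (hp : ∀ l, 0 < p l) (A : Finset (Fin n)) : 0 < modProd p A :=
  Finset.prod_pos fun l _ => by exact_mod_cast hp l

theorem size_pos {p : Fin n → ℕ} (hp : ∀ l, 0 < p l) (α : Fin n → Option (Fin k)) :
    0 < size p α := by
  rw [← prod_modProd_fiber]
  exact Finset.prod_pos fun j _ => modProd_pos hp _

theorem coeff_nonneg {p : Fin n → ℕ} {G : Finset (Fin n) → ℝ} {R : ℝ} (hp : ∀ l, 0 < p l)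
    (hG : ∀ A, 0 ≤ G A) (α : Fin n → Option (Fin k)) : 0 ≤ coeff p G R α := by
  rw [coeff]
  split_ifs
  · exact Finset.prod_nonneg fun j _ => div_nonneg (hG _) (modProd_pos hp _).le
  · exact le_rfl

theorem prod_indicator_eq (α β : Fin n → Option (Fin k)) :
    ∏ l, (if α l = β l then (1 : ℝ) else 0) = if α = β then 1 else 0 := by
  rw [Finset.prod_ite_zero]
  simp [funext_iff]

/-- Upper bound for the mean square in the integer model. -/
theorem Admissible.intMean_le {p : Fin n → ℕ} {G : Finset (Fin n) → ℝ} {R : ℝ} (hk : 1 ≤ k)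
    (H : Admissible k p G R) :
    intMean p (coeff (k := k) p G R) ≤ 2 * (∑ A, G A ^ 2 / modProd p A) ^ k := by
  have hpp : ∀ l, (0 : ℝ) < p l := fun l => by exact_mod_cast H.pos l
  have h1 := sum_prod_mul_sq_le (n := n) (w := fun l x => intWeight (k := k) (p l) x)
    (v := fun l x => x.elim (1 + 1 / (p l : ℝ) ^ 2) fun _ => (p l : ℝ))
    (A := fun l x t => localFactor (p l) t x) (B := fun l y t => if t = y then 1 else 0)
    (fun l x => intWeight_nonneg (by have := H.two_mul_le l; omega) x)
    (fun l y => by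
      rcases y with _ | j
      · simp only [Option.elim_none]; positivity
      · exact (hpp l).le)
    (fun l u => by
      refine (sum_intWeight_mul_sq_le (H.pos l) (H.two_mul_le l) u).trans_eq ?_
      simp) (coeff p G R)
  refine h1.trans ?_
  have h2 : ∏ l, (1 + 1 / (p l : ℝ) ^ 2) ≤ 2 := by
    calc ∏ l, (1 + 1 / (p l : ℝ) ^ 2) ≤ ∏ l, Real.exp ((1 / (p l : ℝ)) ^ 2) := by
          refine Finset.prod_le_prod (fun l _ => by positivity) fun l _ => ?_
          rw [one_div_pow, add_comm]
          exact Real.add_one_le_exp _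
      _ = Real.exp (∑ l, (1 / (p l : ℝ)) ^ 2) := (Real.exp_sum _ _).symm
      _ ≤ Real.exp (1 / 2) := by
          gcongr
          refine H.sum_sq.trans ?_
          have : (1 : ℝ) ≤ k := by exact_mod_cast hk
          gcongr
          nlinarith
      _ ≤ 2 := by
          have := Real.exp_one_lt_d9
          have h : Real.exp (1 / 2) ^ 2 = Real.exp 1 := by
            rw [← Real.exp_nat_mul]; norm_num
          nlinarith [Real.exp_pos (1 / 2)]
  have h3 : ∀ y : Fin n → Option (Fin k),
      (∏ l, (y l).elim (1 + 1 / (p l : ℝ) ^ 2) fun _ => (p l : ℝ)) *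
        (∑ t, coeff p G R t * ∏ l, if t l = y l then 1 else 0) ^ 2 ≤
      2 * ∏ j, G (fiber y j) ^ 2 / modProd p (fiber y j) := by
    intro y
    simp_rw [prod_indicator_eq]
    rw [Finset.sum_eq_single y (fun t _ ht => by simp [ht]) (by simp), if_pos rfl, mul_one]
    have e1 : (∏ l, (y l).elim (1 + 1 / (p l : ℝ) ^ 2) fun _ => (p l : ℝ)) ≤ 2 * size p y := by
      calc (∏ l, (y l).elim (1 + 1 / (p l : ℝ) ^ 2) fun _ => (p l : ℝ))
          ≤ ∏ l, (1 + 1 / (p l : ℝ) ^ 2) * (y l).elim 1 fun _ => (p l : ℝ) := by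
            refine Finset.prod_le_prod (fun l _ => ?_) fun l _ => ?_
            · rcases y l with _ | j
              · simp only [Option.elim_none]; positivity
              · exact (hpp l).le
            · rcases y l with _ | j
              · simp
              · have : (0 : ℝ) ≤ 1 / (p l : ℝ) ^ 2 := by positivity
                simp only [Option.elim_some]
                nlinarith [hpp l]
        _ = (∏ l, (1 + 1 / (p l : ℝ) ^ 2)) * size p y := Finset.prod_mul_distrib
        _ ≤ _ := mul_le_mul_of_nonneg_right h2 (size_pos H.pos y).le
    refine (mul_le_mul_of_nonneg_right e1 (sq_nonneg _)).trans ?_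
    rw [mul_assoc]
    refine mul_le_mul_of_nonneg_left ?_ zero_le_two
    rw [coeff]
    split_ifs
    · rw [← prod_modProd_fiber, ← Finset.prod_pow, ← Finset.prod_mul_distrib]
      refine le_of_eq (Finset.prod_congr rfl fun j _ => ?_)
      have := (modProd_pos H.pos (fiber y j)).ne'
      field_simp
    · rw [sq, mul_zero, mul_zero]
      exact Finset.prod_nonneg fun j _ => div_nonneg (sq_nonneg _) (modProd_pos H.pos _).le
  refine (Finset.sum_le_sum fun y _ => h3 y).trans ?_
  rw [← Finset.mul_sum]
  refine mul_le_mul_of_nonneg_left ?_ zero_le_two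
  have h4 : (∑ A, G A ^ 2 / modProd p A) ^ k =
      ∑ B : Fin k → Finset (Fin n), ∏ j, G (B j) ^ 2 / modProd p (B j) := by
    rw [← Fintype.prod_sum (fun (_ : Fin k) A => G A ^ 2 / modProd p A)]
    simp
  rw [h4, ← Finset.sum_image (s := Finset.univ) (g := fiber)
    (f := fun B : Fin k → Finset (Fin n) => ∏ j, G (B j) ^ 2 / modProd p (B j))
    fun a _ b _ h => fiber_injective h]
  exact Finset.sum_le_sum_of_subset_of_nonneg (Finset.subset_univ _) fun B _ _ =>
    Finset.prod_nonneg fun j _ => div_nonneg (sq_nonneg _) (modProd_pos H.pos _).le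

end TupleSieve

namespace TupleSieve

variable {k n : ℕ}

/-- The pattern weight of the assignments seen by `y` when the `i`th class is unconstrained. -/
def seen (i : Fin k) (t y : Option (Fin k)) : ℝ :=
  y.elim (if t = none ∨ t = some i then 1 else 0) fun j => if t = some j then 1 else 0

theorem seen_nonneg (i : Fin k) (t y : Option (Fin k)) : 0 ≤ seen i t y := by
  rcases y with _ | j <;> simp only [seen, Option.elim_none, Option.elim_some] <;>
    split_ifs <;> norm_num

/-- The assignment obtained from `y` by giving the value `i` on `A`. -/
def extend (y : Fin n → Option (Fin k)) (i : Fin k) (A : Finset (Fin n)) (l : Fin n) :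
    Option (Fin k) :=
  if l ∈ A then some i else y l

theorem fiber_extend_same {y : Fin n → Option (Fin k)} {i : Fin k} (hy : fiber y i = ∅)
    (A : Finset (Fin n)) : fiber (extend y i A) i = A := by
  ext l
  have : y l ≠ some i := fun h => by
    have : l ∈ fiber y i := mem_fiber.2 h
    rw [hy] at this
    simp at this
  rw [mem_fiber, extend]
  split_ifs with h <;> simp [h, this]

theorem fiber_extend_ne {y : Fin n → Option (Fin k)} {i j : Fin k} (hj : j ≠ i)
    {A : Finset (Fin n)} (hA : ∀ l ∈ A, y l = none) : fiber (extend y i A) j = fiber y j := by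
  ext l
  rw [mem_fiber, extend, mem_fiber]
  split_ifs with h
  · rw [hA l h]
    simp [hj.symm]
  · rfl

theorem prod_seen_extend {y : Fin n → Option (Fin k)} (i : Fin k)
    {A : Finset (Fin n)} (hA : ∀ l ∈ A, y l = none) : ∏ l, seen i (extend y i A l) (y l) = 1 := by
  refine Finset.prod_eq_one fun l _ => ?_
  rw [extend]
  split_ifs with h
  · rw [hA l h]
    simp [seen]
  · rcases y l with _ | j <;> simp [seen]

/-- The weight attached to a reciprocal of the modulus and to its logarithm. -/
noncomputable def goodCost (k : ℕ) (p : Fin n → ℕ) (R : ℝ) (l : Fin n) : ℝ :=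
  2 * k / p l + 2 / Real.log R * Real.log (p l)

theorem sum_elim_eq_sum_filter (y : Fin n → Option (Fin k)) (F : Fin n → ℝ) :
    ∑ l, ((y l).elim 0 fun _ => F l) = ∑ l with y l ≠ none, F l := by
  rw [Finset.sum_filter]
  refine Finset.sum_congr rfl fun l _ => ?_
  rcases y l with _ | j <;> simp

section
variable {p : Fin n → ℕ} {G : Finset (Fin n) → ℝ} {R : ℝ}

theorem Admissible.goodCost_nonneg (H : Admissible k p G R) (l : Fin n) :
    0 ≤ goodCost k p R l := by
  have := Real.log_pos H.one_lt
  have h2 : (1 : ℝ) ≤ p l := by exact_mod_cast H.pos l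
  have := Real.log_nonneg h2
  rw [goodCost]
  positivity

theorem Admissible.cost_bounds (H : Admissible k p G R) {y : Fin n → Option (Fin k)}
    (hy : GoodTuple (goodCost k p R) (fiber y)) :
    ∑ l with y l ≠ none, (k : ℝ) / p l ≤ 1 / 2 ∧ size p y ^ 2 ≤ R := by
  have hR := Real.log_pos H.one_lt
  have h := hy.2
  have hpp : ∀ l, (0 : ℝ) < p l := fun l => by exact_mod_cast H.pos l
  rw [sum_sum_fiber, sum_elim_eq_sum_filter] at h
  simp_rw [goodCost, Finset.sum_add_distrib, mul_div_assoc, ← Finset.mul_sum] at h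
  have h1 : 0 ≤ ∑ l with y l ≠ none, (k : ℝ) / p l :=
    Finset.sum_nonneg fun l _ => by have := hpp l; positivity
  have h2 : 0 ≤ ∑ l with y l ≠ none, Real.log (p l) :=
    Finset.sum_nonneg fun l _ => Real.log_nonneg (by exact_mod_cast H.pos l)
  have h3 : 0 ≤ 2 / Real.log R * ∑ l with y l ≠ none, Real.log (p l) := by positivity
  refine ⟨by linarith, ?_⟩
  have h4 : 2 / Real.log R * ∑ l with y l ≠ none, Real.log (p l) ≤ 1 := by linarith
  rw [div_mul_eq_mul_div, div_le_one hR] at h4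
  have h5 : Real.log (size p y) = ∑ l with y l ≠ none, Real.log (p l) := by
    rw [← sum_elim_eq_sum_filter, size, Real.log_prod]
    · refine Finset.sum_congr rfl fun l _ => ?_
      rcases y l with _ | j <;> simp
    · intro l _
      rcases y l with _ | j
      · simp
      · exact (hpp l).ne'
  rw [← h5] at h4
  have h6 := size_pos H.pos y
  rw [← Real.log_le_log_iff (by positivity) (by linarith [H.one_lt]), Real.log_pow]
  exact_mod_cast h4

theorem Admissible.sum_disjoint_ge (H : Admissible k p G R) (hk : 1 ≤ k)
    {y : Fin n → Option (Fin k)} (hy : ∑ l with y l ≠ none, (k : ℝ) / p l ≤ 1 / 2) :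
    (∑ A, G A / modProd p A) / 2 ≤
      ∑ A : Finset (Fin n) with ∀ l ∈ A, y l = none, G A / modProd p A := by
  have hpp : ∀ l, (0 : ℝ) < p l := fun l => by exact_mod_cast H.pos l
  have h0 : ∀ A, 0 ≤ G A / modProd p A := fun A => div_nonneg (H.nonneg A) (modProd_pos H.pos A).le
  set m := ∑ A, G A / modProd p A with hm
  have hm0 : 0 ≤ m := Finset.sum_nonneg fun A _ => h0 A
  have h1 : ∀ l, ∑ A, G A / modProd p A * (if l ∈ A then 1 else 0) ≤ 1 / p l * m := by
    intro l
    refine sum_filter_mem_le h0 (fun A hl => ?_) (by have := hpp l; positivity)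
    have h2 : modProd p A = p l * modProd p (A.erase l) := (Finset.mul_prod_erase _ _ hl).symm
    have h3 := modProd_pos H.pos (A.erase l)
    rw [h2, div_mul_div_comm, one_mul]
    have := hpp l
    gcongr
    exact H.erase A l hl
  have h2 : ∀ A : Finset (Fin n), G A / modProd p A -
      ∑ l with y l ≠ none, G A / modProd p A * (if l ∈ A then 1 else 0) ≤
      if ∀ l ∈ A, y l = none then G A / modProd p A else 0 := by
    intro A
    have h3 : ∀ l ∈ Finset.univ.filter (fun l => y l ≠ none),
        0 ≤ G A / modProd p A * (if l ∈ A then 1 else 0) := fun l _ =>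
      mul_nonneg (h0 A) (by split_ifs <;> norm_num)
    split_ifs with h
    · linarith [Finset.sum_nonneg h3]
    · push Not at h
      obtain ⟨l, hl, hl'⟩ := h
      have := Finset.single_le_sum h3 (Finset.mem_filter.2 ⟨Finset.mem_univ l, hl'⟩)
      rw [if_pos hl, mul_one] at this
      linarith
  rw [Finset.sum_filter]
  refine le_trans ?_ (Finset.sum_le_sum fun A _ => h2 A)
  rw [Finset.sum_sub_distrib, Finset.sum_comm, ← hm]
  have h4 : ∑ l with y l ≠ none, ∑ A, G A / modProd p A * (if l ∈ A then 1 else 0) ≤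
      ∑ l with y l ≠ none, (k : ℝ) / p l * m := by
    refine Finset.sum_le_sum fun l _ => (h1 l).trans ?_
    have := hpp l
    have : (1 : ℝ) ≤ k := by exact_mod_cast hk
    gcongr
  rw [← Finset.sum_mul] at h4
  nlinarith [mul_le_mul_of_nonneg_right hy hm0]

theorem Admissible.le_inner_sum (H : Admissible k p G R) (hk : 1 ≤ k) (i : Fin k)
    {y : Fin n → Option (Fin k)} (hyi : fiber y i = ∅)
    (hy : GoodTuple (goodCost k p R) (fiber y)) :
    (∏ j ∈ Finset.univ.erase i, G (fiber y j) / modProd p (fiber y j)) *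
      ((∑ A, G A / modProd p A) / 2) ≤
    ∑ t, coeff p G R t * ∏ l, seen i (t l) (y l) := by
  obtain ⟨hc1, hc2⟩ := H.cost_bounds hy
  have h0 : ∀ A, 0 ≤ G A / modProd p A := fun A => div_nonneg (H.nonneg A) (modProd_pos H.pos A).le
  have h1 : ∀ A ∈ Finset.univ.filter (fun A : Finset (Fin n) => ∀ l ∈ A, y l = none),
      (∏ j ∈ Finset.univ.erase i, G (fiber y j) / modProd p (fiber y j)) * (G A / modProd p A) ≤
      coeff p G R (extend y i A) := by
    intro A hA
    have hA := (Finset.mem_filter.1 hA).2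
    by_cases hG : G A = 0
    · rw [hG, zero_div, mul_zero]
      exact coeff_nonneg H.pos H.nonneg _
    have hprod : ∀ F : Finset (Fin n) → ℝ, ∏ j, F (fiber (extend y i A) j) =
        (∏ j ∈ Finset.univ.erase i, F (fiber y j)) * F A := by
      intro F
      rw [← Finset.mul_prod_erase _ _ (Finset.mem_univ i), fiber_extend_same hyi, mul_comm]
      congr 1
      refine Finset.prod_congr rfl fun j hj => ?_
      rw [fiber_extend_ne (Finset.ne_of_mem_erase hj) hA]
    have hs : size p (extend y i A) = size p y * modProd p A := by
      rw [← prod_modProd_fiber, hprod, ← prod_modProd_fiber,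
        ← Finset.mul_prod_erase _ _ (Finset.mem_univ i), hyi]
      simp [modProd]
    rw [coeff, if_pos, hprod fun B => G B / modProd p B]
    have h2 := H.supp A hG
    have h3 := size_pos H.pos y
    have h4 := modProd_pos H.pos A
    have hR := H.one_lt
    rw [hs]
    nlinarith [sq_nonneg (size p y - modProd p A)]
  calc _ ≤ (∏ j ∈ Finset.univ.erase i, G (fiber y j) / modProd p (fiber y j)) *
        ∑ A : Finset (Fin n) with ∀ l ∈ A, y l = none, G A / modProd p A :=
      mul_le_mul_of_nonneg_left (H.sum_disjoint_ge hk hc1) (Finset.prod_nonneg fun j _ => h0 _)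
    _ ≤ ∑ A : Finset (Fin n) with ∀ l ∈ A, y l = none, coeff p G R (extend y i A) *
        ∏ l, seen i (extend y i A l) (y l) := by
      rw [Finset.mul_sum]
      refine Finset.sum_le_sum fun A hA => ?_
      rw [prod_seen_extend i (Finset.mem_filter.1 hA).2, mul_one]
      exact h1 A hA
    _ ≤ _ := by
      rw [← Finset.sum_image (g := extend y i)
        (f := fun t => coeff p G R t * ∏ l, seen i (t l) (y l))]
      · exact Finset.sum_le_sum_of_subset_of_nonneg (Finset.subset_univ _) fun t _ _ =>
          mul_nonneg (coeff_nonneg H.pos H.nonneg _) (Finset.prod_nonneg fun l _ => seen_nonneg _ _ _)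
      · intro A _ B _ h
        rw [← fiber_extend_same hyi A, ← fiber_extend_same hyi B, h]

end

end TupleSieve

namespace TupleSieve

variable {k n : ℕ} {p : Fin n → ℕ} {G : Finset (Fin n) → ℝ} {R : ℝ}

/-- The density of the `m`th set in the model where the `i`th shift is prime. -/
noncomputable def setDensity (p : Fin n → ℕ) (G : Finset (Fin n) → ℝ) (i m : Fin k)
    (B : Finset (Fin n)) : ℝ :=
  if m = i then (if B = ∅ then 1 else 0) else G B ^ 2 / modProd p B

theorem Admissible.sq_div_nonneg (H : Admissible k p G R) (A : Finset (Fin n)) :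
    0 ≤ G A ^ 2 / modProd p A :=
  div_nonneg (sq_nonneg _) (modProd_pos H.pos A).le

theorem Admissible.setDensity_nonneg (H : Admissible k p G R) (i m : Fin k) (B : Finset (Fin n)) :
    0 ≤ setDensity p G i m B := by
  rw [setDensity]
  split_ifs
  · exact zero_le_one
  · exact le_rfl
  · exact H.sq_div_nonneg B

theorem prod_sum_setDensity (i : Fin k) :
    ∏ m, ∑ B, setDensity p G i m B = (∑ A, G A ^ 2 / modProd p A) ^ (k - 1) := by
  rw [← Finset.mul_prod_erase _ _ (Finset.mem_univ i)]
  have h1 : ∑ B, setDensity p G i i B = 1 := by simp [setDensity]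
  have h2 : ∀ m ∈ Finset.univ.erase i, ∑ B, setDensity p G i m B = ∑ A, G A ^ 2 / modProd p A := by
    intro m hm
    simp [setDensity, Finset.ne_of_mem_erase hm]
  rw [h1, one_mul, Finset.prod_congr rfl h2, Finset.prod_const,
    Finset.card_erase_of_mem (Finset.mem_univ i), Finset.card_univ, Fintype.card_fin]

theorem Admissible.sum_mem_sq_div_le (H : Admissible k p G R) (l : Fin n) :
    ∑ A, G A ^ 2 / modProd p A * (if l ∈ A then 1 else 0) ≤
      1 / p l * ∑ A, G A ^ 2 / modProd p A := by
  have hpp : (0 : ℝ) < p l := by exact_mod_cast H.pos l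
  refine sum_filter_mem_le H.sq_div_nonneg (fun A hl => ?_) (by positivity)
  have h2 : modProd p A = p l * modProd p (A.erase l) := (Finset.mul_prod_erase _ _ hl).symm
  have h3 := modProd_pos H.pos (A.erase l)
  rw [h2, div_mul_div_comm, one_mul]
  have := H.nonneg A
  gcongr
  exact H.erase A l hl

theorem Admissible.sum_goodCost_le (H : Admissible k p G R) (hk : 1 ≤ k) :
    ∑ A, G A ^ 2 / modProd p A * ∑ l ∈ A, goodCost k p R l ≤
      1 / (2 * k) * ∑ A, G A ^ 2 / modProd p A := by
  have hpp : ∀ l, (0 : ℝ) < p l := fun l => by exact_mod_cast H.pos l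
  have hk' : (1 : ℝ) ≤ k := by exact_mod_cast hk
  have hR := Real.log_pos H.one_lt
  set γ := ∑ A, G A ^ 2 / modProd p A with hγ
  have hγ0 : 0 ≤ γ := Finset.sum_nonneg fun A _ => H.sq_div_nonneg A
  have h1 : ∑ A, G A ^ 2 / modProd p A * ∑ l ∈ A, 2 * (k : ℝ) / p l ≤ 1 / (4 * k) * γ := by
    calc ∑ A, G A ^ 2 / modProd p A * ∑ l ∈ A, 2 * (k : ℝ) / p l
        = ∑ l, 2 * (k : ℝ) / p l * ∑ A, G A ^ 2 / modProd p A * (if l ∈ A then 1 else 0) := by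
          simp_rw [Finset.mul_sum]
          rw [Finset.sum_comm' (t' := Finset.univ) (s' := fun l => Finset.univ.filter (l ∈ ·))
            (by simp)]
          refine Finset.sum_congr rfl fun l _ => ?_
          rw [Finset.sum_filter]
          refine Finset.sum_congr rfl fun A _ => ?_
          split_ifs <;> ring
      _ ≤ ∑ l, 2 * (k : ℝ) / p l * (1 / p l * γ) := by
          refine Finset.sum_le_sum fun l _ => ?_
          have := hpp l
          exact mul_le_mul_of_nonneg_left (H.sum_mem_sq_div_le l) (by positivity)
      _ = 2 * k * γ * ∑ l, (1 / (p l : ℝ)) ^ 2 := by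
          rw [Finset.mul_sum]
          refine Finset.sum_congr rfl fun l _ => ?_
          ring
      _ ≤ 2 * k * γ * (1 / (8 * (k : ℝ) ^ 2)) :=
          mul_le_mul_of_nonneg_left H.sum_sq (by positivity)
      _ = _ := by field_simp; ring
  have h2 : 2 / Real.log R * ∑ A, G A ^ 2 / modProd p A * ∑ l ∈ A, Real.log (p l) ≤
      1 / (4 * k) * γ := by
    refine (mul_le_mul_of_nonneg_left H.sum_log (by positivity)).trans_eq ?_
    rw [← hγ]
    field_simp
    ring
  calc ∑ A, G A ^ 2 / modProd p A * ∑ l ∈ A, goodCost k p R l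
      = ∑ A, G A ^ 2 / modProd p A * ∑ l ∈ A, 2 * (k : ℝ) / p l +
        2 / Real.log R * ∑ A, G A ^ 2 / modProd p A * ∑ l ∈ A, Real.log (p l) := by
        rw [Finset.mul_sum, ← Finset.sum_add_distrib]
        refine Finset.sum_congr rfl fun A _ => ?_
        simp_rw [goodCost]
        rw [Finset.sum_add_distrib, ← Finset.mul_sum]
        ring
    _ ≤ 1 / (4 * k) * γ + 1 / (4 * k) * γ := add_le_add h1 h2
    _ = _ := by field_simp; ring

open Classical in
theorem Admissible.le_sum_good (H : Admissible k p G R) (i : Fin k) :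
    (∑ A, G A ^ 2 / modProd p A) ^ (k - 1) / 4 ≤
      ∑ B : Fin k → Finset (Fin n) with GoodTuple (goodCost k p R) B,
        ∏ m, setDensity p G i m (B m) := by
  have hk : 1 ≤ k := i.pos
  have hk' : (1 : ℝ) ≤ k := by exact_mod_cast hk
  have hpp : ∀ l, (0 : ℝ) < p l := fun l => by exact_mod_cast H.pos l
  have h := le_sum_goodTuple (W := setDensity p G i) (c := goodCost k p R)
    (q := fun l => 1 / (p l : ℝ)) (e := 1 / (2 * k)) (H.setDensity_nonneg i) H.goodCost_nonneg
    (fun m l => by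
      rcases eq_or_ne m i with rfl | hm
      · have h0 : ∀ B : Finset (Fin n),
            setDensity p G m m B * (if l ∈ B then (1 : ℝ) else 0) = 0 := fun B => by
          rcases eq_or_ne B ∅ with rfl | hB
          · simp
          · simp [setDensity, hB]
        rw [Finset.sum_eq_zero fun B _ => h0 B]
        have := hpp l
        exact mul_nonneg (by positivity) (Finset.sum_nonneg fun B _ => H.setDensity_nonneg m m B)
      · simpa only [setDensity, if_neg hm] using H.sum_mem_sq_div_le l)
    (fun m => by
      rcases eq_or_ne m i with rfl | hm
      · simp [setDensity]
      · simpa only [setDensity, if_neg hm] using H.sum_goodCost_le hk)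
  refine le_trans ?_ h
  rw [prod_sum_setDensity]
  have hγ0 : 0 ≤ (∑ A, G A ^ 2 / modProd p A) ^ (k - 1) :=
    pow_nonneg (Finset.sum_nonneg fun A _ => H.sq_div_nonneg A) _
  have h1 : (k : ℝ) ^ 2 * ∑ l, (1 / (p l : ℝ)) ^ 2 ≤ 1 / 8 := by
    refine (mul_le_mul_of_nonneg_left H.sum_sq (by positivity)).trans_eq ?_
    field_simp
  have h2 : (k : ℝ) * (1 / (2 * k)) = 1 / 2 := by field_simp
  rw [h2, div_eq_inv_mul]
  exact mul_le_mul_of_nonneg_right (by linarith) hγ0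

/-- Lower bound for the mean square in the model where the `i`th shift is prime. -/
theorem Admissible.le_primeMean (H : Admissible k p G R) (hk : 2 ≤ k) (i : Fin k) :
    (∑ A, G A ^ 2 / modProd p A) ^ (k - 1) * (∑ A, G A / modProd p A) ^ 2 / 32 ≤
      primeMean i p (coeff p G R) := by
  classical
  have hpp : ∀ l, (0 : ℝ) < p l := fun l => by exact_mod_cast H.pos l
  have hkp : ∀ l, (k : ℝ) ≤ p l := fun l => by
    have := H.two_mul_le l
    exact_mod_cast (by omega : k ≤ p l)
  set m₁ := ∑ A, G A / modProd p A with hm₁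
  have hm0 : 0 ≤ m₁ := Finset.sum_nonneg fun A _ => div_nonneg (H.nonneg A) (modProd_pos H.pos A).le
  have hv0 : ∀ l (y : Option (Fin k)),
      0 ≤ y.elim (1 : ℝ) fun j => if j = i then 0 else (p l - k : ℝ) := by
    intro l y
    rcases y with _ | j
    · exact zero_le_one
    · simp only [Option.elim_some]
      split_ifs
      · exact le_rfl
      · linarith [hkp l]
  have h1 := sum_prod_mul_sq_le (n := n)
    (w := fun l (y : Option (Fin k)) => y.elim (1 : ℝ) fun j => if j = i then 0 else (p l - k : ℝ))
    (v := fun l x => primeWeight i (p l) x)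
    (A := fun l y t => seen i t y) (B := fun l x t => localFactor (p l) t x) hv0
    (fun l x => primeWeight_nonneg (by have := H.two_mul_le l; omega) i x)
    (fun l u => le_sum_primeWeight_mul_sq (by have := H.two_mul_le l; omega) i u) (coeff p G R)
  refine le_trans ?_ h1
  have h2 : ∀ y : Fin n → Option (Fin k), GoodTuple (goodCost k p R) (fiber y) →
      m₁ ^ 2 / 8 * ∏ m, setDensity p G i m (fiber y m) ≤
      (∏ l, (y l).elim (1 : ℝ) fun j => if j = i then 0 else (p l - k : ℝ)) *
        (∑ t, coeff p G R t * ∏ l, seen i (t l) (y l)) ^ 2 := by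
    intro y hy
    have hprod : ∏ m, setDensity p G i m (fiber y m) = (if fiber y i = ∅ then 1 else 0) *
        ∏ j ∈ Finset.univ.erase i, G (fiber y j) ^ 2 / modProd p (fiber y j) := by
      rw [← Finset.mul_prod_erase _ _ (Finset.mem_univ i)]
      congr 1
      · simp [setDensity]
      · refine Finset.prod_congr rfl fun j hj => ?_
        simp [setDensity, Finset.ne_of_mem_erase hj]
    rw [hprod]
    split_ifs with hyi
    swap
    · rw [zero_mul, mul_zero]
      exact mul_nonneg (Finset.prod_nonneg fun l _ => hv0 l _) (sq_nonneg _)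
    obtain ⟨hc1, -⟩ := H.cost_bounds hy
    have h3 := H.le_inner_sum (by omega) i hyi hy
    rw [← hm₁] at h3
    set Q := ∏ j ∈ Finset.univ.erase i, G (fiber y j) / modProd p (fiber y j) with hQ
    have hQ0 : 0 ≤ Q :=
      Finset.prod_nonneg fun j _ => div_nonneg (H.nonneg _) (modProd_pos H.pos _).le
    have hs : size p y = ∏ j ∈ Finset.univ.erase i, modProd p (fiber y j) := by
      rw [← prod_modProd_fiber, ← Finset.mul_prod_erase _ _ (Finset.mem_univ i), hyi]
      simp [modProd]
    have h4 : size p y / 2 ≤ ∏ l, (y l).elim (1 : ℝ) fun j => if j = i then 0 else (p l - k : ℝ) := by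
      have e1 : (∏ l, (y l).elim (1 : ℝ) fun j => if j = i then 0 else (p l - k : ℝ)) =
          size p y * ∏ l with y l ≠ none, (1 - (k : ℝ) / p l) := by
        rw [size, Finset.prod_filter, ← Finset.prod_mul_distrib]
        refine Finset.prod_congr rfl fun l _ => ?_
        rcases hyl : y l with _ | j
        · simp
        · have hj : j ≠ i := by
            rintro rfl
            have : l ∈ fiber y j := mem_fiber.2 hyl
            rw [hyi] at this
            simp at this
          have := (hpp l).ne'
          simp only [Option.elim_some, if_neg hj, ne_eq, reduceCtorEq, not_false_eq_true, if_true]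
          field_simp
      rw [e1, div_eq_mul_inv]
      refine mul_le_mul_of_nonneg_left ?_ (size_pos H.pos y).le
      refine le_trans (by norm_num; linarith) (one_sub_sum_le_prod_one_sub _ (fun l _ => ?_) fun l _ => ?_)
      · have := hpp l
        positivity
      · exact (div_le_one (hpp l)).2 (hkp l)
    have h5 : ∏ j ∈ Finset.univ.erase i, G (fiber y j) ^ 2 / modProd p (fiber y j) =
        size p y * Q ^ 2 := by
      rw [hs, hQ, ← Finset.prod_pow, ← Finset.prod_mul_distrib]
      refine Finset.prod_congr rfl fun j _ => ?_
      have := (modProd_pos H.pos (fiber y j)).ne'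
      field_simp
    calc m₁ ^ 2 / 8 * (1 * ∏ j ∈ Finset.univ.erase i, G (fiber y j) ^ 2 / modProd p (fiber y j))
        = size p y / 2 * (Q * (m₁ / 2)) ^ 2 := by rw [h5]; ring
      _ ≤ _ := by
        refine mul_le_mul h4 (pow_le_pow_left₀ (by positivity) h3 2) (sq_nonneg _) ?_
        exact Finset.prod_nonneg fun l _ => hv0 l _
  calc _ = m₁ ^ 2 / 8 * ((∑ A, G A ^ 2 / modProd p A) ^ (k - 1) / 4) := by ring
    _ ≤ m₁ ^ 2 / 8 * ∑ B : Fin k → Finset (Fin n) with GoodTuple (goodCost k p R) B,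
        ∏ m, setDensity p G i m (B m) :=
      mul_le_mul_of_nonneg_left (H.le_sum_good i) (by positivity)
    _ ≤ m₁ ^ 2 / 8 * ∑ y : Fin n → Option (Fin k) with GoodTuple (goodCost k p R) (fiber y),
        ∏ m, setDensity p G i m (fiber y m) := by
      refine mul_le_mul_of_nonneg_left ?_ (by positivity)
      rw [← Finset.sum_image (g := fiber)
        (f := fun B : Fin k → Finset (Fin n) => ∏ m, setDensity p G i m (B m))
        fun a _ b _ h => fiber_injective h]
      refine Finset.sum_le_sum_of_subset_of_nonneg (fun B hB => ?_) fun B _ _ =>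
        Finset.prod_nonneg fun m _ => H.setDensity_nonneg i m _
      have hB := (Finset.mem_filter.1 hB).2
      obtain ⟨α, rfl⟩ := exists_fiber_eq hB.1
      exact Finset.mem_image.2 ⟨α, Finset.mem_filter.2 ⟨Finset.mem_univ _, hB⟩, rfl⟩
    _ ≤ ∑ y : Fin n → Option (Fin k) with GoodTuple (goodCost k p R) (fiber y),
        (∏ l, (y l).elim (1 : ℝ) fun j => if j = i then 0 else (p l - k : ℝ)) *
        (∑ t, coeff p G R t * ∏ l, seen i (t l) (y l)) ^ 2 := by
      rw [Finset.mul_sum]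
      exact Finset.sum_le_sum fun y hy => h2 y (Finset.mem_filter.1 hy).2
    _ ≤ _ := Finset.sum_le_sum_of_subset_of_nonneg (Finset.filter_subset _ _) fun y _ _ =>
        mul_nonneg (Finset.prod_nonneg fun l _ => hv0 l _) (sq_nonneg _)

end TupleSieve

/-- The sum of the reciprocals of the squarefree integers up to `x` that are coprime to `W`. -/
noncomputable def squarefreeSum (W : ℕ) (x : ℝ) : ℝ :=
  ∑ r ∈ Finset.Icc 1 ⌊x⌋₊ with Squarefree r ∧ W.Coprime r, 1 / (r : ℝ)

namespace CoprimeSum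

theorem block_bounds {W : ℕ} (hW : 0 < W) {n : ℕ} :
    (W.totient : ℝ) / (n + W) ≤ ∑ m ∈ Finset.Ico (n + 1) (n + 1 + W) with W.Coprime m, 1 / (m : ℝ) ∧
      ∑ m ∈ Finset.Ico (n + 1) (n + 1 + W) with W.Coprime m, 1 / (m : ℝ) ≤
        (W.totient : ℝ) / (n + 1) := by
  have hcard := Nat.filter_coprime_Ico_eq_totient W (n + 1)
  have hW' : (0 : ℝ) < W := by exact_mod_cast hW
  constructor
  · rw [← hcard, div_eq_mul_one_div, ← nsmul_eq_mul]
    refine Finset.card_nsmul_le_sum _ _ _ fun m hm => ?_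
    have hm := Finset.mem_Ico.1 (Finset.mem_filter.1 hm).1
    have h1 : (0 : ℝ) < m := by exact_mod_cast (by omega : 0 < m)
    have h2 : (m : ℝ) ≤ n + W := by exact_mod_cast (by omega : m ≤ n + W)
    gcongr
  · rw [← hcard, div_eq_mul_one_div, ← nsmul_eq_mul]
    refine Finset.sum_le_card_nsmul _ _ _ fun m hm => ?_
    have hm := Finset.mem_Ico.1 (Finset.mem_filter.1 hm).1
    have h2 : (n : ℝ) + 1 ≤ m := by exact_mod_cast hm.1
    gcongr

theorem sum_Ico_succ_block (W Q : ℕ) :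
    ∑ m ∈ Finset.Ico 1 (W * (Q + 1) + 1) with W.Coprime m, 1 / (m : ℝ) =
      ∑ m ∈ Finset.Ico 1 (W * Q + 1) with W.Coprime m, 1 / (m : ℝ) +
      ∑ m ∈ Finset.Ico (W * Q + 1) (W * Q + 1 + W) with W.Coprime m, 1 / (m : ℝ) := by
  rw [show W * (Q + 1) + 1 = W * Q + 1 + W by ring]
  simp_rw [Finset.sum_filter]
  rw [Finset.sum_Ico_consecutive _ (by omega) (by omega)]

theorem mul_harmonic_le {W : ℕ} (hW : 0 < W) (Q : ℕ) :
    (W.totient / W : ℝ) * (harmonic Q : ℝ) ≤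
      ∑ m ∈ Finset.Ico 1 (W * Q + 1) with W.Coprime m, 1 / (m : ℝ) := by
  have hW' : (0 : ℝ) < W := by exact_mod_cast hW
  induction Q with
  | zero => simp
  | succ Q ih =>
    rw [sum_Ico_succ_block, harmonic_succ]
    push_cast
    rw [mul_add]
    refine add_le_add ih (le_trans (le_of_eq ?_) (block_bounds hW (n := W * Q)).1)
    push_cast
    field_simp

theorem le_add_mul_harmonic {W : ℕ} (hW : 0 < W) (Q : ℕ) :
    ∑ m ∈ Finset.Ico 1 (W * (Q + 1) + 1) with W.Coprime m, 1 / (m : ℝ) ≤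
      W + (W.totient / W : ℝ) * (harmonic Q : ℝ) := by
  have hW' : (0 : ℝ) < W := by exact_mod_cast hW
  induction Q with
  | zero =>
    rw [sum_Ico_succ_block]
    have h := (block_bounds hW (n := W * 0)).2
    have h2 : (W.totient : ℝ) ≤ W := by exact_mod_cast Nat.totient_le W
    simp at h ⊢
    linarith
  | succ Q ih =>
    rw [sum_Ico_succ_block, harmonic_succ]
    push_cast
    rw [mul_add (W.totient / W : ℝ), ← add_assoc]
    refine add_le_add ih ((block_bounds hW (n := W * (Q + 1))).2.trans ?_)
    push_cast
    rw [← div_eq_mul_inv, div_div]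
    gcongr
    linarith

theorem sum_inv_sq_le (s : Finset ℕ) : ∑ b ∈ s, 1 / (b : ℝ) ^ 2 ≤ 5 / 3 := by
  refine (sum_le_hasSum s (fun b _ => by positivity) hasSum_zeta_two).trans ?_
  have := Real.pi_lt_d2
  have := Real.pi_pos
  nlinarith

theorem sum_coprime_le_mul_squarefreeSum {W : ℕ} (x : ℝ) :
    ∑ m ∈ Finset.Icc 1 ⌊x⌋₊ with W.Coprime m, 1 / (m : ℝ) ≤ 5 / 3 * squarefreeSum W x := by
  classical
  have h : ∀ m : ℕ, ∃ ba : ℕ × ℕ, ba.1 ^ 2 * ba.2 = m ∧ Squarefree ba.2 := fun m => by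
    obtain ⟨a, b, h⟩ := Nat.sq_mul_squarefree m
    exact ⟨(b, a), h⟩
  choose f hf1 hf2 using h
  set S := Finset.Icc 1 ⌊x⌋₊
  set F : ℕ × ℕ → ℝ := fun ba => 1 / (ba.1 : ℝ) ^ 2 * (1 / (ba.2 : ℝ))
  calc ∑ m ∈ S with W.Coprime m, 1 / (m : ℝ) = ∑ m ∈ S with W.Coprime m, F (f m) := by
        refine Finset.sum_congr rfl fun m _ => ?_
        change _ = 1 / ((f m).1 : ℝ) ^ 2 * (1 / ((f m).2 : ℝ))
        rw [one_div_mul_one_div]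
        congr 1
        exact_mod_cast (hf1 m).symm
    _ = ∑ ba ∈ (S.filter W.Coprime).image f, F ba := by
        rw [Finset.sum_image]
        intro m _ m' _ h
        rw [← hf1 m, ← hf1 m', h]
    _ ≤ ∑ ba ∈ S ×ˢ (S.filter fun r => Squarefree r ∧ W.Coprime r), F ba := by
        refine Finset.sum_le_sum_of_subset_of_nonneg (fun ba hba => ?_) fun ba _ _ => by positivity
        obtain ⟨m, hm, rfl⟩ := Finset.mem_image.1 hba
        obtain ⟨hmS, hmW⟩ := Finset.mem_filter.1 hm
        have hm := Finset.mem_Icc.1 hmS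
        have e := hf1 m
        have h1 : (f m).1 ≠ 0 := fun h0 => by rw [h0] at e; simp at e; omega
        have h2 : (f m).2 ≠ 0 := fun h0 => by rw [h0] at e; simp at e; omega
        have d1 : (f m).1 ∣ m := ⟨(f m).1 * (f m).2, by rw [← mul_assoc, ← sq, e]⟩
        have d2 : (f m).2 ∣ m := ⟨(f m).1 ^ 2, by rw [mul_comm, e]⟩
        have l1 := Nat.le_of_dvd (by omega) d1
        have l2 := Nat.le_of_dvd (by omega) d2
        refine Finset.mem_product.2 ⟨Finset.mem_Icc.2 (by omega), Finset.mem_filter.2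
          ⟨Finset.mem_Icc.2 (by omega), hf2 m, hmW.coprime_dvd_right d2⟩⟩
    _ = (∑ b ∈ S, 1 / (b : ℝ) ^ 2) * squarefreeSum W x := by
        rw [Finset.sum_product, squarefreeSum, Finset.sum_mul_sum]
    _ ≤ _ := mul_le_mul_of_nonneg_right (sum_inv_sq_le S)
        (Finset.sum_nonneg fun r _ => by positivity)

end CoprimeSum

open CoprimeSum Filter in
/-- The reciprocal sum over squarefree integers has the expected logarithmic order. -/
theorem eventually_squarefreeSum_bounds {W : ℕ} (hW : 0 < W) :
    ∀ᶠ x : ℝ in atTop, (W.totient / W : ℝ) * Real.log x / 2 ≤ squarefreeSum W x ∧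
      squarefreeSum W x ≤ 2 * (W.totient / W : ℝ) * Real.log x := by
  have hW' : (0 : ℝ) < W := by exact_mod_cast hW
  have hℓ : 0 < (W.totient / W : ℝ) := by
    have : (0 : ℝ) < W.totient := by exact_mod_cast Nat.totient_pos.2 hW
    positivity
  set ℓ : ℝ := W.totient / W with hℓ'
  have hlog := Real.tendsto_log_atTop
  filter_upwards [hlog.eventually_ge_atTop (W / ℓ + 1), hlog.eventually_ge_atTop (6 * Real.log W),
    eventually_ge_atTop (W : ℝ), eventually_ge_atTop (1 : ℝ)] with x h1 h2 h3 h4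
  set X := ⌊x⌋₊ with hX
  set Q := X / W with hQ
  have hXW : W * Q ≤ X := Nat.mul_div_le X W
  have hXW2 : X < W * (Q + 1) := Nat.lt_mul_div_succ X hW
  have hx1 : x < X + 1 := Nat.lt_floor_add_one x
  have hx2 : (X : ℝ) ≤ x := Nat.floor_le (by linarith)
  constructor
  · have e1 := (mul_harmonic_le hW Q).trans (Finset.sum_le_sum_of_subset_of_nonneg
      (t := (Finset.Icc 1 X).filter W.Coprime) (fun m hm => by
        rw [Finset.mem_filter, Finset.mem_Ico] at hm
        rw [Finset.mem_filter, Finset.mem_Icc]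
        exact ⟨by omega, hm.2⟩) fun m _ _ => by positivity)
    have e2 := sum_coprime_le_mul_squarefreeSum (W := W) x
    have e3 := log_add_one_le_harmonic Q
    have e4 : Real.log x - Real.log W ≤ Real.log ((Q + 1 : ℕ) : ℝ) := by
      rw [← Real.log_div (by linarith) hW'.ne']
      refine Real.log_le_log (by positivity) ?_
      rw [div_le_iff₀ hW']
      have : ((X + 1 : ℕ) : ℝ) ≤ ((W * (Q + 1) : ℕ) : ℝ) := by exact_mod_cast hXW2
      push_cast at this ⊢
      linarith
    have e5 := mul_le_mul_of_nonneg_left (e4.trans e3) hℓ.le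
    have e6 : ℓ * (6 * Real.log W) ≤ ℓ * Real.log x := mul_le_mul_of_nonneg_left h2 hℓ.le
    nlinarith
  · have e1 : squarefreeSum W x ≤
        ∑ m ∈ Finset.Ico 1 (W * (Q + 1) + 1) with W.Coprime m, 1 / (m : ℝ) := by
      refine Finset.sum_le_sum_of_subset_of_nonneg (fun m hm => ?_) fun m _ _ => by positivity
      rw [Finset.mem_filter, Finset.mem_Icc] at hm
      rw [Finset.mem_filter, Finset.mem_Ico]
      exact ⟨by omega, hm.2.2⟩
    have e2 := e1.trans (le_add_mul_harmonic hW Q)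
    have e3 := harmonic_le_one_add_log Q
    have e4 : Real.log Q ≤ Real.log x := by
      have hQ0 : 0 < Q := Nat.div_pos (Nat.le_floor h3) hW
      refine Real.log_le_log (by exact_mod_cast hQ0) ?_
      have : (Q : ℝ) ≤ X := by exact_mod_cast Nat.div_le_self X W
      linarith
    have e5 : ℓ * (harmonic Q : ℝ) ≤ ℓ * (1 + Real.log x) :=
      mul_le_mul_of_nonneg_left (e3.trans (by linarith)) hℓ.le
    have e6 : (W : ℝ) + ℓ ≤ ℓ * Real.log x := by
      have := mul_le_mul_of_nonneg_left h1 hℓ.le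
      rw [mul_add, mul_div_cancel₀ _ hℓ.ne', mul_one] at this
      exact this
    linarith

namespace TupleSieve

variable {k n : ℕ}

theorem sq_sum_half_pow_le (u : ℕ → ℝ) (hu : ∀ t, u t = 0 ∨ u t = 1) (I : ℕ) :
    (∑ t ∈ Finset.range I, (1 / 2 : ℝ) ^ t * u t) ^ 2 ≤
      4 * ∑ t ∈ Finset.range I, (1 / 4 : ℝ) ^ t * u t := by
  induction I generalizing u with
  | zero => simp
  | succ I ih =>
    have h := ih (fun t => u (t + 1)) fun t => hu (t + 1)
    rw [Finset.sum_range_succ', Finset.sum_range_succ']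
    have e1 : ∑ t ∈ Finset.range I, (1 / 2 : ℝ) ^ (t + 1) * u (t + 1) =
        1 / 2 * ∑ t ∈ Finset.range I, (1 / 2 : ℝ) ^ t * u (t + 1) := by
      rw [Finset.mul_sum]
      exact Finset.sum_congr rfl fun t _ => by ring
    have e2 : ∑ t ∈ Finset.range I, (1 / 4 : ℝ) ^ (t + 1) * u (t + 1) =
        1 / 4 * ∑ t ∈ Finset.range I, (1 / 4 : ℝ) ^ t * u (t + 1) := by
      rw [Finset.mul_sum]
      exact Finset.sum_congr rfl fun t _ => by ring
    rw [e1, e2]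
    have h0 : ∀ t, 0 ≤ u t ∧ u t ≤ 1 := fun t => by rcases hu t with h | h <;> rw [h] <;> norm_num
    have h2 : ∑ t ∈ Finset.range I, (1 / 2 : ℝ) ^ t * u (t + 1) ≤ 2 := by
      refine le_trans ?_ (sum_geometric_two_le I)
      exact Finset.sum_le_sum fun t _ => mul_le_of_le_one_right (by positivity) (h0 _).2
    have h3 : 0 ≤ ∑ t ∈ Finset.range I, (1 / 2 : ℝ) ^ t * u (t + 1) :=
      Finset.sum_nonneg fun t _ => mul_nonneg (by positivity) (h0 _).1
    have h4 : 0 ≤ ∑ t ∈ Finset.range I, (1 / 4 : ℝ) ^ t * u (t + 1) :=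
      Finset.sum_nonneg fun t _ => mul_nonneg (by positivity) (h0 _).1
    rcases hu 0 with h0' | h0' <;> rw [h0'] <;> nlinarith

/-- The `t`th truncation level. -/
noncomputable def level (I : ℕ) (R : ℝ) (t : ℕ) : ℝ := R ^ ((2 : ℝ) ^ t / 2 ^ (I + 1))

/-- The smoothing function, a combination of cutoffs at geometrically spaced logarithmic scales. -/
noncomputable def levelWeight (I : ℕ) (R x : ℝ) : ℝ :=
  ∑ t ∈ Finset.range (I + 1), (1 / 2 : ℝ) ^ t * if x ≤ level I R t then 1 else 0

theorem levelWeight_nonneg (I : ℕ) (R x : ℝ) : 0 ≤ levelWeight I R x :=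
  Finset.sum_nonneg fun t _ => mul_nonneg (by positivity) (by split_ifs <;> norm_num)

theorem levelWeight_le_two (I : ℕ) (R x : ℝ) : levelWeight I R x ≤ 2 := by
  refine le_trans ?_ (sum_geometric_two_le (I + 1))
  exact Finset.sum_le_sum fun t _ => mul_le_of_le_one_right (by positivity)
    (by split_ifs <;> norm_num)

theorem levelWeight_antitone (I : ℕ) (R : ℝ) : Antitone (levelWeight I R) := by
  intro x y h
  refine Finset.sum_le_sum fun t _ => mul_le_mul_of_nonneg_left ?_ (by positivity)
  split_ifs <;> linarith

theorem levelWeight_sq_le (I : ℕ) (R x : ℝ) : levelWeight I R x ^ 2 ≤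
    4 * ∑ t ∈ Finset.range (I + 1), (1 / 4 : ℝ) ^ t * if x ≤ level I R t then 1 else 0 :=
  sq_sum_half_pow_le _ (fun t => by split_ifs <;> simp) _

theorem level_sq_le {I : ℕ} {R : ℝ} (hR : 1 ≤ R) {t : ℕ} (ht : t ≤ I) : level I R t ^ 2 ≤ R := by
  rw [level, ← Real.rpow_natCast, ← Real.rpow_mul (by linarith)]
  refine (Real.rpow_le_rpow_of_exponent_le hR ?_).trans_eq (Real.rpow_one R)
  have : (2 : ℝ) ^ t ≤ 2 ^ I := pow_le_pow_right₀ one_le_two ht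
  rw [div_mul_eq_mul_div, div_le_one (by positivity), pow_succ]
  push_cast
  linarith

theorem log_level {I : ℕ} {R : ℝ} (hR : 0 < R) (t : ℕ) :
    Real.log (level I R t) = 2 ^ t / 2 ^ (I + 1) * Real.log R :=
  Real.log_rpow hR _

theorem levelWeight_ne_zero {I : ℕ} {R x : ℝ} (hR : 1 ≤ R) (hx : 0 ≤ x)
    (h : levelWeight I R x ≠ 0) : x ^ 2 ≤ R := by
  obtain ⟨t, ht, h⟩ := Finset.exists_ne_zero_of_sum_ne_zero h
  have h : x ≤ level I R t := by
    by_contra h'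
    exact h (by rw [if_neg h', mul_zero])
  exact (pow_le_pow_left₀ hx h 2).trans
    (level_sq_le hR (Nat.lt_succ_iff.1 (Finset.mem_range.1 ht)))

section moments
variable {ι : Type*} [Fintype ι] {N : ι → ℝ} {I : ℕ} {R c : ℝ}

theorem sum_div_mul_eq (F : ℕ → ℝ) : ∑ A, (∑ t ∈ Finset.range (I + 1), F t *
    if N A ≤ level I R t then 1 else 0) / N A = ∑ t ∈ Finset.range (I + 1),
      F t * ∑ A, (if N A ≤ level I R t then 1 else 0) / N A := by
  simp_rw [Finset.sum_div, Finset.mul_sum]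
  rw [Finset.sum_comm]
  simp_rw [mul_div_assoc]

theorem sum_levelWeight_sq_div_le (hN : ∀ A, 0 < N A) (hc : 0 ≤ c)
    (hV : ∀ t ≤ I, ∑ A, (if N A ≤ level I R t then 1 else 0) / N A ≤ 2 * c * 2 ^ t) :
    ∑ A, levelWeight I R (N A) ^ 2 / N A ≤ 16 * c := by
  calc ∑ A, levelWeight I R (N A) ^ 2 / N A ≤ ∑ A, 4 * ((∑ t ∈ Finset.range (I + 1),
        (1 / 4 : ℝ) ^ t * if N A ≤ level I R t then 1 else 0) / N A) := by
        refine Finset.sum_le_sum fun A _ => ?_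
        rw [← mul_div_assoc]
        exact div_le_div_of_nonneg_right (levelWeight_sq_le I R _) (hN A).le
    _ ≤ 4 * ∑ t ∈ Finset.range (I + 1), (1 / 4 : ℝ) ^ t * (2 * c * 2 ^ t) := by
        rw [← Finset.mul_sum, sum_div_mul_eq]
        gcongr with t ht
        exact hV t (Nat.lt_succ_iff.1 (Finset.mem_range.1 ht))
    _ = 8 * c * ∑ t ∈ Finset.range (I + 1), (1 / 2 : ℝ) ^ t := by
        rw [Finset.mul_sum, Finset.mul_sum]
        refine Finset.sum_congr rfl fun t _ => ?_
        have : (1 / 4 : ℝ) ^ t * 2 ^ t = (1 / 2) ^ t := by rw [← mul_pow]; norm_num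
        linear_combination 8 * c * this
    _ ≤ 8 * c * 2 := mul_le_mul_of_nonneg_left (sum_geometric_two_le _) (by positivity)
    _ = _ := by ring

theorem le_sum_levelWeight_sq_div (hN : ∀ A, 0 < N A)
    (hV : c / 2 ≤ ∑ A, (if N A ≤ level I R 0 then 1 else 0) / N A) :
    c / 2 ≤ ∑ A, levelWeight I R (N A) ^ 2 / N A := by
  refine hV.trans (Finset.sum_le_sum fun A _ => div_le_div_of_nonneg_right ?_ (hN A).le)
  have h : (if N A ≤ level I R 0 then (1 : ℝ) else 0) ≤ levelWeight I R (N A) := by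
    have := Finset.single_le_sum (f := fun t => (1 / 2 : ℝ) ^ t *
      if N A ≤ level I R t then 1 else 0) (s := Finset.range (I + 1))
      (fun t _ => mul_nonneg (by positivity) (by split_ifs <;> norm_num))
      (Finset.mem_range.2 (Nat.succ_pos I))
    rwa [pow_zero, one_mul] at this
  split_ifs at h ⊢
  · nlinarith
  · positivity

theorem le_sum_levelWeight_div
    (hV : ∀ t ≤ I, c * 2 ^ t / 2 ≤ ∑ A, (if N A ≤ level I R t then 1 else 0) / N A) :
    (I + 1) * (c / 2) ≤ ∑ A, levelWeight I R (N A) / N A := by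
  simp_rw [levelWeight]
  rw [sum_div_mul_eq]
  calc ((I : ℝ) + 1) * (c / 2) = ∑ t ∈ Finset.range (I + 1), (1 / 2 : ℝ) ^ t * (c * 2 ^ t / 2) := by
        rw [Finset.sum_congr rfl fun t _ => show (1 / 2 : ℝ) ^ t * (c * 2 ^ t / 2) = c / 2 by
          have : (1 / 2 : ℝ) ^ t * 2 ^ t = 1 := by rw [← mul_pow]; norm_num
          linear_combination c / 2 * this]
        simp
    _ ≤ _ := by
        gcongr with t ht
        exact hV t (Nat.lt_succ_iff.1 (Finset.mem_range.1 ht))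

theorem sum_levelWeight_sq_div_mul_log_le (hN : ∀ A, 1 ≤ N A) (hR : 1 ≤ R)
    (hV : ∀ t ≤ I, ∑ A, (if N A ≤ level I R t then 1 else 0) / N A ≤ 2 * c * 2 ^ t) :
    ∑ A, levelWeight I R (N A) ^ 2 / N A * Real.log (N A) ≤
      8 * (I + 1) * c * (Real.log R / 2 ^ (I + 1)) := by
  have hL := Real.log_nonneg hR
  have hN0 : ∀ A, 0 < N A := fun A => zero_lt_one.trans_le (hN A)
  calc ∑ A, levelWeight I R (N A) ^ 2 / N A * Real.log (N A)
      ≤ ∑ A, 4 * ((∑ t ∈ Finset.range (I + 1),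
        ((1 / 4 : ℝ) ^ t * (2 ^ t / 2 ^ (I + 1) * Real.log R)) *
          if N A ≤ level I R t then 1 else 0) / N A) := by
        refine Finset.sum_le_sum fun A _ => ?_
        rw [← mul_div_assoc, div_mul_eq_mul_div]
        refine div_le_div_of_nonneg_right ?_ (hN0 A).le
        refine (mul_le_mul_of_nonneg_right (levelWeight_sq_le I R _)
          (Real.log_nonneg (hN A))).trans ?_
        rw [mul_assoc, Finset.sum_mul]
        refine mul_le_mul_of_nonneg_left (Finset.sum_le_sum fun t _ => ?_) (by norm_num)
        split_ifs with h
        · have h1 : Real.log (N A) ≤ _ := (Real.log_le_log (hN0 A) h).trans_eq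
            (log_level (by linarith) t)
          rw [mul_one, mul_one]
          gcongr
        · simp
    _ ≤ 4 * ∑ t ∈ Finset.range (I + 1),
        ((1 / 4 : ℝ) ^ t * (2 ^ t / 2 ^ (I + 1) * Real.log R)) * (2 * c * 2 ^ t) := by
        rw [← Finset.mul_sum, sum_div_mul_eq]
        gcongr with t ht
        exact hV t (Nat.lt_succ_iff.1 (Finset.mem_range.1 ht))
    _ = _ := by
        rw [Finset.sum_congr rfl fun t _ => show
          ((1 / 4 : ℝ) ^ t * (2 ^ t / 2 ^ (I + 1) * Real.log R)) * (2 * c * 2 ^ t) =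
            2 * c * (Real.log R / 2 ^ (I + 1)) by
          have : (1 / 4 : ℝ) ^ t * 2 ^ t * 2 ^ t = 1 := by rw [← mul_pow, ← mul_pow]; norm_num
          linear_combination 2 * c * (Real.log R / 2 ^ (I + 1)) * this]
        simp
        ring

end moments

end TupleSieve

namespace TupleSieve

open Filter

variable {k n : ℕ}

/-- An enumeration of the primes up to `R` that do not divide `W`. -/
structure PrimeList (W : ℕ) (R : ℝ) (p : Fin n → ℕ) : Prop where
  injective : Function.Injective p
  prime : ∀ l, (p l).Prime
  not_dvd : ∀ l, ¬ p l ∣ W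
  le : ∀ l, (p l : ℝ) ≤ R
  complete : ∀ q : ℕ, q.Prime → ¬ q ∣ W → (q : ℝ) ≤ R → ∃ l, p l = q

theorem exists_primeList (W : ℕ) {R : ℝ} (hR : 0 ≤ R) :
    ∃ n, ∃ p : Fin n → ℕ, PrimeList W R p := by
  set P := (Finset.range (⌊R⌋₊ + 1)).filter fun q => q.Prime ∧ ¬ q ∣ W with hP
  have hmem : ∀ q, q ∈ P ↔ (q : ℝ) ≤ R ∧ q.Prime ∧ ¬ q ∣ W := fun q => by
    rw [hP, Finset.mem_filter, Finset.mem_range, Nat.lt_succ_iff, Nat.le_floor_iff hR]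
  refine ⟨P.card, fun l => (P.equivFin.symm l).1, ?_, ?_, ?_, ?_, ?_⟩
  · exact Subtype.val_injective.comp P.equivFin.symm.injective
  · exact fun l => ((hmem _).1 (P.equivFin.symm l).2).2.1
  · exact fun l => ((hmem _).1 (P.equivFin.symm l).2).2.2
  · exact fun l => ((hmem _).1 (P.equivFin.symm l).2).1
  · exact fun q h1 h2 h3 => ⟨P.equivFin ⟨q, (hmem q).2 ⟨h3, h1, h2⟩⟩, by simp⟩

namespace PrimeList

variable {W : ℕ} {R : ℝ} {p : Fin n → ℕ}

theorem dvd_prod_iff (h : PrimeList W R p) {l : Fin n} {A : Finset (Fin n)} :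
    p l ∣ ∏ m ∈ A, p m ↔ l ∈ A := by
  rw [(h.prime l).prime.dvd_finsetProd_iff]
  constructor
  · rintro ⟨m, hm, hd⟩
    rwa [h.injective ((Nat.prime_dvd_prime_iff_eq (h.prime l) (h.prime m)).1 hd)]
  · exact fun hl => ⟨l, hl, dvd_rfl⟩

theorem squarefree_prod (h : PrimeList W R p) (A : Finset (Fin n)) :
    Squarefree (∏ m ∈ A, p m) := by
  classical
  induction A using Finset.induction_on with
  | empty => simp
  | insert a A ha ih =>
    rw [Finset.prod_insert ha, Nat.squarefree_mul]
    · exact ⟨(h.prime a).squarefree, ih⟩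
    · exact (Nat.Prime.coprime_iff_not_dvd (h.prime a)).2 fun hd => ha (h.dvd_prod_iff.1 hd)

theorem coprime_prod (h : PrimeList W R p) (A : Finset (Fin n)) : W.Coprime (∏ m ∈ A, p m) :=
  Nat.Coprime.prod_right fun l _ =>
    ((Nat.Prime.coprime_iff_not_dvd (h.prime l)).2 (h.not_dvd l)).symm

theorem prod_filter_dvd (h : PrimeList W R p) {r : ℕ} (hr : Squarefree r) (hW : W.Coprime r)
    (hR : (r : ℝ) ≤ R) : ∏ l with p l ∣ r, p l = r := by
  rw [← Finset.prod_image (f := fun q : ℕ => q) (g := p) h.injective.injOn]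
  conv_rhs => rw [← Nat.prod_primeFactors_of_squarefree hr]
  refine Finset.prod_congr ?_ fun _ _ => rfl
  ext q
  rw [Finset.mem_image, Nat.mem_primeFactors]
  constructor
  · rintro ⟨l, hl, rfl⟩
    exact ⟨h.prime l, (Finset.mem_filter.1 hl).2, hr.ne_zero⟩
  · rintro ⟨hq, hd, h0⟩
    obtain ⟨l, rfl⟩ := h.complete q hq
      (fun hqW => hq.one_lt.ne' (Nat.eq_one_of_dvd_coprimes hW hqW hd))
      ((Nat.cast_le.2 (Nat.le_of_dvd (Nat.pos_of_ne_zero h0) hd)).trans hR)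
    exact ⟨l, Finset.mem_filter.2 ⟨Finset.mem_univ _, hd⟩, rfl⟩

theorem modProd_eq (p : Fin n → ℕ) (A : Finset (Fin n)) :
    modProd p A = ((∏ m ∈ A, p m : ℕ) : ℝ) := by
  rw [modProd, Nat.cast_prod]

theorem sum_modProd_eq (h : PrimeList W R p) {x : ℝ} (hx0 : 0 ≤ x) (hx : x ≤ R) :
    ∑ A, (if modProd p A ≤ x then 1 else 0) / modProd p A = squarefreeSum W x := by
  simp_rw [ite_div, zero_div, modProd_eq]
  rw [← Finset.sum_filter, squarefreeSum]
  refine Finset.sum_bij' (fun A _ => ∏ m ∈ A, p m) (fun r _ => Finset.univ.filter (p · ∣ r))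
    ?_ ?_ ?_ ?_ ?_
  · intro A hA
    rw [Finset.mem_filter, Finset.mem_Icc, Nat.le_floor_iff hx0]
    exact ⟨⟨Nat.one_le_iff_ne_zero.2 (h.squarefree_prod A).ne_zero, (Finset.mem_filter.1 hA).2⟩,
      h.squarefree_prod A, h.coprime_prod A⟩
  · intro r hr
    rw [Finset.mem_filter, Finset.mem_Icc, Nat.le_floor_iff hx0] at hr
    rw [Finset.mem_filter, h.prod_filter_dvd hr.2.1 hr.2.2 (hr.1.2.trans hx)]
    exact ⟨Finset.mem_univ _, hr.1.2⟩
  · intro A hA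
    ext l
    simp [h.dvd_prod_iff]
  · intro r hr
    rw [Finset.mem_filter, Finset.mem_Icc, Nat.le_floor_iff hx0] at hr
    exact h.prod_filter_dvd hr.2.1 hr.2.2 (hr.1.2.trans hx)
  · exact fun A hA => rfl

theorem sum_sq_inv_le (h : PrimeList W R p) {D : ℕ} (hD : D ≠ 0)
    (hWD : ∀ q : ℕ, q.Prime → q ≤ D → q ∣ W) : ∑ l, (1 / (p l : ℝ)) ^ 2 ≤ 1 / (D : ℝ) := by
  have hlt : ∀ l, D < p l := fun l => by
    by_contra hl
    exact h.not_dvd l (hWD _ (h.prime l) (not_lt.1 hl))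
  obtain ⟨M, hM⟩ : ∃ M, ∀ l, p l ≤ M := ⟨∑ l, p l, fun l =>
    Finset.single_le_sum (fun _ _ => Nat.zero_le _) (Finset.mem_univ l)⟩
  calc ∑ l, (1 / (p l : ℝ)) ^ 2 = ∑ q ∈ Finset.univ.image p, ((q : ℝ) ^ 2)⁻¹ := by
        rw [Finset.sum_image h.injective.injOn]
        exact Finset.sum_congr rfl fun l _ => by rw [one_div, inv_pow]
    _ ≤ ∑ q ∈ Finset.Ioc D (max D M), ((q : ℝ) ^ 2)⁻¹ := by
        refine Finset.sum_le_sum_of_subset_of_nonneg (fun q hq => ?_) fun _ _ _ => by positivity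
        obtain ⟨l, -, rfl⟩ := Finset.mem_image.1 hq
        exact Finset.mem_Ioc.2 ⟨hlt l, (hM l).trans (le_max_right _ _)⟩
    _ ≤ (D : ℝ)⁻¹ - ((max D M : ℕ) : ℝ)⁻¹ := sum_Ioc_inv_sq_le_sub hD (le_max_left _ _)
    _ ≤ 1 / D := by
        rw [one_div]
        exact sub_le_self _ (by positivity)

end PrimeList

theorem level_tendsto (I t : ℕ) : Tendsto (fun R => level I R t) atTop atTop :=
  tendsto_rpow_atTop (by positivity)

/-- For large `R` the smoothing function is admissible and its moments have the right size. -/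
theorem eventually_admissible {I k W D : ℕ} (hk : 2 ≤ k) (hI : 128 * k * (I + 1) = 2 ^ (I + 1))
    (hD : 8 * k ^ 2 ≤ D) (hW : 0 < W) (hWD : ∀ q : ℕ, q.Prime → q ≤ D → q ∣ W) :
    ∀ᶠ R : ℝ in atTop, ∀ (n : ℕ) (p : Fin n → ℕ), PrimeList W R p →
      Admissible k p (fun A => levelWeight I R (modProd p A)) R ∧
      1 ≤ ∑ A, levelWeight I R (modProd p A) ^ 2 / modProd p A ∧
      (I + 1) * (W.totient / W : ℝ) * Real.log R / 8192 *
        ∑ A, levelWeight I R (modProd p A) ^ 2 / modProd p A ≤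
        k * (∑ A, levelWeight I R (modProd p A) / modProd p A) ^ 2 := by
  have hk' : (0 : ℝ) < k := by exact_mod_cast (by omega : 0 < k)
  have hW' : (0 : ℝ) < W := by exact_mod_cast hW
  have hℓ : 0 < (W.totient / W : ℝ) := by
    have : (0 : ℝ) < W.totient := by exact_mod_cast Nat.totient_pos.2 hW
    positivity
  have hI' : (128 : ℝ) * k * (I + 1) = 2 ^ (I + 1) := by exact_mod_cast hI
  have hev : ∀ᶠ R : ℝ in atTop, ∀ t ∈ Finset.range (I + 1),
      (W.totient / W : ℝ) * Real.log (level I R t) / 2 ≤ squarefreeSum W (level I R t) ∧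
      squarefreeSum W (level I R t) ≤ 2 * (W.totient / W : ℝ) * Real.log (level I R t) :=
    (Filter.eventually_all_finset _).2 fun t _ =>
      (level_tendsto I t).eventually (eventually_squarefreeSum_bounds hW)
  filter_upwards [hev, eventually_gt_atTop 1,
    Real.tendsto_log_atTop.eventually_ge_atTop (2 * 2 ^ (I + 1) / (W.totient / W : ℝ))]
    with R hR hR1 hR2 n p hp
  set ℓ := (W.totient / W : ℝ) with hℓ'
  have hL := Real.log_pos hR1
  set L := Real.log R
  set c := ℓ * L / 2 ^ (I + 1) with hc
  have hc0 : 0 < c := by positivity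
  have hN1 : ∀ A, 1 ≤ modProd p A := fun A => by
    rw [PrimeList.modProd_eq]
    exact_mod_cast Nat.one_le_iff_ne_zero.2 (hp.squarefree_prod A).ne_zero
  have hN0 : ∀ A, 0 < modProd p A := fun A => zero_lt_one.trans_le (hN1 A)
  have hV : ∀ t ≤ I, c * 2 ^ t / 2 ≤
        ∑ A, (if modProd p A ≤ level I R t then 1 else 0) / modProd p A ∧
      ∑ A, (if modProd p A ≤ level I R t then 1 else 0) / modProd p A ≤ 2 * c * 2 ^ t := by
    intro t ht
    have h0 : 0 ≤ level I R t := Real.rpow_nonneg (by linarith) _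
    have h1 : level I R t ≤ R := by
      have := level_sq_le hR1.le ht
      nlinarith
    rw [hp.sum_modProd_eq h0 h1]
    have h := hR t (Finset.mem_range.2 (Nat.lt_succ_of_le ht))
    rw [log_level (by linarith)] at h
    have e : ℓ * (2 ^ t / 2 ^ (I + 1) * L) = c * 2 ^ t := by rw [hc]; ring
    constructor
    · rw [← e]; exact h.1
    · rw [mul_assoc 2 c, ← e, ← mul_assoc]; exact h.2
  have hγ1 := sum_levelWeight_sq_div_le hN0 hc0.le fun t ht => (hV t ht).2
  have hγ2 := le_sum_levelWeight_sq_div hN0 (by simpa using (hV 0 (Nat.zero_le _)).1)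
  have hm := le_sum_levelWeight_div fun t ht => (hV t ht).1
  have hlog := sum_levelWeight_sq_div_mul_log_le hN1 hR1.le fun t ht => (hV t ht).2
  set γ := ∑ A, levelWeight I R (modProd p A) ^ 2 / modProd p A with hγ
  set m := ∑ A, levelWeight I R (modProd p A) / modProd p A with hm'
  have hDpos : 0 < D := lt_of_lt_of_le (by positivity) hD
  have hDp : ∀ l, D < p l := fun l => by
    by_contra hl
    exact hp.not_dvd l (hWD _ (hp.prime l) (not_lt.1 hl))
  refine ⟨⟨hR1, fun l => (hp.prime l).pos, fun l => ?_, fun A => levelWeight_nonneg _ _ _,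
    fun A l hl => levelWeight_antitone I R ?_, fun A hA => levelWeight_ne_zero hR1.le (hN0 A).le hA,
    ?_, ?_⟩, ?_, ?_⟩
  · have := hDp l
    nlinarith
  · rw [show modProd p A = p l * modProd p (A.erase l) from (Finset.mul_prod_erase _ _ hl).symm]
    have : (1 : ℝ) ≤ p l := by exact_mod_cast (hp.prime l).one_le
    nlinarith [hN0 (A.erase l)]
  · refine (hp.sum_sq_inv_le hDpos.ne' hWD).trans ?_
    have : (8 : ℝ) * k ^ 2 ≤ D := by exact_mod_cast hD
    gcongr
  · have e : ∀ A : Finset (Fin n), ∑ l ∈ A, Real.log (p l) = Real.log (modProd p A) := fun A => by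
      rw [modProd, Real.log_prod]
      exact fun l _ => by exact_mod_cast (hp.prime l).ne_zero
    simp_rw [e]
    refine hlog.trans ?_
    rw [← hγ, ← hI']
    have h1 : 8 * ((I : ℝ) + 1) * c * (L / (128 * k * (I + 1))) = L / (8 * k) * (c / 2) := by
      field_simp
      ring
    rw [h1]
    exact mul_le_mul_of_nonneg_left hγ2 (by positivity)
  · refine le_trans ?_ hγ2
    rw [div_le_iff₀ hℓ] at hR2
    rw [hc, le_div_iff₀ two_pos, le_div_iff₀ (by positivity)]
    linarith
  · have h1 : ((I : ℝ) + 1) * ℓ * L / 8192 * γ ≤ (I + 1) * ℓ * L / 8192 * (16 * c) :=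
      mul_le_mul_of_nonneg_left hγ1 (by positivity)
    have h2 : k * ((I + 1) * (c / 2)) ^ 2 ≤ k * m ^ 2 := by gcongr
    refine h1.trans (le_trans (le_of_eq ?_) h2)
    rw [hc, ← hI']
    field_simp
    ring

end TupleSieve

namespace TupleSieve

variable {k n : ℕ}

/-- The indicator that the divisibility pattern `x` contains `d`. -/
def below (d x : Option (Fin k)) : ℝ := if d = none ∨ d = x then 1 else 0

/-- The coefficients of a local factor in terms of the indicators `below`. -/
noncomputable def localCoeff (p : ℕ) (t d : Option (Fin k)) : ℝ :=
  d.elim 1 fun j => if t = some j then -((p : ℝ) - 1) else 0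

theorem localFactor_eq (p : ℕ) (t x : Option (Fin k)) :
    localFactor p t x = ∑ d, localCoeff p t d * below d x := by
  rw [Fintype.sum_option (f := fun d => localCoeff p t d * below d x)]
  rcases t with _ | j
  · simp [localFactor, localCoeff, below]
  · rw [Finset.sum_eq_single j]
    · simp only [localFactor, localCoeff, below, Option.elim_some, Option.elim_none, if_true,
        true_or, reduceCtorEq, false_or, eq_comm (a := x), mul_one]
      split_ifs <;> ring
    · intro j' _ hj
      simp [localCoeff, hj.symm]
    · simp

/-- The indicator that `δ` is contained in the pattern `x`. -/
def Below (δ x : Fin n → Option (Fin k)) : Prop := ∀ l, δ l = none ∨ δ l = x l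

open Classical in
theorem prod_below (δ x : Fin n → Option (Fin k)) :
    ∏ l, below (δ l) (x l) = if Below δ x then 1 else 0 := by
  split_ifs with h
  · exact Finset.prod_eq_one fun l _ => if_pos (h l)
  · obtain ⟨l, hl⟩ := not_forall.1 h
    exact Finset.prod_eq_zero (Finset.mem_univ l) (if_neg hl)

/-- The coefficients of the sieve form as a divisor-type sum. -/
noncomputable def divCoeff (p : Fin n → ℕ) (a : (Fin n → Option (Fin k)) → ℝ)
    (δ : Fin n → Option (Fin k)) : ℝ :=
  ∑ t, a t * ∏ l, localCoeff (p l) (t l) (δ l)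

theorem sieveForm_eq (p : Fin n → ℕ) (a : (Fin n → Option (Fin k)) → ℝ)
    (x : Fin n → Option (Fin k)) :
    sieveForm p a x = ∑ δ, divCoeff p a δ * ∏ l, below (δ l) (x l) := by
  simp_rw [sieveForm, divCoeff, Finset.sum_mul, localFactor_eq]
  rw [Finset.sum_comm]
  refine Finset.sum_congr rfl fun t _ => ?_
  rw [Fintype.prod_sum, Finset.mul_sum]
  refine Finset.sum_congr rfl fun δ _ => ?_
  rw [Finset.prod_mul_distrib, mul_assoc]

/-- Two assignments that agree wherever both are nontrivial. -/
def Compatible (δ ε : Fin n → Option (Fin k)) : Prop :=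
  ∀ l, δ l = none ∨ ε l = none ∨ δ l = ε l

/-- The union of two assignments. -/
def merge (δ ε : Fin n → Option (Fin k)) (l : Fin n) : Option (Fin k) := (δ l).or (ε l)

theorem below_and_below_iff {δ ε x : Fin n → Option (Fin k)} :
    Below δ x ∧ Below ε x ↔ Compatible δ ε ∧ Below (merge δ ε) x := by
  simp only [Below, Compatible, merge, ← forall_and]
  refine forall_congr' fun l => ?_
  rcases δ l with _ | j <;> rcases ε l with _ | j' <;> simp
  exact ⟨fun h => ⟨Option.some.inj (h.1.trans h.2.symm), h.1⟩, fun h => ⟨h.2, h.1 ▸ h.2⟩⟩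

open Classical in
/-- The quadratic form in the divisor-type coefficients attached to a model of the integers. -/
noncomputable def quadForm (lam : (Fin n → Option (Fin k)) → ℝ)
    (M : (Fin n → Option (Fin k)) → ℝ) : ℝ :=
  ∑ δ, ∑ ε, lam δ * lam ε * if Compatible δ ε then M (merge δ ε) else 0

open Classical in
theorem sieveForm_sq_eq (p : Fin n → ℕ) (a : (Fin n → Option (Fin k)) → ℝ)
    (x : Fin n → Option (Fin k)) :
    sieveForm p a x ^ 2 = quadForm (divCoeff p a) fun θ => if Below θ x then 1 else 0 := by
  rw [sq, sieveForm_eq, Finset.sum_mul_sum, quadForm]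
  refine Finset.sum_congr rfl fun δ _ => Finset.sum_congr rfl fun ε _ => ?_
  have h := below_and_below_iff (δ := δ) (ε := ε) (x := x)
  rw [mul_mul_mul_comm, prod_below, prod_below]
  by_cases h1 : Below δ x <;> by_cases h2 : Below ε x <;> by_cases h3 : Compatible δ ε <;>
    by_cases h4 : Below (merge δ ε) x <;> simp_all

theorem quadForm_sum {ι : Type*} (s : Finset ι) (lam : (Fin n → Option (Fin k)) → ℝ)
    (w : ι → ℝ) (M : ι → (Fin n → Option (Fin k)) → ℝ) :
    ∑ x ∈ s, w x * quadForm lam (M x) = quadForm lam fun θ => ∑ x ∈ s, w x * M x θ := by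
  simp_rw [quadForm, Finset.mul_sum]
  rw [Finset.sum_comm]
  refine Finset.sum_congr rfl fun δ _ => ?_
  rw [Finset.sum_comm]
  refine Finset.sum_congr rfl fun ε _ => ?_
  split_ifs
  · rw [Finset.mul_sum]
    exact Finset.sum_congr rfl fun x _ => by ring
  · simp

theorem hasSum_quadForm {ι : Type*} (lam : (Fin n → Option (Fin k)) → ℝ)
    (w : ι → ℝ) (M : ι → (Fin n → Option (Fin k)) → ℝ) (hs : ∀ θ, Summable fun x => w x * M x θ) :
    HasSum (fun x => w x * quadForm lam (M x)) (quadForm lam fun θ => ∑' x, w x * M x θ) := by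
  simp_rw [quadForm, Finset.mul_sum]
  refine hasSum_sum fun δ _ => hasSum_sum fun ε _ => ?_
  split_ifs
  · exact ((hs _).hasSum.mul_left (lam δ * lam ε)).congr_fun fun x => by ring
  · simp

open Classical in
theorem abs_quadForm_sub_le (lam M M' : (Fin n → Option (Fin k)) → ℝ) (c : ℝ) :
    |quadForm lam M - c * quadForm lam M'| ≤
      ∑ δ, ∑ ε, |lam δ| * |lam ε| *
        if Compatible δ ε then |M (merge δ ε) - c * M' (merge δ ε)| else 0 := by
  simp_rw [quadForm, Finset.mul_sum, ← Finset.sum_sub_distrib]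
  refine (Finset.abs_sum_le_sum_abs _ _).trans (Finset.sum_le_sum fun δ _ => ?_)
  refine (Finset.abs_sum_le_sum_abs _ _).trans (Finset.sum_le_sum fun ε _ => le_of_eq ?_)
  split_ifs
  · rw [← abs_mul, ← abs_mul]
    congr 1
    ring
  · simp

open Classical in
theorem sum_prod_mul_below (w : Fin n → Option (Fin k) → ℝ) (θ : Fin n → Option (Fin k)) :
    ∑ x : Fin n → Option (Fin k), (∏ l, w l (x l)) * (if Below θ x then 1 else 0) =
      ∏ l, (θ l).elim (∑ y, w l y) fun j => w l (some j) := by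
  simp_rw [← prod_below, ← Finset.prod_mul_distrib]
  rw [← Fintype.prod_sum (fun l y => w l y * below (θ l) y)]
  refine Finset.prod_congr rfl fun l _ => ?_
  rcases θ l with _ | j
  · simp [below]
  · simp [below]

/-- The probability of `θ` in the model where the `i`th shift is prime. -/
noncomputable def primeDensity (i : Fin k) (p : Fin n → ℕ) (θ : Fin n → Option (Fin k)) : ℝ :=
  ∏ l, (θ l).elim 1 fun j => if j = i then 0 else 1 / ((p l : ℝ) - 1)

theorem intMean_eq (p : Fin n → ℕ) (a : (Fin n → Option (Fin k)) → ℝ) :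
    intMean p a = quadForm (divCoeff p a) fun θ => 1 / size p θ := by
  classical
  simp_rw [intMean, sieveForm_sq_eq]
  rw [quadForm_sum]
  congr 1
  funext θ
  rw [sum_prod_mul_below, size, one_div, ← Finset.prod_inv_distrib]
  refine Finset.prod_congr rfl fun l _ => ?_
  rcases θ l with _ | j
  · rw [Option.elim_none, Fintype.sum_option (f := fun y => intWeight (p l) y)]
    simp [intWeight, div_eq_mul_inv]
  · simp [intWeight]

theorem primeMean_eq {p : Fin n → ℕ} (hp : ∀ l, 1 < p l) (i : Fin k)
    (a : (Fin n → Option (Fin k)) → ℝ) :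
    primeMean i p a = quadForm (divCoeff p a) (primeDensity i p) := by
  classical
  simp_rw [primeMean, sieveForm_sq_eq]
  rw [quadForm_sum]
  congr 1
  funext θ
  rw [sum_prod_mul_below, primeDensity]
  refine Finset.prod_congr rfl fun l _ => ?_
  rcases θ l with _ | j
  · rw [Option.elim_none, Option.elim_none,
      Fintype.sum_option (f := fun y => primeWeight i (p l) y)]
    have h : (1 : ℝ) < p l := by exact_mod_cast hp l
    have hk : 1 ≤ k := i.pos
    simp only [primeWeight, Option.elim_none, Option.elim_some]
    rw [← Finset.add_sum_erase _ _ (Finset.mem_univ i), if_pos rfl, zero_add,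
      Finset.sum_congr rfl fun j hj => if_neg (Finset.ne_of_mem_erase hj), Finset.sum_const,
      Finset.card_erase_of_mem (Finset.mem_univ i), Finset.card_univ, Fintype.card_fin,
      nsmul_eq_mul, Nat.cast_sub hk]
    push_cast
    ring
  · simp [primeWeight]

section bounds
variable {p : Fin n → ℕ} {G : Finset (Fin n) → ℝ} {R : ℝ}

/-- The Euler product `∏ (1 + K / p)`. -/
noncomputable def eulerProd (p : Fin n → ℕ) (K : ℝ) : ℝ := ∏ l, (1 + K / p l)

theorem coeff_le (hp : ∀ l, 0 < p l) (hG : ∀ A, 0 ≤ G A) (hG2 : ∀ A, G A ≤ 2)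
    (α : Fin n → Option (Fin k)) : coeff p G R α ≤ 2 ^ k / size p α := by
  rw [coeff]
  split_ifs
  · rw [Finset.prod_div_distrib, prod_modProd_fiber]
    refine div_le_div_of_nonneg_right ?_ (size_pos hp α).le
    exact (Finset.prod_le_prod (fun j _ => hG _) fun j _ => hG2 _).trans_eq (by simp)
  · exact (div_pos (by positivity) (size_pos hp α)).le

theorem abs_divCoeff_le (hp : ∀ l, 0 < p l) (hG : ∀ A, 0 ≤ G A) (hG2 : ∀ A, G A ≤ 2)
    (δ : Fin n → Option (Fin k)) :
    |divCoeff p (coeff p G R) δ| ≤ 2 ^ k * eulerProd p k := by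
  have hpp : ∀ l, (0 : ℝ) < p l := fun l => by exact_mod_cast hp l
  calc |divCoeff p (coeff p G R) δ| ≤ ∑ t : Fin n → Option (Fin k),
        2 ^ k * ∏ l, ((t l).elim 1 fun _ => 1 / (p l : ℝ)) * |localCoeff (p l) (t l) (δ l)| := by
        refine (Finset.abs_sum_le_sum_abs _ _).trans (Finset.sum_le_sum fun t _ => ?_)
        rw [abs_mul, Finset.abs_prod, Finset.prod_mul_distrib, ← mul_assoc,
          abs_of_nonneg (coeff_nonneg hp hG t)]
        refine mul_le_mul_of_nonneg_right ((coeff_le hp hG hG2 t).trans_eq ?_)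
          (Finset.prod_nonneg fun l _ => abs_nonneg _)
        rw [div_eq_mul_inv, size, ← Finset.prod_inv_distrib]
        congr 1
        refine Finset.prod_congr rfl fun l _ => ?_
        rcases t l with _ | j <;> simp
    _ ≤ _ := by
        rw [← Finset.mul_sum]
        refine mul_le_mul_of_nonneg_left ?_ (by positivity)
        rw [← Fintype.prod_sum (fun l t => (t.elim 1 fun _ => 1 / (p l : ℝ)) *
          |localCoeff (p l) t (δ l)|), eulerProd]
        refine Finset.prod_le_prod (fun l _ => Finset.sum_nonneg fun t _ =>
          mul_nonneg ?_ (abs_nonneg _)) fun l _ => ?_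
        · rcases t with _ | j
          · exact zero_le_one
          · exact (one_div_pos.2 (hpp l)).le
        · rw [Fintype.sum_option (f := fun t => (t.elim 1 fun _ => 1 / (p l : ℝ)) *
            |localCoeff (p l) t (δ l)|)]
          rcases δ l with _ | j
          · simp [localCoeff, div_eq_mul_inv]
          · have h1 : (1 : ℝ) ≤ p l := by exact_mod_cast hp l
            rw [Finset.sum_eq_single j]
            · simp only [localCoeff, Option.elim_none, Option.elim_some, reduceCtorEq, if_false,
                abs_zero, mul_zero, zero_add, if_true, abs_neg]
              rw [abs_of_nonneg (by linarith), one_div_mul_eq_div]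
              have : ((p l : ℝ) - 1) / p l ≤ 1 := (div_le_one (hpp l)).2 (by linarith)
              have : (0 : ℝ) ≤ k / p l := by positivity
              linarith
            · intro j' _ hj
              simp [localCoeff, hj]
            · simp

theorem divCoeff_eq_zero (hp : ∀ l, 0 < p l) {δ : Fin n → Option (Fin k)} (h : R < size p δ) :
    divCoeff p (coeff p G R) δ = 0 := by
  refine Finset.sum_eq_zero fun t _ => ?_
  by_contra h0
  obtain ⟨h1, h2⟩ := mul_ne_zero_iff.1 h0
  have h3 : size p t ≤ R := by
    by_contra h'
    exact h1 (by rw [coeff, if_neg h'])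
  refine absurd (h.trans_le (le_trans ?_ h3)) (lt_irrefl _)
  refine Finset.prod_le_prod (fun l _ => ?_) fun l _ => ?_
  · rcases δ l with _ | j
    · exact zero_le_one
    · exact Nat.cast_nonneg _
  · have h4 := Finset.prod_ne_zero_iff.1 h2 l (Finset.mem_univ l)
    rcases hδ : δ l with _ | j
    · rcases t l with _ | j'
      · exact le_rfl
      · exact Nat.one_le_cast.2 (hp l)
    · rw [hδ] at h4
      have h5 : t l = some j := by
        by_contra h'
        exact h4 (by simp [localCoeff, h'])
      rw [h5]

theorem sum_one_div_size (p : Fin n → ℕ) :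
    ∑ δ : Fin n → Option (Fin k), 1 / size p δ = eulerProd p k := by
  have h : ∀ δ : Fin n → Option (Fin k), 1 / size p δ =
      ∏ l, (δ l).elim 1 fun _ => 1 / (p l : ℝ) := fun δ => by
    rw [size, one_div, ← Finset.prod_inv_distrib]
    refine Finset.prod_congr rfl fun l _ => ?_
    rcases δ l with _ | j <;> simp
  simp_rw [h]
  rw [← Fintype.prod_sum (fun l (d : Option (Fin k)) => d.elim 1 fun _ => 1 / (p l : ℝ)), eulerProd]
  refine Finset.prod_congr rfl fun l _ => ?_
  rw [Fintype.sum_option (f := fun (d : Option (Fin k)) => d.elim 1 fun _ => 1 / (p l : ℝ))]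
  simp [div_eq_mul_inv]

theorem sum_abs_divCoeff_le (hp : ∀ l, 0 < p l) (hG : ∀ A, 0 ≤ G A) (hG2 : ∀ A, G A ≤ 2)
    (hR : 0 ≤ R) :
    ∑ δ, |divCoeff (k := k) p (coeff p G R) δ| ≤ 2 ^ k * eulerProd p k ^ 2 * R := by
  have hE : 0 ≤ eulerProd p k := Finset.prod_nonneg fun l _ => by positivity
  calc ∑ δ, |divCoeff (k := k) p (coeff p G R) δ|
      ≤ ∑ δ : Fin n → Option (Fin k), 2 ^ k * eulerProd p k * (R * (1 / size p δ)) := by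
        refine Finset.sum_le_sum fun δ _ => ?_
        have hs := size_pos hp δ
        rcases lt_or_ge R (size p δ) with h | h
        · rw [divCoeff_eq_zero hp h, abs_zero]
          positivity
        · refine (abs_divCoeff_le hp hG hG2 δ).trans ?_
          refine le_mul_of_one_le_right (by positivity) ?_
          rw [mul_one_div, one_le_div hs]
          exact h
    _ = _ := by
        rw [← Finset.mul_sum, ← Finset.mul_sum, sum_one_div_size]
        ring

end bounds

end TupleSieve

namespace TupleSieve

open Filter Topology

section arithmeticProgression

variable {F : ℕ → ℝ} {q : ℕ}

theorem tsum_ite_modEq_eq (hq : 0 < q) (a : ℕ) :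
    ∑' m, (if m ≡ a [MOD q] then F m else 0) = ∑' j, F (a % q + q * j) := by
  have hinj : Function.Injective fun j : ℕ => a % q + q * j := fun i j h => by
    simpa [hq.ne'] using h
  rw [← hinj.tsum_eq (f := fun m => if m ≡ a [MOD q] then F m else 0)]
  · refine tsum_congr fun j => if_pos ?_
    simp [Nat.ModEq]
  · intro m hm
    have h : m ≡ a [MOD q] := by
      by_contra h
      exact hm (if_neg h)
    exact ⟨m / q, by
      show a % q + q * (m / q) = m
      rw [← h]
      exact Nat.mod_add_div m q⟩

/-- A monotone sum over an arithmetic progression is close to its average. -/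
theorem abs_tsum_ite_modEq_sub_le (hF : Summable F) (hanti : Antitone F) (hq : 0 < q) (a : ℕ) :
    |∑' m, (if m ≡ a [MOD q] then F m else 0) - 1 / q * ∑' m, F m| ≤ F 0 := by
  have hinj : ∀ c, Function.Injective fun j : ℕ => c + q * j := fun c i j h => by
    simpa [hq.ne'] using h
  have hs : ∀ c, Summable fun j => F (c + q * j) := fun c => hF.comp_injective (hinj c)
  set T : ℕ → ℝ := fun c => ∑' j, F (c + q * j) with hT
  have hTanti : Antitone T := fun c d hcd =>
    (hs d).tsum_le_tsum (fun j => hanti (by gcongr)) (hs c)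
  have hTq : T 0 = F 0 + T q := by
    rw [hT]
    dsimp only
    rw [(hs 0).tsum_eq_zero_add]
    congr 2
    funext j
    congr 1
    ring
  have hmem : ∀ c ≤ q, T 0 - F 0 ≤ T c ∧ T c ≤ T 0 := fun c hc =>
    ⟨by linarith [hTanti hc], hTanti (Nat.zero_le c)⟩
  have : NeZero q := ⟨hq.ne'⟩
  have hsum : ∑' m, F m = ∑ j : ZMod q, T j.val := Nat.sumByResidueClasses hF q
  have hq' : (0 : ℝ) < q := by exact_mod_cast hq
  have h1 : q * (T 0 - F 0) ≤ ∑' m, F m := by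
    rw [hsum]
    refine le_trans ?_ (Finset.card_nsmul_le_sum _ _ (T 0 - F 0) fun j _ =>
      (hmem _ (ZMod.val_lt j).le).1)
    simp
  have h2 : ∑' m, F m ≤ q * T 0 := by
    rw [hsum]
    refine (Finset.sum_le_card_nsmul _ _ (T 0) fun j _ => (hmem _ (ZMod.val_lt j).le).2).trans ?_
    simp
  have h3 := hmem (a % q) (Nat.mod_lt _ hq).le
  have h4 : T 0 - F 0 ≤ 1 / q * ∑' m, F m := by
    rw [one_div_mul_eq_div, le_div_iff₀ hq']
    linarith
  have h5 : 1 / q * ∑' m, F m ≤ T 0 := by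
    rw [one_div_mul_eq_div, div_le_iff₀ hq']
    linarith
  rw [tsum_ite_modEq_eq hq]
  exact abs_sub_le_iff.2 ⟨by linarith [h3.2], by linarith [h3.1]⟩

end arithmeticProgression

/-- The weight `(log n)^K / n²`. -/
noncomputable def logWeight (K n : ℕ) : ℝ := Real.log n ^ K / (n : ℝ) ^ 2

theorem logWeight_nonneg (K n : ℕ) : 0 ≤ logWeight K n :=
  div_nonneg (pow_nonneg (Real.log_natCast_nonneg n) K) (sq_nonneg _)

theorem log_mul_logWeight (K n : ℕ) : Real.log n * logWeight K n = logWeight (K + 1) n := by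
  rw [logWeight, logWeight, pow_succ]
  ring

theorem logWeight_le_rpow (K n : ℕ) {t : ℝ} (ht : 0 < t) (hn : n ≠ 0) :
    logWeight K n ≤ K.factorial * t⁻¹ ^ K * (n : ℝ) ^ (t - 2) := by
  have hn' : (0 : ℝ) < n := by positivity
  have hl := Real.log_natCast_nonneg n
  have h := Real.pow_div_factorial_le_exp (t * Real.log n) (mul_nonneg ht.le hl) K
  rw [mul_comm t, Real.exp_mul, Real.exp_log hn', div_le_iff₀ (by positivity), mul_pow] at h
  rw [logWeight, Real.rpow_sub hn', inv_pow, div_le_iff₀ (by positivity)]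
  rw [Real.rpow_two]
  have : K.factorial * (t ^ K)⁻¹ * ((n : ℝ) ^ t / (n : ℝ) ^ 2) * (n : ℝ) ^ 2 =
      (n : ℝ) ^ t * K.factorial / t ^ K := by field_simp
  rw [this, le_div_iff₀ (by positivity)]
  linarith

theorem log_pow_div_sq_le (K : ℕ) {s t : ℝ} (hs : Real.exp (K / 2) ≤ s) (hst : s ≤ t) :
    Real.log t ^ K / t ^ 2 ≤ Real.log s ^ K / s ^ 2 := by
  have hs0 : 0 < s := (Real.exp_pos _).trans_le hs
  have ht0 : 0 < t := hs0.trans_le hst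
  rcases Nat.eq_zero_or_pos K with rfl | hK
  · simp only [pow_zero]
    gcongr
  have hK' : (0 : ℝ) < K := by exact_mod_cast hK
  have hform : ∀ u : ℝ, 0 < u →
      Real.log u ^ K / u ^ 2 = (Real.log u / u ^ (2 / K : ℝ)) ^ K := fun u hu => by
    rw [div_pow, ← Real.rpow_mul_natCast hu.le, div_mul_cancel₀ _ hK'.ne', Real.rpow_two]
  have he : Real.exp (2 / K : ℝ)⁻¹ ≤ s := by rwa [inv_div]
  have h1 : (1 : ℝ) ≤ t := ((Real.one_le_exp (by positivity)).trans hs).trans hst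
  rw [hform t ht0, hform s hs0]
  exact pow_le_pow_left₀ (div_nonneg (Real.log_nonneg h1) (Real.rpow_nonneg ht0.le _))
    (Real.log_div_self_rpow_antitoneOn (by positivity) he (he.trans hst) hst) K

theorem antitone_logWeight_add (K n₀ : ℕ) (h : Real.exp (K / 2) ≤ n₀) :
    Antitone fun m => logWeight K (n₀ + m) := fun a b hab =>
  log_pow_div_sq_le K (h.trans (by exact_mod_cast Nat.le_add_right _ _))
    (by exact_mod_cast Nat.add_le_add_left hab _)

/-- An antiderivative of `-(log t)^K / t²`. -/
noncomputable def logPrimitive (K : ℕ) (t : ℝ) : ℝ :=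
  K.factorial * (∑ i ∈ Finset.range (K + 1), Real.log t ^ i / i.factorial) / t

theorem logPrimitive_succ (K : ℕ) (t : ℝ) :
    logPrimitive (K + 1) t = Real.log t ^ (K + 1) / t + (K + 1) * logPrimitive K t := by
  rw [logPrimitive, Finset.sum_range_succ, logPrimitive, Nat.factorial_succ]
  push_cast
  have : (K.factorial : ℝ) ≠ 0 := by positivity
  field_simp
  ring

theorem hasDerivAt_logPrimitive (K : ℕ) {t : ℝ} (ht : 0 < t) :
    HasDerivAt (logPrimitive K) (-(Real.log t ^ K / t ^ 2)) t := by
  induction K with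
  | zero =>
    have : logPrimitive 0 = fun t => t⁻¹ := by
      funext t
      simp [logPrimitive]
    rw [this]
    simpa [one_div] using hasDerivAt_inv ht.ne'
  | succ K ih =>
    have : logPrimitive (K + 1) =
        fun t => Real.log t ^ (K + 1) / t + (K + 1) * logPrimitive K t :=
      funext (logPrimitive_succ K)
    rw [this]
    refine ((((Real.hasDerivAt_log ht.ne').pow (K + 1)).div (hasDerivAt_id' t) ht.ne').add
      (ih.const_mul ((K : ℝ) + 1))).congr_deriv ?_
    push_cast
    rw [Pi.pow_apply]
    field_simp
    ring

theorem logPrimitive_le (K : ℕ) {t : ℝ} (ht : 1 ≤ t) : logPrimitive K t ≤ K.factorial := by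
  have h0 : 0 < t := by linarith
  rw [logPrimitive, div_le_iff₀ h0]
  refine mul_le_mul_of_nonneg_left ?_ (by positivity)
  refine (Real.sum_le_exp_of_nonneg (Real.log_nonneg ht) _).trans_eq (Real.exp_log h0)

theorem logPrimitive_nonneg (K : ℕ) {t : ℝ} (ht : 1 ≤ t) : 0 ≤ logPrimitive K t := by
  have := Real.log_nonneg ht
  exact div_nonneg (mul_nonneg (by positivity) (Finset.sum_nonneg fun i _ => by positivity))
    (by linarith)

theorem sum_logWeight_le (K n₀ : ℕ) (h : Real.exp (K / 2) ≤ n₀) (N : ℕ) :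
    ∑ m ∈ Finset.range N, logWeight K (n₀ + (m + 1)) ≤ K.factorial := by
  have h1 : (1 : ℝ) ≤ n₀ := (Real.one_le_exp (by positivity)).trans h
  have hstep : ∀ m, logWeight K (n₀ + (m + 1)) ≤
      logPrimitive K ((n₀ + m : ℕ) : ℝ) - logPrimitive K ((n₀ + (m + 1) : ℕ) : ℝ) := fun m => by
    have hm : (n₀ : ℝ) ≤ ((n₀ + m : ℕ) : ℝ) := by exact_mod_cast Nat.le_add_right _ _
    have hlt : ((n₀ + m : ℕ) : ℝ) < ((n₀ + (m + 1) : ℕ) : ℝ) := by exact_mod_cast Nat.lt_succ_self _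
    have hderiv : ∀ x ∈ Set.Icc ((n₀ + m : ℕ) : ℝ) ((n₀ + (m + 1) : ℕ) : ℝ),
        HasDerivAt (logPrimitive K) (-(Real.log x ^ K / x ^ 2)) x := fun x hx =>
      hasDerivAt_logPrimitive K (by linarith [hx.1])
    obtain ⟨c, hc, hc'⟩ := exists_hasDerivAt_eq_slope (logPrimitive K) _ hlt
      (fun x hx => (hderiv x hx).continuousAt.continuousWithinAt)
      fun x hx => hderiv x (Set.Ioo_subset_Icc_self hx)
    have h1 : ((n₀ + (m + 1) : ℕ) : ℝ) - ((n₀ + m : ℕ) : ℝ) = 1 := by push_cast; ring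
    rw [h1, div_one] at hc'
    have h2 := log_pow_div_sq_le K ((h.trans hm).trans hc.1.le) hc.2.le
    rw [logWeight]
    linarith
  refine (Finset.sum_le_sum fun m _ => hstep m).trans ?_
  rw [Finset.sum_range_sub' fun m => logPrimitive K ((n₀ + m : ℕ) : ℝ)]
  have h2 := logPrimitive_nonneg K (t := ((n₀ + N : ℕ) : ℝ)) (by push_cast; linarith [N.cast_nonneg (α := ℝ)])
  have h3 := logPrimitive_le K h1
  simp only [add_zero]
  linarith

theorem summable_logWeight (K : ℕ) : Summable (logWeight K) := by
  refine Summable.of_nonneg_of_le (logWeight_nonneg K) (fun n => ?_)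
    ((Real.summable_nat_rpow.2 (by norm_num : (1 / 2 - 2 : ℝ) < -1)).mul_left
      (K.factorial * (1 / 2 : ℝ)⁻¹ ^ K))
  rcases eq_or_ne n 0 with rfl | hn
  · rw [logWeight, Nat.cast_zero, zero_pow two_ne_zero, div_zero]
    positivity
  · exact logWeight_le_rpow K n (by norm_num) hn

theorem tsum_logWeight_add_le (K n₀ : ℕ) (h : Real.exp (K / 2) ≤ n₀) :
    ∑' m, logWeight K (n₀ + m) ≤ 2 * K.factorial := by
  have hs : Summable fun m => logWeight K (n₀ + m) :=
    (summable_logWeight K).comp_injective (add_right_injective n₀)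
  have h1 : (1 : ℝ) ≤ n₀ := (Real.one_le_exp (by positivity)).trans h
  rw [hs.tsum_eq_zero_add]
  have h2 : logWeight K (n₀ + 0) ≤ K.factorial := by
    have hn : n₀ ≠ 0 := by
      rintro rfl
      norm_num at h1
    refine (logWeight_le_rpow K n₀ one_pos hn).trans ?_
    rw [inv_one, one_pow, mul_one]
    exact mul_le_of_le_one_right (by positivity)
      (Real.rpow_le_one_of_one_le_of_nonpos h1 (by norm_num))
  have h3 : ∑' m, logWeight K (n₀ + (m + 1)) ≤ K.factorial :=
    Real.tsum_le_of_sum_range_le (fun m => logWeight_nonneg _ _) (sum_logWeight_le K n₀ h)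
  linarith

end TupleSieve

namespace TupleSieve

open ArithmeticFunction in
/-- The weighted count of prime powers that are below `N` or not prime. -/
noncomputable def tinyMass (J N : ℕ) : ℝ :=
  (∑ m ∈ Finset.range N, vonMangoldt m * logWeight J m) +
    ∑' m : ℕ, if m.Prime then 0 else vonMangoldt m * logWeight J m

open ArithmeticFunction in
theorem vonMangoldt_mul_logWeight_nonneg (J m : ℕ) : 0 ≤ vonMangoldt m * logWeight J m :=
  mul_nonneg vonMangoldt_nonneg (logWeight_nonneg J m)

open ArithmeticFunction in
theorem summable_vonMangoldt_mul_logWeight (J : ℕ) :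
    Summable fun m => vonMangoldt m * logWeight J m :=
  Summable.of_nonneg_of_le (vonMangoldt_mul_logWeight_nonneg J) (fun m => by
    rw [← log_mul_logWeight]
    exact mul_le_mul_of_nonneg_right vonMangoldt_le_log (logWeight_nonneg J m))
    (summable_logWeight (J + 1))

open ArithmeticFunction in
theorem summable_nonprime_vonMangoldt_mul_logWeight (J : ℕ) :
    Summable fun m : ℕ => if m.Prime then 0 else vonMangoldt m * logWeight J m :=
  Summable.of_nonneg_of_le (fun m => by
    split_ifs
    exacts [le_rfl, vonMangoldt_mul_logWeight_nonneg J m]) (fun m => by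
    split_ifs
    exacts [vonMangoldt_mul_logWeight_nonneg J m, le_rfl]) (summable_vonMangoldt_mul_logWeight J)

theorem tinyMass_nonneg (J N : ℕ) : 0 ≤ tinyMass J N :=
  add_nonneg (Finset.sum_nonneg fun m _ => vonMangoldt_mul_logWeight_nonneg J m)
    (tsum_nonneg fun m => by
      split_ifs
      exacts [le_rfl, vonMangoldt_mul_logWeight_nonneg J m])

open ArithmeticFunction in
open Classical in
/-- Any part of the von Mangoldt mass avoiding the primes `≥ N` is at most `tinyMass`. -/
theorem tsum_ite_le_tinyMass (J N : ℕ) (P : ℕ → Prop) (hP : ∀ m, P m → m.Prime → m < N) :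
    ∑' m : ℕ, (if P m then vonMangoldt m * logWeight J m else 0) ≤ tinyMass J N := by
  have h0 := vonMangoldt_mul_logWeight_nonneg J
  have h1 : HasSum (fun m => if m ∈ Finset.range N then vonMangoldt m * logWeight J m else 0)
      (∑ m ∈ Finset.range N, vonMangoldt m * logWeight J m) := by
    rw [← Finset.sum_congr rfl fun m (hm : m ∈ Finset.range N) => if_pos hm]
    exact hasSum_sum_of_ne_finset_zero fun m hm => if_neg hm
  have h2 := h1.add (summable_nonprime_vonMangoldt_mul_logWeight J).hasSum
  rw [tinyMass, ← h2.tsum_eq]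
  have h3 : ∀ m : ℕ, (if P m then vonMangoldt m * logWeight J m else 0) ≤
      (if m ∈ Finset.range N then vonMangoldt m * logWeight J m else 0) +
        if m.Prime then 0 else vonMangoldt m * logWeight J m := fun m => by
    have := h0 m
    by_cases hm : P m
    · by_cases hp : m.Prime
      · simp [hm, hp, hP m hm hp]
      · simp only [hm, hp, if_true, if_false]
        split_ifs <;> linarith
    · rw [if_neg hm]
      split_ifs <;> linarith
  refine Summable.tsum_le_tsum h3 (Summable.of_nonneg_of_le (fun m => ?_) h3 h2.summable)
    h2.summable
  split_ifs
  exacts [h0 m, le_rfl]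

open ArithmeticFunction in
theorem exists_eq_sq_mul_cube {m : ℕ} (h : vonMangoldt m ≠ 0) (hm : ¬ m.Prime) :
    ∃ ab : ℕ × ℕ, m = ab.1 ^ 2 * ab.2 ^ 3 := by
  obtain ⟨p, e, hp, he, rfl⟩ := (isPrimePow_nat_iff m).1 (vonMangoldt_ne_zero_iff.1 h)
  have he1 : e ≠ 1 := by
    rintro rfl
    exact hm (by rwa [pow_one])
  rcases Nat.even_or_odd' e with ⟨c, rfl | rfl⟩
  · exact ⟨(p ^ c, 1), by simp [← pow_mul, mul_comm]⟩
  · obtain ⟨d, rfl⟩ : ∃ d, c = d + 1 := ⟨c - 1, by omega⟩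
    exact ⟨(p ^ d, p), by rw [← pow_mul, ← pow_add]; congr 1; ring⟩

open ArithmeticFunction in
theorem summable_nonprime_vonMangoldt_mul_rpow :
    Summable fun m : ℕ => if m.Prime then 0 else vonMangoldt m * (m : ℝ) ^ (-(3 / 4) : ℝ) := by
  set S : Set ℕ := {m | vonMangoldt m ≠ 0 ∧ ¬ m.Prime} with hS
  have hex : ∀ m : S, ∃ ab : ℕ × ℕ, (m : ℕ) = ab.1 ^ 2 * ab.2 ^ 3 := fun m =>
    exists_eq_sq_mul_cube m.2.1 m.2.2
  choose g hg using hex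
  have hinj : Function.Injective g := fun a b hab => Subtype.ext (by rw [hg a, hg b, hab])
  have hsum : Summable fun ab : ℕ × ℕ =>
      (ab.1 : ℝ) ^ (-(7 / 5) : ℝ) * (ab.2 : ℝ) ^ (-(21 / 10) : ℝ) :=
    (Real.summable_nat_rpow.2 (by norm_num)).mul_of_nonneg (Real.summable_nat_rpow.2 (by norm_num))
      (fun n => Real.rpow_nonneg n.cast_nonneg _) fun n => Real.rpow_nonneg n.cast_nonneg _
  have h1 : Summable fun m : S => 20 * ((m : ℕ) : ℝ) ^ (-(7 / 10) : ℝ) := by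
    refine ((hsum.comp_injective hinj).mul_left 20).congr fun m => ?_
    simp only [Function.comp]
    rw [hg m]
    push_cast
    rw [Real.mul_rpow (by positivity) (by positivity), ← Real.rpow_natCast_mul (by positivity),
      ← Real.rpow_natCast_mul (by positivity)]
    norm_num
  have h2 : Summable (S.indicator fun m : ℕ => 20 * (m : ℝ) ^ (-(7 / 10) : ℝ)) :=
    summable_subtype_iff_indicator.1 h1
  refine Summable.of_nonneg_of_le (fun m => ?_) (fun m => ?_) h2
  · split_ifs
    exacts [le_rfl, mul_nonneg vonMangoldt_nonneg (Real.rpow_nonneg m.cast_nonneg _)]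
  · by_cases hm : m ∈ S
    · rw [Set.indicator_of_mem hm, if_neg hm.2]
      have hm0 : 0 < m := Nat.pos_of_ne_zero fun h => hm.1 (by simp [h])
      have hm0' : (0 : ℝ) < m := by exact_mod_cast hm0
      have h3 : vonMangoldt m ≤ 20 * (m : ℝ) ^ (1 / 20 : ℝ) := by
        refine vonMangoldt_le_log.trans ((Real.log_le_rpow_div hm0'.le
          (by norm_num : (0 : ℝ) < 1 / 20)).trans_eq ?_)
        ring
      refine (mul_le_mul_of_nonneg_right h3 (Real.rpow_nonneg hm0'.le _)).trans_eq ?_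
      rw [mul_assoc, ← Real.rpow_add hm0']
      norm_num
    · rw [Set.indicator_of_notMem hm]
      rcases not_and_or.1 hm with h | h
      · simp [not_not.1 h]
      · rw [if_pos (not_not.1 h)]

open ArithmeticFunction in
theorem exists_tinyMass_le : ∃ C : ℝ, 0 ≤ C ∧ ∀ J N : ℕ, 1 ≤ N →
    tinyMass J N ≤ J.factorial * (N * Real.log N * (1 / 2) ^ J + C * (4 / 5) ^ J) := by
  refine ⟨∑' m : ℕ, if m.Prime then 0 else vonMangoldt m * (m : ℝ) ^ (-(3 / 4) : ℝ),
    tsum_nonneg fun m => ?_, fun J N hN => ?_⟩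
  · split_ifs
    exacts [le_rfl, mul_nonneg vonMangoldt_nonneg (Real.rpow_nonneg m.cast_nonneg _)]
  have h1 : ∑ m ∈ Finset.range N, vonMangoldt m * logWeight J m ≤
      N * (Real.log N * (J.factorial * (1 / 2) ^ J)) := by
    refine (Finset.sum_le_card_nsmul _ _ (Real.log N * (J.factorial * (1 / 2) ^ J))
      fun m hm => ?_).trans_eq (by simp)
    rcases eq_or_ne m 0 with rfl | hm0
    · rw [ArithmeticFunction.map_zero, zero_mul]
      have := Real.log_natCast_nonneg N
      positivity
    · have hm1 : (0 : ℝ) < m := by positivity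
      refine mul_le_mul (vonMangoldt_le_log.trans (Real.log_le_log hm1
        (by exact_mod_cast (Finset.mem_range.1 hm).le))) ?_ (logWeight_nonneg J m)
        (Real.log_natCast_nonneg N)
      simpa using logWeight_le_rpow J m two_pos hm0
  have h2 : (∑' m : ℕ, if m.Prime then 0 else vonMangoldt m * logWeight J m) ≤
      J.factorial * (4 / 5) ^ J *
        ∑' m : ℕ, if m.Prime then 0 else vonMangoldt m * (m : ℝ) ^ (-(3 / 4) : ℝ) := by
    rw [← tsum_mul_left]
    refine Summable.tsum_le_tsum (fun m => ?_) (summable_nonprime_vonMangoldt_mul_logWeight J)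
      (summable_nonprime_vonMangoldt_mul_rpow.mul_left _)
    split_ifs with hp
    · rw [mul_zero]
    · rcases eq_or_ne m 0 with rfl | hm0
      · simp
      · have := logWeight_le_rpow J m (by norm_num : (0 : ℝ) < 5 / 4) hm0
        norm_num at this
        refine (mul_le_mul_of_nonneg_left this vonMangoldt_nonneg).trans_eq ?_
        norm_num
        ring
  rw [tinyMass]
  linarith

end TupleSieve

namespace TupleSieve

open DirichletCharacter

open ArithmeticFunction in
theorem summable_twist {u : ℕ → ℂ} (hu : ∀ m, ‖u m‖ ≤ 1) (J : ℕ) :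
    Summable fun m : ℕ => u m * ((vonMangoldt m * logWeight J m : ℝ) : ℂ) := by
  refine Summable.of_norm_bounded (summable_vonMangoldt_mul_logWeight J) fun m => ?_
  rw [norm_mul, Complex.norm_real, Real.norm_of_nonneg (vonMangoldt_mul_logWeight_nonneg J m)]
  exact mul_le_of_le_one_left (vonMangoldt_mul_logWeight_nonneg J m) (hu m)

open ArithmeticFunction in
/-- Two bounded twists agreeing on the integers coprime to `q` have nearly equal sums. -/
theorem norm_tsum_twist_sub_le {u v : ℕ → ℂ} {q J N : ℕ} (hu : ∀ m, ‖u m‖ ≤ 1)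
    (hv : ∀ m, ‖v m‖ ≤ 1) (hu0 : ∀ m, ¬ m.Coprime q → u m = 0)
    (huv : ∀ m, m.Coprime q → u m = v m) (hN : ∀ l, l.Prime → l ∣ q → l < N) :
    ‖(∑' m : ℕ, u m * ((vonMangoldt m * logWeight J m : ℝ) : ℂ)) -
      ∑' m : ℕ, v m * ((vonMangoldt m * logWeight J m : ℝ) : ℂ)‖ ≤ tinyMass J N := by
  have hs := summable_twist hu J
  have ht := summable_twist hv J
  have h0 := vonMangoldt_mul_logWeight_nonneg J
  rw [← hs.tsum_sub ht]
  have hb : ∀ m : ℕ, ‖u m * ((vonMangoldt m * logWeight J m : ℝ) : ℂ) -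
      v m * ((vonMangoldt m * logWeight J m : ℝ) : ℂ)‖ ≤
      if ¬ m.Coprime q then vonMangoldt m * logWeight J m else 0 := fun m => by
    by_cases hm : m.Coprime q
    · simp [hm, huv m hm]
    · rw [if_pos hm, hu0 m hm, zero_mul, zero_sub, norm_neg, norm_mul, Complex.norm_real,
        Real.norm_of_nonneg (h0 m)]
      exact mul_le_of_le_one_left (h0 m) (hv m)
  have hsum : Summable fun m : ℕ =>
      if ¬ m.Coprime q then vonMangoldt m * logWeight J m else 0 :=
    Summable.of_nonneg_of_le (fun m => by split_ifs; exacts [le_rfl, h0 m])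
      (fun m => by split_ifs; exacts [h0 m, le_rfl]) (summable_vonMangoldt_mul_logWeight J)
  refine (tsum_of_norm_bounded hsum.hasSum hb).trans ?_
  refine le_trans (le_of_eq ?_) (tsum_ite_le_tinyMass J N (fun m => ¬ m.Coprime q) fun m hm hp =>
    hN m hp (by rwa [hp.coprime_iff_not_dvd, not_not] at hm))
  exact tsum_congr fun m => by congr

theorem primitiveCharacter_natCast {q : ℕ} (χ : DirichletCharacter ℂ q) {m : ℕ}
    (hm : m.Coprime q) : χ m = χ.primitiveCharacter m := by
  have := primitiveCharacter_apply_of_isCoprime χ (a := (m : ℤ)) (by exact_mod_cast hm.isCoprime)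
  exact_mod_cast this.symm

theorem natCast_eq_zero_of_not_coprime {q : ℕ} (χ : DirichletCharacter ℂ q) {m : ℕ}
    (hm : ¬ m.Coprime q) : χ m = 0 :=
  χ.map_nonunit (by rwa [ZMod.isUnit_iff_coprime])

theorem norm_twistedSum_le_primitive {q J N : ℕ} (χ : DirichletCharacter ℂ q)
    (hN : ∀ l, l.Prime → l ∣ q → l < N) :
    ‖twistedSum J χ‖ ≤ ‖twistedSum J χ.primitiveCharacter‖ + tinyMass J N := by
  have := norm_tsum_twist_sub_le (u := fun m : ℕ => χ m)
    (v := fun m : ℕ => χ.primitiveCharacter m) (J := J)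
    (fun m => χ.norm_le_one _) (fun m => χ.primitiveCharacter.norm_le_one _)
    (fun m hm => natCast_eq_zero_of_not_coprime χ hm)
    (fun m hm => primitiveCharacter_natCast χ hm) hN
  exact (norm_le_norm_add_norm_sub' _ (twistedSum J χ.primitiveCharacter)).trans (by gcongr; exact this)

theorem sum_norm_twistedSum_primitive_le {q D : ℕ} [NeZero q] (J : ℕ) (hD : q ≤ D) :
    ∑ χ ∈ Finset.univ.erase (1 : DirichletCharacter ℂ q), ‖twistedSum J χ.primitiveCharacter‖ ≤
      ∑ p ∈ (primitiveUpTo D).filter (fun p => p.1 ∣ q), ‖twistedSum J p.2‖ := by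
  classical
  let g : DirichletCharacter ℂ q → Σ r : ℕ, DirichletCharacter ℂ r :=
    fun χ => ⟨χ.conductor, χ.primitiveCharacter⟩
  have hinj : Function.Injective g := by
    refine Function.LeftInverse.injective
      (g := fun p => if h : p.1 ∣ q then changeLevel h p.2 else 1) fun χ => ?_
    have h := χ.conductor_dvd_level
    simp only [g, h, dif_pos]
    exact changeLevel_primitiveCharacter χ
  have h1 : ∑ χ ∈ Finset.univ.erase (1 : DirichletCharacter ℂ q),
      ‖twistedSum J χ.primitiveCharacter‖ =
      ∑ p ∈ (Finset.univ.erase (1 : DirichletCharacter ℂ q)).image g, ‖twistedSum J p.2‖ := by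
    rw [Finset.sum_image fun _ _ _ _ h => hinj h]
  rw [h1]
  refine Finset.sum_le_sum_of_subset_of_nonneg (fun p hp => ?_) fun _ _ _ => norm_nonneg _
  obtain ⟨χ, hχ, rfl⟩ := Finset.mem_image.1 hp
  refine Finset.mem_filter.2 ⟨mem_primitiveUpTo.2 ⟨⟨?_, ?_⟩, χ.primitiveCharacter_isPrimitive⟩,
    χ.conductor_dvd_level⟩
  · have hne : χ.conductor ≠ 1 := fun h =>
      Finset.ne_of_mem_erase hχ (χ.eq_one_iff_conductor_eq_one.2 h)
    have hne0 : χ.conductor ≠ 0 := fun h =>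
      NeZero.ne q (Nat.eq_zero_of_zero_dvd (h ▸ χ.conductor_dvd_level))
    show 1 < χ.conductor
    omega
  · exact (Nat.le_of_dvd (Nat.pos_of_ne_zero (NeZero.ne q)) χ.conductor_dvd_level).trans hD

open ArithmeticFunction in
/-- The von Mangoldt mass. -/
noncomputable def totalMass (J : ℕ) : ℝ := ∑' m : ℕ, vonMangoldt m * logWeight J m

open ArithmeticFunction in
theorem abs_tsum_modEq_sub_le {q D J N a : ℕ} (hq : 0 < q) (hD : q ≤ D) (ha : a.Coprime q)
    (hN : ∀ l, l.Prime → l ∣ q → l < N) :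
    |∑' m : ℕ, (if m ≡ a [MOD q] then vonMangoldt m * logWeight J m else 0) -
        totalMass J / q.totient| ≤
      1 / q.totient * (∑ p ∈ (primitiveUpTo D).filter (fun p => p.1 ∣ q), ‖twistedSum J p.2‖) +
        tinyMass J N := by
  classical
  have : NeZero q := ⟨hq.ne'⟩
  have hφ : (0 : ℝ) < q.totient := by exact_mod_cast Nat.totient_pos.2 hq
  have hua : IsUnit (a : ZMod q) := (ZMod.isUnit_iff_coprime a q).2 ha
  set T : ℝ := ∑' m : ℕ, (if m ≡ a [MOD q] then vonMangoldt m * logWeight J m else 0) with hT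
  have hexp : ((q.totient * T : ℝ) : ℂ) =
      ∑ χ : DirichletCharacter ℂ q, χ (a : ZMod q)⁻¹ * twistedSum J χ := by
    have h1 : HasSum (fun m : ℕ => ∑ χ : DirichletCharacter ℂ q, χ (a : ZMod q)⁻¹ *
        (χ m * ((vonMangoldt m * logWeight J m : ℝ) : ℂ)))
        (∑ χ : DirichletCharacter ℂ q, χ (a : ZMod q)⁻¹ * twistedSum J χ) :=
      hasSum_sum fun χ _ => (summable_twist (fun m => χ.norm_le_one _) J).hasSum.mul_left _
    rw [← h1.tsum_eq, hT, ← tsum_mul_left, Complex.ofReal_tsum]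
    refine tsum_congr fun m => ?_
    simp_rw [← mul_assoc]
    rw [← Finset.sum_mul, sum_char_inv_mul_char_eq ℂ hua]
    have hiff : (a : ZMod q) = m ↔ m ≡ a [MOD q] := by
      rw [eq_comm, ZMod.natCast_eq_natCast_iff]
    by_cases hm : m ≡ a [MOD q]
    · rw [if_pos hm, if_pos (hiff.2 hm)]
      push_cast
      ring
    · rw [if_neg hm, if_neg (fun h => hm (hiff.1 h))]
      simp
  have hone : ‖twistedSum J (1 : DirichletCharacter ℂ q) - (totalMass J : ℂ)‖ ≤ tinyMass J N := by
    have h2 := norm_tsum_twist_sub_le (u := fun m : ℕ => (1 : DirichletCharacter ℂ q) m)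
      (v := fun _ => 1) (J := J) (fun m => DirichletCharacter.norm_le_one _ _)
      (fun m => by simp) (fun m hm => natCast_eq_zero_of_not_coprime _ hm)
      (fun m hm => MulChar.one_apply ((ZMod.isUnit_iff_coprime m q).2 hm)) hN
    rw [totalMass, Complex.ofReal_tsum]
    simpa [twistedSum, logWeight] using h2
  have hcard : (Fintype.card (DirichletCharacter ℂ q) : ℝ) = q.totient := by
    rw [← Nat.card_eq_fintype_card, card_eq_totient_of_hasEnoughRootsOfUnity]
  have hnorm : ‖((q.totient * T : ℝ) : ℂ) - totalMass J‖ ≤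
      (∑ p ∈ (primitiveUpTo D).filter (fun p => p.1 ∣ q), ‖twistedSum J p.2‖) +
        q.totient * tinyMass J N := by
    have h3 : (q.totient : ℝ) * tinyMass J N = tinyMass J N +
        ∑ χ ∈ Finset.univ.erase (1 : DirichletCharacter ℂ q), tinyMass J N := by
      rw [Finset.add_sum_erase _ (fun _ => tinyMass J N) (Finset.mem_univ _), Finset.sum_const,
        Finset.card_univ, nsmul_eq_mul, hcard]
    have hone' : (1 : DirichletCharacter ℂ q) (a : ZMod q)⁻¹ = 1 := by
      obtain ⟨u, hu⟩ := hua
      rw [← hu, ZMod.inv_coe_unit]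
      exact MulChar.one_apply (Units.isUnit _)
    rw [hexp, ← Finset.add_sum_erase _ _ (Finset.mem_univ (1 : DirichletCharacter ℂ q)), hone',
      one_mul, add_sub_right_comm, h3, add_comm (∑ p ∈ _, _), add_assoc]
    refine (norm_add_le _ _).trans (add_le_add hone ((norm_sum_le _ _).trans ?_))
    refine (Finset.sum_le_sum (g := fun χ : DirichletCharacter ℂ q =>
      tinyMass J N + ‖twistedSum J χ.primitiveCharacter‖) fun χ _ => ?_).trans
      ((Finset.sum_add_distrib).le.trans ?_)
    · rw [norm_mul, add_comm]
      exact (mul_le_of_le_one_left (norm_nonneg _) (χ.norm_le_one _)).trans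
        (norm_twistedSum_le_primitive χ hN)
    · gcongr
      exact sum_norm_twistedSum_primitive_le J hD
  have hre : ‖((q.totient * T : ℝ) : ℂ) - totalMass J‖ = |q.totient * T - totalMass J| := by
    rw [← Complex.ofReal_sub, Complex.norm_real, Real.norm_eq_abs]
  rw [hre] at hnorm
  have h4 : T - totalMass J / q.totient = (q.totient * T - totalMass J) / q.totient := by
    field_simp
  rw [h4, abs_div, abs_of_pos hφ, div_le_iff₀ hφ]
  refine hnorm.trans_eq ?_
  field_simp

end TupleSieve

namespace TupleSieve

variable {k n W : ℕ} {R : ℝ} {p : Fin n → ℕ}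

/-- The modulus attached to an assignment, including the fixed modulus `W`. -/
def modulus (W : ℕ) (p : Fin n → ℕ) (θ : Fin n → Option (Fin k)) : ℕ :=
  W * ∏ l, (θ l).elim 1 fun _ => p l

theorem modulus_cast (W : ℕ) (p : Fin n → ℕ) (θ : Fin n → Option (Fin k)) :
    (modulus W p θ : ℝ) = W * size p θ := by
  rw [modulus, size]
  push_cast
  congr 1
  refine Finset.prod_congr rfl fun l _ => ?_
  rcases θ l with _ | j <;> simp

/-- The reciprocal of the totient of the modulus, apart from the factor `W`. -/
noncomputable def invTotient (p : Fin n → ℕ) (θ : Fin n → Option (Fin k)) : ℝ :=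
  ∏ l, (θ l).elim 1 fun _ => 1 / ((p l : ℝ) - 1)

namespace PrimeList

theorem one_lt (h : PrimeList W R p) (l : Fin n) : (1 : ℝ) < p l := by
  exact_mod_cast (h.prime l).one_lt

theorem coprime_elim (h : PrimeList W R p) (θ : Fin n → Option (Fin k)) {l m : Fin n}
    (hlm : l ≠ m) :
    Nat.Coprime ((θ l).elim 1 fun _ => p l) ((θ m).elim 1 fun _ => p m) := by
  rcases θ l with _ | j
  · exact Nat.coprime_one_left _
  · rcases θ m with _ | j'
    · exact Nat.coprime_one_right _
    · exact (Nat.coprime_primes (h.prime l) (h.prime m)).2 fun h' => hlm (h.injective h')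

theorem coprime_W_elim (h : PrimeList W R p) (θ : Fin n → Option (Fin k)) (l : Fin n) :
    Nat.Coprime W ((θ l).elim 1 fun _ => p l) := by
  rcases θ l with _ | j
  · exact Nat.coprime_one_right _
  · exact ((Nat.Prime.coprime_iff_not_dvd (h.prime l)).2 (h.not_dvd l)).symm

theorem totient_modulus (h : PrimeList W R p) (θ : Fin n → Option (Fin k)) :
    1 / ((modulus W p θ).totient : ℝ) = 1 / (W.totient : ℝ) * invTotient p θ := by
  have hprod : ∀ s : Finset (Fin n),
      1 / ((∏ l ∈ s, (θ l).elim 1 fun _ => p l).totient : ℝ) =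
        ∏ l ∈ s, (θ l).elim 1 fun _ => 1 / ((p l : ℝ) - 1) := fun s => by
    classical
    induction s using Finset.induction_on with
    | empty => simp
    | insert a s ha ih =>
      rw [Finset.prod_insert ha, Finset.prod_insert ha, Nat.totient_mul, ← ih]
      · push_cast
        rw [← one_div_mul_one_div]
        congr 1
        rcases θ a with _ | j
        · simp
        · simp [Nat.totient_prime (h.prime a), Nat.cast_sub (h.prime a).one_le]
      · exact Nat.Coprime.prod_right fun l hl =>
          h.coprime_elim θ fun h' => ha (h' ▸ hl)
  rw [modulus, Nat.totient_mul (Nat.Coprime.prod_right fun l _ => h.coprime_W_elim θ l), invTotient,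
    ← hprod]
  push_cast
  rw [one_div_mul_one_div]

end PrimeList

theorem dvd_mul_prod_gcd {ι : Type*} (r : ℕ) (s : Finset ι) (e : ι → ℕ) :
    ∀ W : ℕ, r ∣ W * ∏ l ∈ s, e l → r ∣ W * ∏ l ∈ s, r.gcd (e l) := by
  classical
  induction s using Finset.induction_on with
  | empty => exact fun W h => by simpa using h
  | insert a s ha ih =>
    intro W h
    rw [Finset.prod_insert ha] at h ⊢
    rw [← mul_assoc] at h
    have h1 := ih _ h
    rw [mul_comm W, mul_assoc] at h1
    have h2 := Nat.dvd_gcd_mul_iff_dvd_mul.2 h1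
    rwa [← mul_assoc, mul_comm W, mul_assoc]

/-- The local weight detecting a divisor `r` of the modulus. -/
noncomputable def divisorWeight (r q : ℕ) (d : Option (Fin k)) : ℝ :=
  if q ∣ r then d.elim 0 fun _ => √q else 1

theorem divisorWeight_nonneg (r q : ℕ) (d : Option (Fin k)) : 0 ≤ divisorWeight r q d := by
  rw [divisorWeight]
  split_ifs
  · rcases d with _ | j
    exacts [le_rfl, Real.sqrt_nonneg _]
  · exact zero_le_one

theorem PrimeList.one_le_divisorWeight (h : PrimeList W R p) {r : ℕ} (hr : 0 < r) (hW : 0 < W)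
    {θ : Fin n → Option (Fin k)} (hd : r ∣ modulus W p θ) :
    1 ≤ √(W / r) * ∏ l, divisorWeight r (p l) (θ l) := by
  have hnone : ∀ l, p l ∣ r → ∃ j, θ l = some j := fun l hl => by
    have h1 := hl.trans hd
    rw [modulus, (h.prime l).dvd_mul, (h.prime l).prime.dvd_finsetProd_iff] at h1
    rcases h1 with h1 | ⟨m, -, h1⟩
    · exact absurd h1 (h.not_dvd l)
    · rcases hm : θ m with _ | j
      · rw [hm] at h1
        exact absurd (Nat.dvd_one.1 h1) (h.prime l).ne_one
      · rw [hm] at h1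
        have := h.injective ((Nat.prime_dvd_prime_iff_eq (h.prime l) (h.prime m)).1 h1)
        exact ⟨j, this ▸ hm⟩
  have h2 := dvd_mul_prod_gcd r Finset.univ _ W hd
  have h3 : ∀ l, r.gcd ((θ l).elim 1 fun _ => p l) = if p l ∣ r then p l else 1 := fun l => by
    split_ifs with hl
    · obtain ⟨j, hj⟩ := hnone l hl
      rw [hj]
      exact Nat.gcd_eq_right hl
    · rcases θ l with _ | j
      · exact Nat.gcd_one_right r
      · exact (((h.prime l).coprime_iff_not_dvd).2 hl).symm
  simp_rw [h3] at h2
  have h4 : (r : ℝ) ≤ W * ∏ l, if p l ∣ r then (p l : ℝ) else 1 := by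
    have := Nat.le_of_dvd (Nat.mul_pos hW (Finset.prod_pos fun l _ => by
      split_ifs
      exacts [(h.prime l).pos, one_pos])) h2
    have h5 : ((W * ∏ l, if p l ∣ r then p l else 1 : ℕ) : ℝ) =
        W * ∏ l, if p l ∣ r then (p l : ℝ) else 1 := by push_cast; rfl
    rw [← h5]
    exact_mod_cast this
  have h6 : ∏ l, divisorWeight r (p l) (θ l) = √(∏ l, if p l ∣ r then (p l : ℝ) else 1) := by
    rw [Real.sqrt_prod _ fun l _ => by split_ifs <;> positivity]
    refine Finset.prod_congr rfl fun l _ => ?_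
    rw [divisorWeight]
    split_ifs with hl
    · obtain ⟨j, hj⟩ := hnone l hl
      rw [hj]
      rfl
    · exact Real.sqrt_one.symm
  have hr' : (0 : ℝ) < r := by exact_mod_cast hr
  rw [h6, ← Real.sqrt_mul (by positivity), Real.one_le_sqrt, div_mul_eq_mul_div, one_le_div hr']
  exact h4

theorem sum_sum_prod_eq (G : Fin n → Option (Fin k) → Option (Fin k) → ℝ) :
    ∑ δ : Fin n → Option (Fin k), ∑ ε : Fin n → Option (Fin k), ∏ l, G l (δ l) (ε l) =
      ∏ l, ∑ d, ∑ e, G l d e := by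
  rw [Fintype.prod_sum fun l d => ∑ e, G l d e]
  exact Finset.sum_congr rfl fun δ _ => (Fintype.prod_sum fun l e => G l (δ l) e).symm

theorem PrimeList.sum_invTotient_le (h : PrimeList W R p) {r : ℕ} (hr : 0 < r) (hW : 0 < W)
    (hp : ∀ l, (2 * (((k : ℝ) + 1) ^ 2 - 1)) ^ 2 ≤ p l) :
    ∑ δ : Fin n → Option (Fin k), ∑ ε : Fin n → Option (Fin k),
      (if r ∣ modulus W p (merge δ ε) then invTotient p (merge δ ε) else 0) ≤
      √(W / r) * eulerProd p (2 * (((k : ℝ) + 1) ^ 2 - 1)) := by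
  set K : ℝ := 2 * (((k : ℝ) + 1) ^ 2 - 1) with hK
  have hK0 : 0 ≤ K := by
    rw [hK]
    nlinarith [k.cast_nonneg (α := ℝ)]
  have hinv0 : ∀ l (d : Option (Fin k)), 0 ≤ (d.elim 1 fun _ => 1 / ((p l : ℝ) - 1) : ℝ) :=
    fun l d => by
      have := h.one_lt l
      rcases d with _ | j
      · exact zero_le_one
      · exact one_div_nonneg.2 (by linarith)
  have hinv : ∀ θ : Fin n → Option (Fin k), 0 ≤ invTotient p θ := fun θ =>
    Finset.prod_nonneg fun l _ => hinv0 l _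
  set G : Fin n → Option (Fin k) → Option (Fin k) → ℝ := fun l d e =>
    divisorWeight r (p l) (d.or e) * (d.or e).elim 1 fun _ => 1 / ((p l : ℝ) - 1) with hG
  have hG0 : ∀ l d e, 0 ≤ G l d e := fun l d e =>
    mul_nonneg (divisorWeight_nonneg r _ _) (hinv0 l _)
  calc _ ≤ ∑ δ : Fin n → Option (Fin k), ∑ ε : Fin n → Option (Fin k),
        √(W / r) * ∏ l, G l (δ l) (ε l) := by
        refine Finset.sum_le_sum fun δ _ => Finset.sum_le_sum fun ε _ => ?_
        rw [Finset.prod_mul_distrib, ← mul_assoc]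
        split_ifs with hd
        · exact le_mul_of_one_le_left (hinv _) (h.one_le_divisorWeight hr hW hd)
        · exact mul_nonneg (mul_nonneg (Real.sqrt_nonneg _)
            (Finset.prod_nonneg fun l _ => divisorWeight_nonneg r _ _))
            (Finset.prod_nonneg fun l _ => hinv0 l _)
    _ = √(W / r) * ∏ l, ∑ d, ∑ e, G l d e := by
        simp_rw [← Finset.mul_sum]
        rw [sum_sum_prod_eq]
    _ ≤ _ := by
        refine mul_le_mul_of_nonneg_left (Finset.prod_le_prod (fun l _ =>
          Finset.sum_nonneg fun d _ => Finset.sum_nonneg fun e _ => hG0 l d e) fun l _ => ?_)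
          (Real.sqrt_nonneg _)
        have h1 := h.one_lt l
        have h2 : (2 : ℝ) ≤ p l := by exact_mod_cast (h.prime l).two_le
        have hval : ∑ d, ∑ e, G l d e = (if p l ∣ r then 0 else 1) +
            K / 2 * ((if p l ∣ r then √(p l) else 1) * (1 / ((p l : ℝ) - 1))) := by
          rw [Fintype.sum_option (f := fun d => ∑ e, G l d e),
            Fintype.sum_option (f := fun e => G l none e)]
          simp_rw [Fintype.sum_option (f := fun e => G l (some _) e)]
          simp only [hG, divisorWeight, Option.or_none, Option.none_or, Option.some_or,
            Option.elim_none, Option.elim_some, Finset.sum_const, Finset.card_univ,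
            Fintype.card_fin, nsmul_eq_mul, hK]
          ring
        rw [hval]
        have h3 : 1 / ((p l : ℝ) - 1) ≤ 2 / p l := by
          rw [div_le_div_iff₀ (by linarith) (by linarith)]
          linarith
        have h4 : K / 2 * (1 / ((p l : ℝ) - 1)) ≤ K / p l := by
          refine (mul_le_mul_of_nonneg_left h3 (by positivity)).trans_eq ?_
          field_simp
        split_ifs with hl
        · have h5 : K ≤ √(p l) := Real.le_sqrt_of_sq_le (hp l)
          have h6 : K / 2 * (√(p l) * (1 / ((p l : ℝ) - 1))) ≤ 1 := by
            calc K / 2 * (√(p l) * (1 / ((p l : ℝ) - 1)))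
                = √(p l) * (K / 2 * (1 / ((p l : ℝ) - 1))) := by ring
              _ ≤ √(p l) * (√(p l) / p l) := by
                  refine mul_le_mul_of_nonneg_left (h4.trans ?_) (Real.sqrt_nonneg _)
                  gcongr
              _ = 1 := by
                  rw [← mul_div_assoc, Real.mul_self_sqrt (by linarith),
                    div_self (by linarith)]
          have : 0 ≤ K / p l := by positivity
          linarith
        · rw [one_mul]
          linarith

/-- Mertens-type upper bound for the Euler product. -/
theorem PrimeList.eulerProd_le (h : PrimeList W R p) (hR : 1 < R) (K : ℕ) :
    eulerProd p K ≤ (1 + Real.log R) ^ (3 * K) := by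
  have hlog : 0 < Real.log R := Real.log_pos hR
  set σ : ℝ := 1 + 1 / Real.log R with hσ
  have hσ1 : 1 < σ := by
    rw [hσ]
    linarith [one_div_pos.2 hlog]
  have hpos : ∀ l, (0 : ℝ) < p l := fun l => by linarith [h.one_lt l]
  have hsum : Summable fun m : ℕ => (m : ℝ) ^ (-σ) := Real.summable_nat_rpow.2 (by linarith)
  have hprod : ∏ l, (1 + (p l : ℝ) ^ (-σ)) ≤ 1 + Real.log R := by
    rw [Finset.prod_one_add]
    have hinj : Function.Injective fun A : Finset (Fin n) => ∏ m ∈ A, p m := fun A B hAB => by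
      ext l
      rw [← h.dvd_prod_iff, ← h.dvd_prod_iff]
      exact iff_of_eq (congrArg _ hAB)
    have h1 : ∑ A ∈ Finset.univ.powerset, ∏ l ∈ A, (p l : ℝ) ^ (-σ) =
        ∑ m ∈ Finset.univ.image fun A : Finset (Fin n) => ∏ m ∈ A, p m, (m : ℝ) ^ (-σ) := by
      rw [Finset.sum_image fun _ _ _ _ h => hinj h, Finset.powerset_univ]
      refine Finset.sum_congr rfl fun A _ => ?_
      push_cast
      exact Real.finsetProd_rpow _ _ (fun l _ => (hpos l).le) _
    rw [h1]
    refine (hsum.sum_le_tsum _ fun m _ => Real.rpow_nonneg m.cast_nonneg _).trans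
      ((tsum_rpow_neg_le hσ1).trans_eq ?_)
    rw [hσ]
    field_simp
    ring
  calc eulerProd p K ≤ ∏ l, (1 + (p l : ℝ) ^ (-σ)) ^ (3 * K) := by
        refine Finset.prod_le_prod (fun l _ => by positivity) fun l _ => ?_
        have h1 : 1 + ((3 * K : ℕ) : ℝ) * (p l : ℝ) ^ (-σ) ≤ (1 + (p l : ℝ) ^ (-σ)) ^ (3 * K) :=
          one_add_mul_le_pow (by linarith [Real.rpow_nonneg (hpos l).le (-σ)]) _
        refine le_trans ?_ h1
        have h2 : (p l : ℝ) ^ (1 / Real.log R) ≤ 3 := by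
          have : (p l : ℝ) ^ (1 / Real.log R) ≤ R ^ (1 / Real.log R) :=
            Real.rpow_le_rpow (hpos l).le (h.le l) (by positivity)
          refine this.trans ?_
          rw [Real.rpow_def_of_pos (by linarith), mul_one_div_cancel hlog.ne']
          exact Real.exp_one_lt_three.le
        have h3 : 1 / (p l : ℝ) ≤ 3 * (p l : ℝ) ^ (-σ) := by
          have h4 : (p l : ℝ) ^ (-σ) = 1 / (p l : ℝ) / (p l : ℝ) ^ (1 / Real.log R) := by
            rw [hσ, neg_add, Real.rpow_add (hpos l), Real.rpow_neg_one, Real.rpow_neg (hpos l).le]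
            rw [one_div (p l : ℝ), ← div_eq_mul_inv]
          rw [h4, mul_div_assoc', le_div_iff₀ (Real.rpow_pos_of_pos (hpos l) _), mul_comm]
          exact mul_le_mul_of_nonneg_right h2 (one_div_pos.2 (hpos l)).le
        have h5 := mul_le_mul_of_nonneg_left h3 (Nat.cast_nonneg (α := ℝ) K)
        push_cast
        rw [div_eq_mul_one_div]
        linarith
    _ = (∏ l, (1 + (p l : ℝ) ^ (-σ))) ^ (3 * K) := Finset.prod_pow _ _ _
    _ ≤ _ := pow_le_pow_left₀ (Finset.prod_nonneg fun l _ => by positivity) hprod _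

end TupleSieve

namespace TupleSieve

variable {k n W : ℕ} {R : ℝ} {p : Fin n → ℕ} {h : Fin k → ℕ}

open Classical in
/-- The divisibility pattern of the translates `m + h j`. -/
noncomputable def pattern (p : Fin n → ℕ) (h : Fin k → ℕ) (m : ℕ) (l : Fin n) : Option (Fin k) :=
  if H : ∃ j, p l ∣ m + h j then some H.choose else none

/-- The primes `p l` separate the shifts `h j`. -/
def Separates (p : Fin n → ℕ) (h : Fin k → ℕ) : Prop :=
  ∀ l m i j, p l ∣ m + h i → p l ∣ m + h j → i = j

theorem separates_of_lt (hinj : Function.Injective h) (hlt : ∀ l j, h j < p l) :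
    Separates p h := by
  intro l m i j hi hj
  refine hinj ?_
  have h1 : m + h i ≡ m + h j [MOD p l] :=
    ((Nat.modEq_zero_iff_dvd).2 hi).trans ((Nat.modEq_zero_iff_dvd).2 hj).symm
  exact (Nat.ModEq.add_left_cancel' m h1).eq_of_lt_of_lt (hlt l i) (hlt l j)

/-- The integer `m` satisfies the divisibility conditions of `θ`. -/
def Meets (p : Fin n → ℕ) (h : Fin k → ℕ) (θ : Fin n → Option (Fin k)) (m : ℕ) : Prop :=
  ∀ l j, θ l = some j → p l ∣ m + h j

theorem below_pattern_iff (hs : Separates p h) {θ : Fin n → Option (Fin k)} {m : ℕ} :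
    Below θ (pattern p h m) ↔ Meets p h θ m := by
  refine forall_congr' fun l => ?_
  rcases θ l with _ | j
  · simp
  · simp only [reduceCtorEq, false_or, Option.some.injEq, forall_eq']
    rw [pattern]
    split_ifs with H
    · rw [Option.some.injEq]
      exact ⟨fun hj => hj ▸ H.choose_spec, fun hj => hs l m _ _ hj H.choose_spec⟩
    · simp only [false_iff]
      exact fun hj => H ⟨j, hj⟩

/-- The conditions of `θ` together with a residue class modulo `W` cut out a residue class. -/
theorem PrimeList.exists_modEq_iff (hP : PrimeList W R p) (h : Fin k → ℕ) (b : ℕ)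
    (θ : Fin n → Option (Fin k)) :
    ∃ c, ∀ m, (m ≡ b [MOD W] ∧ Meets p h θ m) ↔ m ≡ c [MOD modulus W p θ] := by
  classical
  suffices H : ∀ s : Finset (Fin n), ∃ c, ∀ m,
      (m ≡ b [MOD W] ∧ ∀ l ∈ s, ∀ j, θ l = some j → p l ∣ m + h j) ↔
        m ≡ c [MOD W * ∏ l ∈ s, (θ l).elim 1 fun _ => p l] by
    simpa [Meets, modulus] using H Finset.univ
  intro s
  induction s using Finset.induction_on with
  | empty => exact ⟨b, fun m => by simp⟩
  | insert a s ha ih =>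
    obtain ⟨c, hc⟩ := ih
    have hco : Nat.Coprime ((θ a).elim 1 fun _ => p a)
        (W * ∏ l ∈ s, (θ l).elim 1 fun _ => p l) :=
      Nat.Coprime.mul_right (hP.coprime_W_elim θ a).symm
        (Nat.Coprime.prod_right fun l hl => hP.coprime_elim θ fun h' => ha (h' ▸ hl))
    have hloc : ∃ d, ∀ m, (∀ j, θ a = some j → p a ∣ m + h j) ↔
        m ≡ d [MOD (θ a).elim 1 fun _ => p a] := by
      rcases θ a with _ | j
      · exact ⟨0, fun m => by simp [Nat.modEq_one]⟩
      · refine ⟨h j * (p a - 1), fun m => ?_⟩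
        simp only [Option.some.injEq, forall_eq', Option.elim_some]
        have h1 : h j * (p a - 1) + h j ≡ 0 [MOD p a] := by
          rw [Nat.modEq_zero_iff_dvd, ← Nat.mul_succ, Nat.succ_eq_add_one,
            Nat.sub_add_cancel (hP.prime a).one_le]
          exact dvd_mul_left _ _
        rw [← Nat.modEq_zero_iff_dvd]
        exact ⟨fun h2 => Nat.ModEq.add_right_cancel' (h j) (h2.trans h1.symm),
          fun h2 => (h2.add_right _).trans h1⟩
    obtain ⟨d, hd⟩ := hloc
    obtain ⟨e, he1, he2⟩ := Nat.chineseRemainder hco d c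
    refine ⟨e, fun m => ?_⟩
    rw [Finset.prod_insert ha, mul_left_comm, ← Nat.modEq_and_modEq_iff_modEq_mul hco]
    have h3 : m ≡ e [MOD (θ a).elim 1 fun _ => p a] ↔ ∀ j, θ a = some j → p a ∣ m + h j := by
      rw [hd]
      exact ⟨fun h4 => h4.trans he1, fun h4 => h4.trans he1.symm⟩
    have h4 : m ≡ e [MOD W * ∏ l ∈ s, (θ l).elim 1 fun _ => p l] ↔
        (m ≡ b [MOD W] ∧ ∀ l ∈ s, ∀ j, θ l = some j → p l ∣ m + h j) := by
      rw [hc]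
      exact ⟨fun h5 => h5.trans he2, fun h5 => h5.trans he2.symm⟩
    rw [h3, h4]
    simp only [Finset.mem_insert, forall_eq_or_imp]
    tauto

theorem modulus_pos (hP : PrimeList W R p) (hW : 0 < W) (θ : Fin n → Option (Fin k)) :
    0 < modulus W p θ :=
  Nat.mul_pos hW (Finset.prod_pos fun l _ => by
    rcases θ l with _ | j
    exacts [one_pos, (hP.prime l).pos])

theorem abs_quadForm_sub_le_of {lam M M' E : (Fin n → Option (Fin k)) → ℝ} {c : ℝ}
    (hE : ∀ δ ε, lam δ ≠ 0 → lam ε ≠ 0 →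
      |M (merge δ ε) - c * M' (merge δ ε)| ≤ E (merge δ ε)) (hE0 : ∀ θ, 0 ≤ E θ) :
    |quadForm lam M - c * quadForm lam M'| ≤
      ∑ δ, ∑ ε, |lam δ| * |lam ε| * E (merge δ ε) := by
  refine (abs_quadForm_sub_le lam M M' c).trans
    (Finset.sum_le_sum fun δ _ => Finset.sum_le_sum fun ε _ => ?_)
  rcases eq_or_ne (lam δ) 0 with h1 | h1
  · simp [h1]
  rcases eq_or_ne (lam ε) 0 with h2 | h2
  · simp [h2]
  refine mul_le_mul_of_nonneg_left ?_ (by positivity)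
  split_ifs
  exacts [hE δ ε h1 h2, hE0 _]

theorem tsum_mul_sieveForm_sq {w : ℕ → ℝ} (hw : Summable w) (h0 : ∀ m, 0 ≤ w m)
    (a : (Fin n → Option (Fin k)) → ℝ) (x : ℕ → Fin n → Option (Fin k)) :
    HasSum (fun m => w m * sieveForm p a (x m) ^ 2)
      (quadForm (divCoeff p a) fun θ => ∑' m, open Classical in
        w m * if Below θ (x m) then 1 else 0) := by
  simp_rw [sieveForm_sq_eq]
  refine hasSum_quadForm _ w _ fun θ => hw.of_nonneg_of_le (fun m => ?_) fun m => ?_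
  · exact mul_nonneg (h0 m) (by split_ifs <;> norm_num)
  · exact mul_le_of_le_one_right (h0 m) (by split_ifs <;> norm_num)

open Classical in
/-- The sieve-weighted sum over integers in a residue class. -/
noncomputable def intSum (J W n₀ b : ℕ) (p : Fin n → ℕ) (h : Fin k → ℕ)
    (a : (Fin n → Option (Fin k)) → ℝ) : ℝ :=
  ∑' m, (if n₀ + m ≡ b [MOD W] then logWeight (J + 1) (n₀ + m) else 0) *
    sieveForm p a (pattern p h (n₀ + m)) ^ 2

theorem summable_ite_logWeight (J n₀ : ℕ) (P : ℕ → Prop) [DecidablePred P] :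
    Summable fun m => if P m then logWeight J (n₀ + m) else 0 :=
  ((summable_logWeight J).comp_injective (add_right_injective n₀)).of_nonneg_of_le
    (fun m => by split_ifs; exacts [logWeight_nonneg _ _, le_rfl])
    (fun m => by split_ifs; exacts [le_rfl, logWeight_nonneg _ _])

theorem intSum_le {J n₀ b : ℕ} (hP : PrimeList W R p) (hW : 0 < W) (hs : Separates p h)
    (hk : ∀ l, k ≤ p l) (hn₀ : Real.exp ((J + 1 : ℕ) / 2) ≤ n₀) (a : (Fin n → Option (Fin k)) → ℝ) :
    intSum J W n₀ b p h a ≤ 2 * (J + 1).factorial / W * intMean p a +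
      logWeight (J + 1) n₀ * (∑ δ, |divCoeff p a δ|) ^ 2 := by
  classical
  set F : ℕ → ℝ := fun m => logWeight (J + 1) (n₀ + m) with hF
  have hFs : Summable F := (summable_logWeight (J + 1)).comp_injective (add_right_injective n₀)
  have hanti : Antitone F := antitone_logWeight_add _ _ hn₀
  have htot : ∑' m, F m ≤ 2 * (J + 1).factorial := tsum_logWeight_add_le _ _ hn₀
  have hW' : (0 : ℝ) < W := by exact_mod_cast hW
  have h1 : intSum J W n₀ b p h a = _ :=
    (tsum_mul_sieveForm_sq (p := p) (summable_ite_logWeight (J + 1) n₀ fun m => n₀ + m ≡ b [MOD W])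
      (fun m => by split_ifs; exacts [logWeight_nonneg _ _, le_rfl]) a
      fun m => pattern p h (n₀ + m)).tsum_eq
  have h2 : intMean p a = quadForm (divCoeff p a) fun θ => 1 / size p θ := intMean_eq p a
  have hloc : ∀ θ : Fin n → Option (Fin k),
      |(∑' m, (if n₀ + m ≡ b [MOD W] then logWeight (J + 1) (n₀ + m) else 0) *
        if Below θ (pattern p h (n₀ + m)) then 1 else 0) - (∑' m, F m) / W * (1 / size p θ)| ≤
      F 0 := fun θ => by
    obtain ⟨c, hc⟩ := hP.exists_modEq_iff h b θ
    set q := modulus W p θ with hq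
    have hq0 : 0 < q := modulus_pos hP hW θ
    have hcond : ∀ m, n₀ + m ≡ c [MOD q] ↔ m ≡ c + n₀ * (q - 1) [MOD q] := fun m => by
      have h3 : n₀ + (c + n₀ * (q - 1)) ≡ c [MOD q] := by
        have : n₀ + (c + n₀ * (q - 1)) = c + n₀ * q := by
          have h4 : n₀ * (q - 1) + n₀ = n₀ * q := by
            rw [← Nat.mul_succ, Nat.succ_eq_add_one, Nat.sub_add_cancel hq0]
          omega
        rw [this]
        simp [Nat.ModEq]
      exact ⟨fun h4 => Nat.ModEq.add_left_cancel' n₀ (h4.trans h3.symm),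
        fun h4 => (h4.add_left n₀).trans h3⟩
    have h3 := abs_tsum_ite_modEq_sub_le hFs hanti hq0 (c + n₀ * (q - 1))
    have h4 : (∑' m, F m) / W * (1 / size p θ) = 1 / q * ∑' m, F m := by
      rw [hq, modulus_cast]
      field_simp
    rw [h4]
    convert h3 using 3
    refine tsum_congr fun m => ?_
    have h5 := hc (n₀ + m)
    rw [hcond, ← below_pattern_iff hs] at h5
    by_cases h6 : n₀ + m ≡ b [MOD W] <;> by_cases h7 : Below θ (pattern p h (n₀ + m)) <;>
      simp [h6, h7] at h5 <;> simp [h6, h7, h5, hF]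
  have h3 := abs_quadForm_sub_le_of (lam := divCoeff p a) (E := fun _ => F 0)
    (M := fun θ => ∑' m, (if n₀ + m ≡ b [MOD W] then logWeight (J + 1) (n₀ + m) else 0) *
      if Below θ (pattern p h (n₀ + m)) then 1 else 0)
    (M' := fun θ => 1 / size p θ) (c := (∑' m, F m) / W)
    (fun δ ε _ _ => hloc (merge δ ε)) fun _ => logWeight_nonneg _ _
  rw [← h1, ← h2] at h3
  have h4 : ∑ δ, ∑ ε, |divCoeff p a δ| * |divCoeff p a ε| * F 0 =
      F 0 * (∑ δ, |divCoeff p a δ|) ^ 2 := by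
    rw [sq, Finset.sum_mul_sum, Finset.mul_sum]
    simp_rw [Finset.mul_sum, mul_comm (F 0)]
  rw [h4] at h3
  have h5 : 0 ≤ intMean p a := by
    rw [intMean]
    refine Finset.sum_nonneg fun x _ => mul_nonneg (Finset.prod_nonneg fun l _ => ?_) (sq_nonneg _)
    exact intWeight_nonneg (hk l) _
  have h6 := mul_le_mul_of_nonneg_right (div_le_div_of_nonneg_right htot hW'.le) h5
  have h7 := (abs_le.1 h3).2
  have h8 : F 0 = logWeight (J + 1) n₀ := rfl
  rw [h8] at h7
  linarith

end TupleSieve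

namespace TupleSieve

open DirichletCharacter

variable {k n W : ℕ} {R : ℝ} {p : Fin n → ℕ} {h : Fin k → ℕ}

open Classical in
/-- The sieve-weighted sum over integers in a residue class whose `i`th shift is prime. -/
noncomputable def primeSum (i : Fin k) (J W n₀ b : ℕ) (p : Fin n → ℕ) (h : Fin k → ℕ)
    (a : (Fin n → Option (Fin k)) → ℝ) : ℝ :=
  ∑' m, (if n₀ + m ≡ b [MOD W] ∧ (n₀ + m + h i).Prime then
    logWeight (J + 1) (n₀ + m + h i) else 0) * sieveForm p a (pattern p h (n₀ + m)) ^ 2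

theorem prime_dvd_modulus {r : ℕ} (hP : PrimeList W R p) (hr : r.Prime)
    {θ : Fin n → Option (Fin k)} (hd : r ∣ modulus W p θ) :
    r ∣ W ∨ ∃ l j, θ l = some j ∧ r = p l := by
  rw [modulus, hr.dvd_mul] at hd
  refine hd.imp_right fun h1 => ?_
  obtain ⟨l, -, hl⟩ := (hr.prime.dvd_finsetProd_iff _).1 h1
  rcases hθ : θ l with _ | j
  · rw [hθ, Option.elim_none] at hl
    exact absurd (Nat.dvd_one.1 hl) hr.ne_one
  · rw [hθ, Option.elim_some] at hl
    exact ⟨l, j, hθ, (Nat.prime_dvd_prime_iff_eq hr (hP.prime l)).1 hl⟩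

theorem coprime_modulus {b c : ℕ} {i : Fin k} {θ : Fin n → Option (Fin k)}
    (hP : PrimeList W R p) (hs : Separates p h) (hb : (b + h i).Coprime W)
    (hθ : ∀ l, θ l ≠ some i) (hcb : c ≡ b [MOD W]) (hc : Meets p h θ c) :
    (c + h i).Coprime (modulus W p θ) := by
  refine Nat.coprime_of_dvd fun r hr h1 h2 => ?_
  rcases prime_dvd_modulus hP hr h2 with h3 | ⟨l, j, hj, rfl⟩
  · have h4 : r ∣ b + h i := ((hcb.add_right (h i)).dvd_iff h3).1 h1
    exact Nat.not_coprime_of_dvd_of_dvd hr.one_lt h4 h3 hb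
  · exact hθ l (by rw [hj, hs l c j i (hc l j hj) h1])

theorem primeDensity_eq {i : Fin k} {θ : Fin n → Option (Fin k)} (hθ : ∀ l, θ l ≠ some i) :
    primeDensity i p θ = invTotient p θ := by
  refine Finset.prod_congr rfl fun l _ => ?_
  rcases hl : θ l with _ | j
  · rfl
  · simp only [Option.elim_some]
    rw [if_neg fun h' => hθ l (hl.trans (congrArg some h'))]

theorem PrimeList.invTotient_nonneg (hP : PrimeList W R p) (θ : Fin n → Option (Fin k)) :
    0 ≤ invTotient p θ := by
  refine Finset.prod_nonneg fun l _ => ?_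
  have := hP.one_lt l
  rcases θ l with _ | j
  · simp
  · simp only [Option.elim_some]
    exact one_div_nonneg.2 (by linarith)

open ArithmeticFunction in
open Classical in
/-- Restricting a weighted sum over a residue class to large primes costs little. -/
theorem abs_primeTail_sub_le {q a J N M : ℕ} (hM : M ≤ N) :
    |(∑' m, if M + m ≡ a [MOD q] ∧ (M + m).Prime then logWeight (J + 1) (M + m) else 0) -
      ∑' m, (if m ≡ a [MOD q] then vonMangoldt m * logWeight J m else 0)| ≤ tinyMass J N := by
  set u : ℕ → ℝ := fun x => if x ≡ a [MOD q] ∧ x.Prime ∧ M ≤ x then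
    vonMangoldt x * logWeight J x else 0 with hu
  have h0 := vonMangoldt_mul_logWeight_nonneg J
  have hsum : ∀ (P : ℕ → Prop) [DecidablePred P], Summable fun x =>
      if P x then vonMangoldt x * logWeight J x else 0 := fun P _ =>
    (summable_vonMangoldt_mul_logWeight J).of_nonneg_of_le
      (fun m => by split_ifs; exacts [h0 m, le_rfl])
      (fun m => by split_ifs; exacts [le_rfl, h0 m])
  have h1 : (∑' m, if M + m ≡ a [MOD q] ∧ (M + m).Prime then logWeight (J + 1) (M + m) else 0) =
      ∑' x, u x := by
    rw [← (add_right_injective M).tsum_eq (f := u)]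
    · refine tsum_congr fun m => ?_
      simp only [hu, Nat.le_add_right, and_true]
      split_ifs with h2
      · rw [vonMangoldt_apply_prime h2.2, log_mul_logWeight]
      · rfl
    · intro x hx
      rw [Function.mem_support, hu] at hx
      have : M ≤ x := by
        by_contra h3
        exact hx (if_neg fun h4 => h3 h4.2.2)
      exact ⟨x - M, by simp [this]⟩
  have h2 : (∑' m, (if m ≡ a [MOD q] then vonMangoldt m * logWeight J m else 0)) - ∑' x, u x =
      ∑' x, if x ≡ a [MOD q] ∧ ¬ (x.Prime ∧ M ≤ x) then vonMangoldt x * logWeight J x else 0 := by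
    rw [← (hsum (fun m => m ≡ a [MOD q])).tsum_sub
      (hsum fun x => x ≡ a [MOD q] ∧ x.Prime ∧ M ≤ x)]
    refine tsum_congr fun x => ?_
    by_cases h3 : x ≡ a [MOD q] <;> by_cases h4 : x.Prime ∧ M ≤ x <;> simp [h3, h4]
  rw [h1, abs_sub_comm, h2, abs_of_nonneg (tsum_nonneg fun x => by
    split_ifs; exacts [h0 x, le_rfl])]
  refine le_trans (le_of_eq (tsum_congr fun m => by congr))
    (tsum_ite_le_tinyMass J N (fun x => x ≡ a [MOD q] ∧ ¬ (x.Prime ∧ M ≤ x)) fun x hx hp => ?_)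
  by_contra h3
  exact hx.2 ⟨hp, hM.trans (not_lt.1 h3)⟩

open Classical in
theorem abs_tsum_meets_sub_le {i : Fin k} {J n₀ b N D : ℕ} {θ : Fin n → Option (Fin k)}
    (hP : PrimeList W R p) (hW : 0 < W) (hs : Separates p h) (hb : (b + h i).Coprime W)
    (hR : R < n₀) (hN : n₀ + h i ≤ N) (hWN : W < N) (hD : modulus W p θ ≤ D) :
    |(∑' m, if (n₀ + m ≡ b [MOD W] ∧ (n₀ + m + h i).Prime) ∧ Meets p h θ (n₀ + m) then
        logWeight (J + 1) (n₀ + m + h i) else 0) -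
      totalMass J / W.totient * primeDensity i p θ| ≤
      1 / W.totient * (∑ χ ∈ primitiveUpTo D, (if χ.1 ∣ modulus W p θ then invTotient p θ else 0) *
        ‖twistedSum J χ.2‖) + 2 * tinyMass J N := by
  have hE : 0 ≤ 1 / (W.totient : ℝ) * (∑ χ ∈ primitiveUpTo D,
      (if χ.1 ∣ modulus W p θ then invTotient p θ else 0) * ‖twistedSum J χ.2‖) := by
    refine mul_nonneg (by positivity) (Finset.sum_nonneg fun χ _ =>
      mul_nonneg ?_ (norm_nonneg _))
    split_ifs
    exacts [hP.invTotient_nonneg θ, le_rfl]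
  by_cases hθ : ∃ l, θ l = some i
  · obtain ⟨l, hl⟩ := hθ
    have h1 : primeDensity i p θ = 0 :=
      Finset.prod_eq_zero (Finset.mem_univ l) (by simp [hl])
    have h2 : ∀ m, ¬ ((n₀ + m ≡ b [MOD W] ∧ (n₀ + m + h i).Prime) ∧ Meets p h θ (n₀ + m)) := by
      rintro m ⟨⟨-, h3⟩, h4⟩
      have h5 := (Nat.prime_dvd_prime_iff_eq (hP.prime l) h3).1 (h4 l i hl)
      have h6 : (p l : ℝ) < n₀ := (hP.le l).trans_lt hR
      have h7 : p l < n₀ := by exact_mod_cast h6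
      omega
    simp only [h1, h2, if_false, tsum_zero, mul_zero, sub_zero, abs_zero]
    linarith [tinyMass_nonneg J N]
  · push Not at hθ
    obtain ⟨c, hc⟩ := hP.exists_modEq_iff h b θ
    obtain ⟨hcb, hcm⟩ := (hc c).2 rfl
    have hco := coprime_modulus hP hs hb hθ hcb hcm
    have h1 : (∑' m, if (n₀ + m ≡ b [MOD W] ∧ (n₀ + m + h i).Prime) ∧ Meets p h θ (n₀ + m) then
        logWeight (J + 1) (n₀ + m + h i) else 0) =
        ∑' m, if n₀ + h i + m ≡ c + h i [MOD modulus W p θ] ∧ (n₀ + h i + m).Prime then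
          logWeight (J + 1) (n₀ + h i + m) else 0 := by
      refine tsum_congr fun m => ?_
      have h2 : n₀ + h i + m ≡ c + h i [MOD modulus W p θ] ↔
          n₀ + m ≡ b [MOD W] ∧ Meets p h θ (n₀ + m) := by
        rw [hc, add_right_comm]
        exact ⟨Nat.ModEq.add_right_cancel' _, fun h3 => h3.add_right _⟩
      refine if_congr ?_ (by rw [add_right_comm]) rfl
      rw [h2, add_right_comm n₀ (h i) m]
      tauto
    have h2 := abs_primeTail_sub_le (q := modulus W p θ) (a := c + h i) (J := J) hN
    have h3 := abs_tsum_modEq_sub_le (J := J) (N := N) (modulus_pos hP hW θ) hD hco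
      fun l hl hd => by
        rcases prime_dvd_modulus hP hl hd with h4 | ⟨l', j, -, rfl⟩
        · exact (Nat.le_of_dvd hW h4).trans_lt hWN
        · have h6 : (p l' : ℝ) < n₀ := (hP.le l').trans_lt hR
          have h7 : p l' < n₀ := by exact_mod_cast h6
          omega
    have h4 : totalMass J / W.totient * primeDensity i p θ =
        totalMass J / (modulus W p θ).totient := by
      rw [div_eq_mul_one_div _ ((modulus W p θ).totient : ℝ), hP.totient_modulus,
        primeDensity_eq hθ]
      ring
    have h5 : 1 / ((modulus W p θ).totient : ℝ) *
        (∑ χ ∈ (primitiveUpTo D).filter (fun χ => χ.1 ∣ modulus W p θ), ‖twistedSum J χ.2‖) =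
        1 / W.totient * (∑ χ ∈ primitiveUpTo D,
          (if χ.1 ∣ modulus W p θ then invTotient p θ else 0) * ‖twistedSum J χ.2‖) := by
      rw [hP.totient_modulus, mul_assoc, Finset.mul_sum, Finset.sum_filter]
      congr 1
      refine Finset.sum_congr rfl fun χ _ => ?_
      split_ifs <;> simp
    rw [h1, h4, ← h5]
    refine (abs_sub_le _ _ _).trans ((add_le_add h2 h3).trans (le_of_eq ?_))
    ring

end TupleSieve

namespace TupleSieve

open DirichletCharacter

variable {k n W : ℕ} {R : ℝ} {p : Fin n → ℕ} {h : Fin k → ℕ}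

theorem PrimeList.modulus_merge_le (hP : PrimeList W R p) {δ ε : Fin n → Option (Fin k)}
    (hδ : size p δ ≤ R) (hε : size p ε ≤ R) : modulus W p (merge δ ε) ≤ W * ⌊R⌋₊ ^ 2 := by
  have hnat : ∀ α : Fin n → Option (Fin k), size p α ≤ R →
      (∏ l, (α l).elim 1 fun _ => p l) ≤ ⌊R⌋₊ := fun α hα => by
    refine Nat.le_floor (le_of_eq_of_le ?_ hα)
    rw [size, Nat.cast_prod]
    refine Finset.prod_congr rfl fun l _ => ?_
    rcases α l with _ | j <;> simp
  refine Nat.mul_le_mul_left W (le_trans ?_ (sq ⌊R⌋₊ ▸ Nat.mul_le_mul (hnat δ hδ) (hnat ε hε)))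
  rw [← Finset.prod_mul_distrib]
  refine Finset.prod_le_prod' fun l _ => ?_
  have := (hP.prime l).one_le
  rw [merge]
  rcases δ l with _ | j
  · simp
  · simpa using Nat.le_mul_of_pos_right _ (by
      rcases ε l with _ | j'
      exacts [one_pos, (hP.prime l).pos])

theorem sum_mul_invTotient_le (hP : PrimeList W R p) (hW : 0 < W)
    (hp : ∀ l, (2 * (((k : ℝ) + 1) ^ 2 - 1)) ^ 2 ≤ p l)
    {lam : (Fin n → Option (Fin k)) → ℝ} {L : ℝ} (hL : ∀ δ, |lam δ| ≤ L) {r : ℕ} (hr : 0 < r) :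
    ∑ δ, ∑ ε, |lam δ| * |lam ε| *
      (if r ∣ modulus W p (merge δ ε) then invTotient p (merge δ ε) else 0) ≤
      L ^ 2 * (√W * eulerProd p (2 * (((k : ℝ) + 1) ^ 2 - 1))) * (r : ℝ) ^ (-(1 / 2) : ℝ) := by
  have h1 : L ^ 2 * (√W * eulerProd p (2 * (((k : ℝ) + 1) ^ 2 - 1))) * (r : ℝ) ^ (-(1 / 2) : ℝ) =
      L ^ 2 * (√(W / r) * eulerProd p (2 * (((k : ℝ) + 1) ^ 2 - 1))) := by
    rw [Real.sqrt_div' _ (by positivity), Real.rpow_neg (by positivity), ← Real.sqrt_eq_rpow]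
    ring
  rw [h1]
  refine le_trans ?_ (mul_le_mul_of_nonneg_left (hP.sum_invTotient_le hr hW hp) (sq_nonneg L))
  rw [Finset.mul_sum]
  refine Finset.sum_le_sum fun δ _ => ?_
  rw [Finset.mul_sum]
  refine Finset.sum_le_sum fun ε _ => mul_le_mul_of_nonneg_right ?_ ?_
  · rw [sq]
    exact mul_le_mul (hL δ) (hL ε) (abs_nonneg _) ((abs_nonneg _).trans (hL δ))
  · split_ifs
    exacts [hP.invTotient_nonneg _, le_rfl]

theorem le_primeSum {i : Fin k} {J n₀ b N : ℕ} {a : (Fin n → Option (Fin k)) → ℝ} {L : ℝ}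
    (hP : PrimeList W R p) (hW : 0 < W) (hs : Separates p h) (hb : (b + h i).Coprime W)
    (hR : R < n₀) (hN : n₀ + h i ≤ N) (hWN : W < N)
    (hp : ∀ l, (2 * (((k : ℝ) + 1) ^ 2 - 1)) ^ 2 ≤ p l)
    (hL : ∀ δ, |divCoeff p a δ| ≤ L) (hsupp : ∀ δ, R < size p δ → divCoeff p a δ = 0) :
    totalMass J / W.totient * primeMean i p a -
      (2 * tinyMass J N * (∑ δ, |divCoeff p a δ|) ^ 2 +
        1 / W.totient * (L ^ 2 * (√W * eulerProd p (2 * (((k : ℝ) + 1) ^ 2 - 1))) *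
          ∑ χ ∈ primitiveUpTo (W * ⌊R⌋₊ ^ 2),
            (χ.1 : ℝ) ^ (-(1 / 2) : ℝ) * ‖twistedSum J χ.2‖)) ≤
      primeSum i J W n₀ b p h a := by
  classical
  set D := W * ⌊R⌋₊ ^ 2 with hD
  set lam := divCoeff p a with hlam
  have hsum : Summable fun m => if n₀ + m ≡ b [MOD W] ∧ (n₀ + m + h i).Prime then
      logWeight (J + 1) (n₀ + m + h i) else 0 := by
    have := summable_ite_logWeight (J + 1) (n₀ + h i) fun m =>
      n₀ + m ≡ b [MOD W] ∧ (n₀ + m + h i).Prime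
    simpa only [add_right_comm n₀ (h i)] using this
  have h1 : primeSum i J W n₀ b p h a = _ :=
    (tsum_mul_sieveForm_sq (p := p) hsum
      (fun m => by split_ifs; exacts [logWeight_nonneg _ _, le_rfl]) a
      fun m => pattern p h (n₀ + m)).tsum_eq
  have h2 : primeMean i p a = quadForm lam (primeDensity i p) :=
    primeMean_eq (fun l => (hP.prime l).one_lt) i a
  set E : (Fin n → Option (Fin k)) → ℝ := fun θ => 1 / W.totient * (∑ χ ∈ primitiveUpTo D,
    (if χ.1 ∣ modulus W p θ then invTotient p θ else 0) * ‖twistedSum J χ.2‖) +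
    2 * tinyMass J N with hE
  have hE0 : ∀ θ, 0 ≤ E θ := fun θ => by
    refine add_nonneg (mul_nonneg (by positivity) (Finset.sum_nonneg fun χ _ =>
      mul_nonneg ?_ (norm_nonneg _))) (mul_nonneg zero_le_two (tinyMass_nonneg J N))
    split_ifs
    exacts [hP.invTotient_nonneg θ, le_rfl]
  have hloc : ∀ δ ε, lam δ ≠ 0 → lam ε ≠ 0 →
      |(∑' m, (if n₀ + m ≡ b [MOD W] ∧ (n₀ + m + h i).Prime then
        logWeight (J + 1) (n₀ + m + h i) else 0) *
        if Below (merge δ ε) (pattern p h (n₀ + m)) then 1 else 0) -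
        totalMass J / W.totient * primeDensity i p (merge δ ε)| ≤ E (merge δ ε) := by
    intro δ ε h3 h4
    refine le_of_eq_of_le ?_ (abs_tsum_meets_sub_le hP hW hs hb hR hN hWN
      (hP.modulus_merge_le (not_lt.1 fun h5 => h3 (hsupp δ h5))
        (not_lt.1 fun h5 => h4 (hsupp ε h5))))
    congr 2
    refine tsum_congr fun m => ?_
    rw [mul_ite, mul_one, mul_zero, ← ite_and]
    exact if_congr (by rw [below_pattern_iff hs, and_comm]) rfl rfl
  have h3 := abs_quadForm_sub_le_of (lam := lam) (E := E)
    (M := fun θ => ∑' m, (if n₀ + m ≡ b [MOD W] ∧ (n₀ + m + h i).Prime then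
      logWeight (J + 1) (n₀ + m + h i) else 0) *
      if Below θ (pattern p h (n₀ + m)) then 1 else 0)
    (M' := primeDensity i p) (c := totalMass J / W.totient) hloc hE0
  rw [← h1, ← h2] at h3
  have h4 : ∑ δ, ∑ ε, |lam δ| * |lam ε| * E (merge δ ε) =
      2 * tinyMass J N * (∑ δ, |lam δ|) ^ 2 + 1 / W.totient * ∑ χ ∈ primitiveUpTo D,
        (∑ δ, ∑ ε, |lam δ| * |lam ε| *
          (if χ.1 ∣ modulus W p (merge δ ε) then invTotient p (merge δ ε) else 0)) *
          ‖twistedSum J χ.2‖ := by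
    have h5 : ∑ χ ∈ primitiveUpTo D, (∑ δ, ∑ ε, |lam δ| * |lam ε| *
        (if χ.1 ∣ modulus W p (merge δ ε) then invTotient p (merge δ ε) else 0)) *
        ‖twistedSum J χ.2‖ = ∑ δ, ∑ ε, |lam δ| * |lam ε| * ∑ χ ∈ primitiveUpTo D,
          (if χ.1 ∣ modulus W p (merge δ ε) then invTotient p (merge δ ε) else 0) *
            ‖twistedSum J χ.2‖ := by
      simp_rw [Finset.sum_mul, Finset.mul_sum]
      rw [Finset.sum_comm]
      refine Finset.sum_congr rfl fun δ _ => ?_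
      rw [Finset.sum_comm]
      exact Finset.sum_congr rfl fun ε _ => Finset.sum_congr rfl fun χ _ => by ring
    rw [h5, sq, Finset.sum_mul_sum]
    simp_rw [Finset.mul_sum (a := 1 / (W.totient : ℝ)), Finset.mul_sum (a := 2 * tinyMass J N),
      ← Finset.sum_add_distrib]
    exact Finset.sum_congr rfl fun δ _ => Finset.sum_congr rfl fun ε _ => by
      rw [hE]
      ring
  have h5 : ∑ χ ∈ primitiveUpTo D, (∑ δ, ∑ ε, |lam δ| * |lam ε| *
      (if χ.1 ∣ modulus W p (merge δ ε) then invTotient p (merge δ ε) else 0)) *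
      ‖twistedSum J χ.2‖ ≤ L ^ 2 * (√W * eulerProd p (2 * (((k : ℝ) + 1) ^ 2 - 1))) *
        ∑ χ ∈ primitiveUpTo D, (χ.1 : ℝ) ^ (-(1 / 2) : ℝ) * ‖twistedSum J χ.2‖ := by
    rw [Finset.mul_sum]
    refine Finset.sum_le_sum fun χ hχ => ?_
    rw [← mul_assoc]
    exact mul_le_mul_of_nonneg_right (sum_mul_invTotient_le hP hW hp hL
      (zero_lt_one.trans (mem_primitiveUpTo.1 hχ).1.1)) (norm_nonneg _)
  rw [h4] at h3
  have h6 := mul_le_mul_of_nonneg_left h5 (one_div_nonneg.2 (Nat.cast_nonneg (α := ℝ) W.totient))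
  have h7 := (abs_le.1 h3).1
  linarith

end TupleSieve

namespace TupleSieve

variable {k n W : ℕ} {R : ℝ} {p : Fin n → ℕ} {h : Fin k → ℕ}

/-- If no translate of `h` contains two primes, the prime sums are dominated by the integer sum. -/
theorem sum_primeSum_le_intSum {J n₀ b : ℕ}
    (hn₀ : Real.exp ((J + 1 : ℕ) / 2) ≤ n₀) (a : (Fin n → Option (Fin k)) → ℝ)
    (hno : ∀ m i j, (m + h i).Prime → (m + h j).Prime → i = j) :
    ∑ i, primeSum i J W n₀ b p h a ≤ intSum J W n₀ b p h a := by
  classical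
  have hanti := antitone_logWeight_add (J + 1) n₀ hn₀
  have hsI := (tsum_mul_sieveForm_sq (p := p)
    (summable_ite_logWeight (J + 1) n₀ fun m => n₀ + m ≡ b [MOD W])
    (fun m => by split_ifs; exacts [logWeight_nonneg _ _, le_rfl]) a
    fun m => pattern p h (n₀ + m)).summable
  have hsP : ∀ i, Summable fun m => (if n₀ + m ≡ b [MOD W] ∧ (n₀ + m + h i).Prime then
      logWeight (J + 1) (n₀ + m + h i) else 0) * sieveForm p a (pattern p h (n₀ + m)) ^ 2 :=
    fun i => by
      have := summable_ite_logWeight (J + 1) (n₀ + h i) fun m =>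
        n₀ + m ≡ b [MOD W] ∧ (n₀ + m + h i).Prime
      simp only [add_right_comm n₀ (h i)] at this
      exact (tsum_mul_sieveForm_sq (p := p) this
        (fun m => by split_ifs; exacts [logWeight_nonneg _ _, le_rfl]) a
        fun m => pattern p h (n₀ + m)).summable
  simp_rw [primeSum]
  rw [← Summable.tsum_finsetSum fun i _ => by convert hsP i, intSum]
  refine Summable.tsum_le_tsum (fun m => ?_)
    (by convert summable_sum fun i (_ : i ∈ Finset.univ) => hsP i) (by convert hsI)
  rw [← Finset.sum_mul]
  refine mul_le_mul_of_nonneg_right ?_ (sq_nonneg _)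
  by_cases hW : n₀ + m ≡ b [MOD W]
  · simp only [hW, true_and, if_true]
    by_cases hex : ∃ i, (n₀ + m + h i).Prime
    · obtain ⟨i, hi⟩ := hex
      rw [Finset.sum_eq_single i (fun j _ hj => if_neg fun hj' => hj (hno _ _ _ hj' hi))
        (by simp), if_pos hi]
      have := hanti (Nat.le_add_right m (h i))
      simpa only [add_assoc] using this
    · push Not at hex
      simp [hex, logWeight_nonneg]
  · simp [hW]

end TupleSieve

namespace TupleSieve

open Filter Topology

theorem exp_mul_pow_le {c x : ℝ} {J : ℕ} (hx : 0 ≤ x) (h : Real.exp c * x ≤ 9 / 10) :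
    Real.exp (c * J) * x ^ J ≤ (9 / 10) ^ J := by
  rw [mul_comm c, Real.exp_nat_mul, ← mul_pow]
  exact pow_le_pow_left₀ (by positivity) h J

theorem eventually_pow_mul_le (A : ℕ) (c : ℝ) :
    ∀ᶠ J : ℕ in atTop, c * ((J : ℝ) ^ A * (9 / 10) ^ J) ≤ 1 := by
  have h := (tendsto_pow_const_mul_const_pow_of_abs_lt_one A
    (by norm_num : |(9 / 10 : ℝ)| < 1)).const_mul c
  rw [mul_zero] at h
  exact h.eventually_le_const one_pos

/-- The error terms of the sieve are negligible for integers beyond `exp (J / 2 + 1)`. -/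
theorem eventually_error_le (A H : ℕ) : ∀ᶠ J : ℕ in atTop,
    logWeight (J + 1) ⌈Real.exp (J / 2 + 1)⌉₊ * ((J : ℝ) ^ A * Real.exp (J / 1000) ^ 2) ≤
      J.factorial ∧
    tinyMass J (⌈Real.exp (J / 2 + 1)⌉₊ + H) * ((J : ℝ) ^ A * Real.exp (J / 1000) ^ 2) ≤
      J.factorial := by
  obtain ⟨C, hC, htiny⟩ := exists_tinyMass_le
  set c : ℝ := H + 5 with hc
  have hc5 : 5 ≤ c := by rw [hc]; linarith [H.cast_nonneg (α := ℝ)]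
  filter_upwards [eventually_ge_atTop 1, eventually_pow_mul_le (A + 1) (c + 1),
    eventually_pow_mul_le (A + 1) (c * (c + 1) + C)] with J hJ h1 h2
  have hJ1 : (1 : ℝ) ≤ J := by exact_mod_cast hJ
  set n₀ := ⌈Real.exp (J / 2 + 1)⌉₊ with hn₀
  have hn₀1 : (1 : ℝ) ≤ n₀ := (Real.one_le_exp (by positivity)).trans (Nat.le_ceil _)
  have hn₀1' : 1 ≤ n₀ := by exact_mod_cast hn₀1
  have hfac : (0 : ℝ) < J.factorial := by exact_mod_cast J.factorial_pos
  have hexp1 : 1 ≤ Real.exp (J / 2) := Real.one_le_exp (by positivity)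
  have hN : ((n₀ + H : ℕ) : ℝ) ≤ c * Real.exp (J / 2) := by
    have h3 := (Nat.ceil_lt_add_one (Real.exp_pos (J / 2 + 1)).le).le
    rw [← hn₀, Real.exp_add] at h3
    have h4 := mul_le_mul_of_nonneg_left Real.exp_one_lt_three.le (Real.exp_pos (J / 2 : ℝ)).le
    push_cast
    rw [hc]
    nlinarith [H.cast_nonneg (α := ℝ)]
  have hlogN : Real.log (n₀ + H : ℕ) ≤ (c + 1) * J := by
    have h3 : (0 : ℝ) < (n₀ + H : ℕ) := by exact_mod_cast (by omega : 0 < n₀ + H)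
    have h4 := Real.log_le_log h3 hN
    rw [Real.log_mul (by positivity) (Real.exp_pos _).ne', Real.log_exp] at h4
    have h5 := Real.log_le_sub_one_of_pos (by positivity : 0 < c)
    nlinarith
  have hlogN0 : 0 ≤ Real.log (n₀ + H : ℕ) := Real.log_natCast_nonneg _
  have hlogn : Real.log n₀ ≤ (c + 1) * J :=
    (Real.log_le_log (by linarith) (by exact_mod_cast Nat.le_add_right n₀ H)).trans hlogN
  have hsq : Real.exp (J / 1000) ^ 2 = Real.exp (1 / 500 * J) := by
    rw [← Real.exp_nat_mul]
    congr 1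
    push_cast
    ring
  have he : Real.exp (1 / 500) ≤ 500 / 499 := by
    have h3 := Real.add_one_le_exp (-(1 / 500) : ℝ)
    rw [Real.exp_neg, le_inv_comm₀ (by norm_num) (Real.exp_pos _)] at h3
    exact h3.trans (by norm_num)
  have he2 : Real.exp (1 / 2) ≤ 1.65 := by
    rw [Real.exp_half, Real.sqrt_le_left (by norm_num)]
    exact Real.exp_one_lt_d9.le.trans (by norm_num)
  have h45 : Real.exp (1 / 500 * J) * (4 / 5) ^ J ≤ (9 / 10) ^ J :=
    exp_mul_pow_le (by norm_num) (by linarith)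
  have h12 : Real.exp (J / 2) * (Real.exp (1 / 500 * J) * (1 / 2) ^ J) ≤ (9 / 10) ^ J := by
    rw [← mul_assoc, ← Real.exp_add, show (J / 2 + 1 / 500 * J : ℝ) = (1 / 2 + 1 / 500) * J by ring]
    refine exp_mul_pow_le (by norm_num) ?_
    rw [Real.exp_add]
    nlinarith [Real.exp_pos (1 / 500), Real.exp_pos (1 / 2)]
  have hpow : (0 : ℝ) ≤ (J : ℝ) ^ A := by positivity
  rw [hsq]
  constructor
  · have h3 : logWeight J n₀ ≤ J.factorial * (4 / 5) ^ J := by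
      have h4 := logWeight_le_rpow J n₀ (by norm_num : (0 : ℝ) < 5 / 4) (by omega)
      rw [inv_div] at h4
      exact h4.trans (mul_le_of_le_one_right (by positivity)
        (Real.rpow_le_one_of_one_le_of_nonpos hn₀1 (by norm_num)))
    rw [← log_mul_logWeight]
    calc Real.log n₀ * logWeight J n₀ * ((J : ℝ) ^ A * Real.exp (1 / 500 * J))
        ≤ (c + 1) * J * (J.factorial * (4 / 5) ^ J) * ((J : ℝ) ^ A * Real.exp (1 / 500 * J)) := by
          refine mul_le_mul_of_nonneg_right ?_ (by positivity)
          exact mul_le_mul hlogn h3 (logWeight_nonneg _ _) (by positivity)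
      _ = J.factorial * ((c + 1) * ((J : ℝ) ^ (A + 1) *
          (Real.exp (1 / 500 * J) * (4 / 5) ^ J))) := by ring
      _ ≤ J.factorial * ((c + 1) * ((J : ℝ) ^ (A + 1) * (9 / 10) ^ J)) := by gcongr
      _ ≤ J.factorial := mul_le_of_le_one_right hfac.le h1
  · calc tinyMass J (n₀ + H) * ((J : ℝ) ^ A * Real.exp (1 / 500 * J))
        ≤ (J.factorial * ((c * Real.exp (J / 2)) * ((c + 1) * J) * (1 / 2) ^ J +
          C * J * (4 / 5) ^ J)) * ((J : ℝ) ^ A * Real.exp (1 / 500 * J)) := by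
          refine mul_le_mul_of_nonneg_right ((htiny J _ (by omega)).trans ?_) (by positivity)
          gcongr
          exact le_mul_of_one_le_right hC hJ1
      _ = J.factorial * ((J : ℝ) ^ (A + 1) * (c * (c + 1) *
          (Real.exp (J / 2) * (Real.exp (1 / 500 * J) * (1 / 2) ^ J)) +
          C * (Real.exp (1 / 500 * J) * (4 / 5) ^ J))) := by ring
      _ ≤ J.factorial * ((J : ℝ) ^ (A + 1) * (c * (c + 1) * (9 / 10) ^ J +
          C * (9 / 10) ^ J)) := by gcongr
      _ = J.factorial * ((c * (c + 1) + C) * ((J : ℝ) ^ (A + 1) * (9 / 10) ^ J)) := by ring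
      _ ≤ J.factorial := mul_le_of_le_one_right hfac.le h2

end TupleSieve

namespace TupleSieve

/-- The main terms of the sieve are incompatible with prime sums bounded by the integer sum. -/
theorem main_terms_incompatible {k : ℕ} (hk : 2 ≤ k) {γ m φ w f J i₁ Q T tot e₁ e₂ : ℝ}
    {P S : Fin k → ℝ} (hγ : 1 ≤ γ) (hφ : 0 < φ) (hw : 0 < w) (hf : 0 < f) (hJ : 1 ≤ J)
    (hi : 5000000000 ≤ i₁) (hm : i₁ * (φ / w) * (J / 1000) / 8192 * γ ≤ k * m ^ 2)
    (hP : ∀ i, γ ^ (k - 1) * m ^ 2 / 32 ≤ P i) (hQ : Q ≤ 2 * γ ^ k) (htot : f / 2 ≤ tot)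
    (hS : ∀ i, tot / φ * P i - e₂ ≤ S i) (hT : T ≤ 2 * ((J + 1) * f) / w * Q + e₁)
    (hST : ∑ i, S i ≤ T) (he : e₁ + k * e₂ ≤ J * f / w) : False := by
  have h1 : ∀ i, f / 2 / φ * (γ ^ (k - 1) * m ^ 2 / 32) - e₂ ≤ S i := fun i => by
    refine le_trans (sub_le_sub_right ?_ _) (hS i)
    exact mul_le_mul (div_le_div_of_nonneg_right htot hφ.le) (hP i) (by positivity)
      (div_nonneg (le_trans (by positivity) htot) hφ.le)
  have h2 : k * (f / 2 / φ * (γ ^ (k - 1) * m ^ 2 / 32) - e₂) ≤ ∑ i, S i := by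
    have := Finset.card_nsmul_le_sum Finset.univ S _ fun i _ => h1 i
    simpa [nsmul_eq_mul] using this
  have h3 : 2 * ((J + 1) * f) / w * Q ≤ 2 * ((J + 1) * f) / w * (2 * γ ^ k) :=
    mul_le_mul_of_nonneg_left hQ (by positivity)
  have h4 : f / 64 / φ * γ ^ (k - 1) * (i₁ * (φ / w) * (J / 1000) / 8192 * γ) ≤
      f / 64 / φ * γ ^ (k - 1) * (k * m ^ 2) := mul_le_mul_of_nonneg_left hm (by positivity)
  have h5 : γ ^ k = γ ^ (k - 1) * γ := by rw [← pow_succ, Nat.sub_add_cancel (by omega)]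
  set X := f / w * γ ^ k with hX
  have h6 : f / 64 / φ * γ ^ (k - 1) * (i₁ * (φ / w) * (J / 1000) / 8192 * γ) =
      i₁ * (J * X) / 524288000 := by
    rw [hX, h5]
    field_simp
    ring
  have h7 : 2 * ((J + 1) * f) / w * (2 * γ ^ k) = 4 * (J * X) + 4 * X := by
    rw [hX]
    ring
  have h8 : J * f / w ≤ J * X := by
    rw [hX, mul_div_assoc]
    exact mul_le_mul_of_nonneg_left (le_mul_of_one_le_right (by positivity) (one_le_pow₀ hγ))
      (by linarith)
  have hX0 : 0 < X := by positivity
  have h9 : 5000000000 * (J * X) ≤ i₁ * (J * X) := mul_le_mul_of_nonneg_right hi (by positivity)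
  have h10 : X ≤ J * X := le_mul_of_one_le_left hX0.le hJ
  have h11 : 0 < J * X := by positivity
  rw [h6] at h4
  rw [h7] at h3
  have h12 : k * (f / 2 / φ * (γ ^ (k - 1) * m ^ 2 / 32) - e₂) =
      f / 64 / φ * γ ^ (k - 1) * (k * m ^ 2) - k * e₂ := by ring
  linarith

theorem exists_forall_coprime_primorial {k D : ℕ} {h : Fin k → ℕ}
    (hdvd : ∀ i, k.factorial ∣ h i) : ∃ b, ∀ i, (b + h i).Coprime (primorial D) := by
  have hloc : ∀ q : ℕ, q.Prime → ∃ c, ∀ i, ¬ q ∣ c + h i := fun q hq => by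
    by_cases hqk : q ≤ k
    · refine ⟨1, fun i hi => hq.one_lt.ne' (Nat.dvd_one.1 ?_)⟩
      exact (Nat.dvd_add_left ((hq.dvd_factorial.2 hqk).trans (hdvd i))).1 hi
    · have : Fact q.Prime := ⟨hq⟩
      have hns : ¬ Function.Surjective fun i : Fin k => -(h i : ZMod q) := fun hsur => by
        have := Fintype.card_le_of_surjective _ hsur
        rw [ZMod.card, Fintype.card_fin] at this
        omega
      rw [Function.Surjective] at hns
      push Not at hns
      obtain ⟨z, hz⟩ := hns
      refine ⟨z.val, fun i hi => hz i ?_⟩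
      rw [← ZMod.natCast_eq_zero_iff] at hi
      push_cast at hi
      rw [ZMod.natCast_zmod_val] at hi
      exact (eq_neg_of_add_eq_zero_left hi).symm
  choose! c hc using hloc
  obtain ⟨b, hb⟩ := Nat.chineseRemainderOfFinset c id
    ((Finset.range (D + 1)).filter Nat.Prime) (fun q hq => (Finset.mem_filter.1 hq).2.ne_zero)
    fun q hq q' hq' hne => (Nat.coprime_primes (Finset.mem_filter.1 hq).2
      (Finset.mem_filter.1 hq').2).2 hne
  refine ⟨b, fun i => Nat.Coprime.prod_right fun q hq => ?_⟩
  have hqp := (Finset.mem_filter.1 hq).2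
  refine (Nat.Coprime.symm ((Nat.Prime.coprime_iff_not_dvd hqp).2 fun hd => hc q hqp i ?_))
  exact (((hb q hq).add_right (h i)).dvd_iff dvd_rfl).1 hd

theorem exists_parameters (M : ℕ) :
    ∃ I k : ℕ, 2 ≤ k ∧ 128 * k * (I + 1) = 2 ^ (I + 1) ∧ M ≤ I + 1 := by
  obtain ⟨e, he, heM⟩ : ∃ e : ℕ, 8 ≤ e ∧ M ≤ e := ⟨M + 8, by omega, by omega⟩
  have h1 : e < 2 ^ e := Nat.lt_two_pow_self
  have h2 : e + 8 ≤ 2 ^ e := by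
    obtain ⟨d, rfl⟩ : ∃ d, e = d + 1 := ⟨e - 1, by omega⟩
    have := Nat.lt_two_pow_self (n := d)
    rw [pow_succ]
    omega
  refine ⟨2 ^ e - 1, 2 ^ (2 ^ e - e - 7), ?_, ?_, by omega⟩
  · exact Nat.le_self_pow (by omega) 2
  · rw [Nat.sub_add_cancel (by omega), show 128 = 2 ^ 7 by norm_num, ← pow_add, ← pow_add]
    congr 1
    omega

end TupleSieve

namespace TupleSieve

open DirichletCharacter Filter Topology

variable {k n W : ℕ} {R : ℝ} {p : Fin n → ℕ}

theorem four_pow_eq (k : ℕ) : (4 : ℝ) ^ k = (2 ^ k) ^ 2 := by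
  rw [← pow_mul, mul_comm, pow_mul]
  norm_num

theorem PrimeList.eulerProd_le_pow (hP : PrimeList W R p) {J : ℕ} (hJ : 2 ≤ J)
    (hR : R = Real.exp (J / 1000)) (K : ℕ) : eulerProd p K ≤ (J : ℝ) ^ (3 * K) := by
  have hJ' : (2 : ℝ) ≤ J := by exact_mod_cast hJ
  refine (hP.eulerProd_le (by rw [hR, Real.one_lt_exp_iff]; positivity) K).trans ?_
  rw [hR, Real.log_exp]
  exact pow_le_pow_left₀ (by positivity) (by linarith) _

theorem PrimeList.sum_abs_divCoeff_sq_le (hP : PrimeList W R p) {J : ℕ} (hJ : 2 ≤ J)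
    (hJk : (4 : ℝ) ^ k ≤ J) (hR : R = Real.exp (J / 1000)) {G : Finset (Fin n) → ℝ}
    (hG : ∀ A, 0 ≤ G A) (hG2 : ∀ A, G A ≤ 2) :
    (∑ δ, |divCoeff (k := k) p (coeff p G R) δ|) ^ 2 ≤
      (J : ℝ) ^ (12 * k + 1) * Real.exp (J / 1000) ^ 2 := by
  have hR0 : 0 ≤ R := hR ▸ (Real.exp_pos _).le
  have hE0 : 0 ≤ eulerProd p k := Finset.prod_nonneg fun l _ => by positivity
  calc (∑ δ, |divCoeff (k := k) p (coeff p G R) δ|) ^ 2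
      ≤ (2 ^ k * ((J : ℝ) ^ (3 * k)) ^ 2 * R) ^ 2 := by
        refine pow_le_pow_left₀ (Finset.sum_nonneg fun δ _ => abs_nonneg _)
          ((sum_abs_divCoeff_le (fun l => (hP.prime l).pos) hG hG2 hR0).trans ?_) 2
        exact mul_le_mul_of_nonneg_right (mul_le_mul_of_nonneg_left
          (pow_le_pow_left₀ hE0 (hP.eulerProd_le_pow hJ hR k) 2) (by positivity)) hR0
    _ = (4 : ℝ) ^ k * ((J : ℝ) ^ (12 * k) * R ^ 2) := by
        rw [four_pow_eq]
        ring
    _ ≤ J * ((J : ℝ) ^ (12 * k) * R ^ 2) := mul_le_mul_of_nonneg_right hJk (by positivity)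
    _ = (J : ℝ) ^ (12 * k + 1) * Real.exp (J / 1000) ^ 2 := by
        rw [hR]
        ring

theorem PrimeList.character_error_le (hP : PrimeList W R p) {J : ℕ} (hJ : 2 ≤ J)
    (hR : R = Real.exp (J / 1000)) {Z : ℝ}
    (hZ : Z ≤ J.factorial / (J : ℝ) ^ (6 * k + 3 * (2 * k ^ 2 + 4 * k))) :
    (2 ^ k * eulerProd p k) ^ 2 * (√W * eulerProd p (2 * (((k : ℝ) + 1) ^ 2 - 1))) * Z ≤
      4 ^ k * √W * J.factorial := by
  have hE0 : ∀ K : ℕ, 0 ≤ eulerProd p K := fun K => Finset.prod_nonneg fun l _ => by positivity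
  have hJ0 : (0 : ℝ) < J := by exact_mod_cast (by omega : 0 < J)
  have hK : 2 * (((k : ℝ) + 1) ^ 2 - 1) = (2 * k ^ 2 + 4 * k : ℕ) := by
    push_cast
    ring
  rw [hK, mul_assoc]
  calc (2 ^ k * eulerProd p k) ^ 2 * (√W * eulerProd p (2 * k ^ 2 + 4 * k : ℕ) * Z)
      ≤ (2 ^ k * eulerProd p k) ^ 2 * (√W * eulerProd p (2 * k ^ 2 + 4 * k : ℕ) *
        (J.factorial / (J : ℝ) ^ (6 * k + 3 * (2 * k ^ 2 + 4 * k)))) :=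
        mul_le_mul_of_nonneg_left (mul_le_mul_of_nonneg_left hZ
          (mul_nonneg (Real.sqrt_nonneg _) (hE0 _))) (sq_nonneg _)
    _ ≤ (2 ^ k * (J : ℝ) ^ (3 * k)) ^ 2 * (√W * (J : ℝ) ^ (3 * (2 * k ^ 2 + 4 * k)) *
        (J.factorial / (J : ℝ) ^ (6 * k + 3 * (2 * k ^ 2 + 4 * k)))) := by
        have h1 := hP.eulerProd_le_pow hJ hR k
        have h2 := hP.eulerProd_le_pow hJ hR (2 * k ^ 2 + 4 * k)
        have := hE0 k
        have := hE0 (2 * k ^ 2 + 4 * k)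
        gcongr
    _ = 4 ^ k * √W * J.factorial := by
        rw [four_pow_eq]
        field_simp
        ring

theorem tupleProperty_of_parameters {I : ℕ} (hk : 2 ≤ k) (hI : 128 * k * (I + 1) = 2 ^ (I + 1))
    (hbig : 5000000000 ≤ I + 1) : TupleProperty k := by
  intro h hmono hdvd
  by_contra hnone
  have hno : ∀ m i j, (m + h i).Prime → (m + h j).Prime → i = j := fun m i j hi hj => by
    rcases lt_trichotomy i j with hij | hij | hij
    · exact absurd ⟨i, j, hij, m + h j, m + h i, hj, hi, by omega⟩ hnone
    · exact hij
    · exact absurd ⟨j, i, hij, m + h i, m + h j, hi, hj, by omega⟩ hnone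
  set H := ∑ i, h i with hH
  have hhH : ∀ i, h i ≤ H := fun i =>
    Finset.single_le_sum (f := h) (fun _ _ => Nat.zero_le _) (Finset.mem_univ i)
  set D := H + 8 * k ^ 2 + (2 * k ^ 2 + 4 * k) ^ 2 with hD
  set W := primorial D with hWdef
  have hW : 0 < W := primorial_pos D
  have hWD : ∀ q : ℕ, q.Prime → q ≤ D → q ∣ W := fun q hq hqD =>
    Finset.dvd_prod_of_mem _ (Finset.mem_filter.2 ⟨Finset.mem_range.2 (by omega), hq⟩)
  obtain ⟨b, hb⟩ := exists_forall_coprime_primorial (D := D) hdvd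
  have hR : Tendsto (fun J : ℕ => Real.exp (J / 1000 : ℝ)) atTop atTop :=
    Real.tendsto_exp_atTop.comp
      ((tendsto_natCast_atTop_atTop (R := ℝ)).atTop_div_const (by norm_num))
  have hlarge := (tendsto_natCast_atTop_atTop (R := ℝ)).eventually_ge_atTop
    (4 ^ k + W * (1 + k * (2 + 4 ^ k * √W)))
  obtain ⟨J, hchar, hmass, hadm, ⟨herr1, herr2⟩, hlarge, hJ⟩ :=
    ((frequently_sum_norm_twistedSum_le (6 * k + 3 * (2 * k ^ 2 + 4 * k)) W hW).and_eventually
      (eventually_le_tsum_vonMangoldt.and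
        ((hR.eventually (eventually_admissible (D := D) hk hI (by omega) hW hWD)).and
          ((eventually_error_le (12 * k + 1) (H + W + 1)).and
            (hlarge.and (eventually_ge_atTop 2)))))).exists
  set R := Real.exp (J / 1000 : ℝ) with hRdef
  obtain ⟨n, p, hP⟩ := exists_primeList W (Real.exp_pos (J / 1000 : ℝ)).le
  obtain ⟨hA, hγ, hratio⟩ := hadm n p hP
  set G : Finset (Fin n) → ℝ := fun A => levelWeight I R (modProd p A) with hG
  set n₀ := ⌈Real.exp (J / 2 + 1 : ℝ)⌉₊ with hn₀
  have hJ' : (2 : ℝ) ≤ J := by exact_mod_cast hJ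
  have hn₀le : Real.exp (J / 2 + 1) ≤ n₀ := Nat.le_ceil _
  have hn₀1 : Real.exp ((J + 1 : ℕ) / 2) ≤ n₀ := by
    refine (Real.exp_le_exp.2 ?_).trans hn₀le
    push_cast
    linarith
  have hRn₀ : R < n₀ := (Real.exp_lt_exp.2 (by linarith)).trans_le hn₀le
  have hpD : ∀ l, D < p l := fun l => by
    by_contra hl
    exact hP.not_dvd l (hWD _ (hP.prime l) (not_lt.1 hl))
  have hs : Separates p h := separates_of_lt hmono.injective fun l j => by
    have := hhH j
    have := hpD l
    omega
  have hpK : ∀ l, (2 * (((k : ℝ) + 1) ^ 2 - 1)) ^ 2 ≤ p l := fun l => by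
    have h1 : (2 * k ^ 2 + 4 * k) ^ 2 ≤ p l := by
      have := hpD l
      omega
    have h2 : (((2 * k ^ 2 + 4 * k) ^ 2 : ℕ) : ℝ) ≤ p l := by exact_mod_cast h1
    refine le_of_eq_of_le ?_ h2
    push_cast
    ring
  have hpos : ∀ l, 0 < p l := fun l => (hP.prime l).pos
  have hG0 : ∀ A, 0 ≤ G A := fun A => levelWeight_nonneg _ _ _
  have hG2 : ∀ A, G A ≤ 2 := fun A => levelWeight_le_two _ _ _
  have hf : (0 : ℝ) < J.factorial := by exact_mod_cast J.factorial_pos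
  have hW' : (0 : ℝ) < W := by exact_mod_cast hW
  have hφ : (1 : ℝ) ≤ W.totient := by exact_mod_cast Nat.totient_pos.2 hW
  have h4 : (0 : ℝ) ≤ 4 ^ k := by positivity
  have hconst : (0 : ℝ) ≤ W * (1 + k * (2 + 4 ^ k * √W)) := by positivity
  set S2 := (∑ δ, |divCoeff (k := k) p (coeff p G R) δ|) ^ 2 with hS2
  have hSle := hP.sum_abs_divCoeff_sq_le (k := k) hJ (by linarith) rfl hG0 hG2
  set e₁ := logWeight (J + 1) n₀ * S2 with he₁
  set N := n₀ + (H + W + 1) with hN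
  set Z := ∑ χ ∈ primitiveUpTo (W * ⌊R⌋₊ ^ 2),
    (χ.1 : ℝ) ^ (-(1 / 2) : ℝ) * ‖twistedSum J χ.2‖ with hZ
  set X := (2 ^ k * eulerProd p k) ^ 2 *
    (√W * eulerProd p (2 * (((k : ℝ) + 1) ^ 2 - 1))) * Z with hX
  have hX1 : X ≤ 4 ^ k * √W * J.factorial := hP.character_error_le hJ rfl hchar
  have he₁le : e₁ ≤ J.factorial :=
    (mul_le_mul_of_nonneg_left hSle (logWeight_nonneg _ _)).trans herr1
  have he₂le : 2 * tinyMass J N * S2 + 1 / W.totient * X ≤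
      (2 + 4 ^ k * √W) * J.factorial := by
    have h1 := (mul_le_mul_of_nonneg_left hSle (tinyMass_nonneg J N)).trans herr2
    have h2 : 1 / (W.totient : ℝ) * X ≤ 4 ^ k * √W * J.factorial := by
      rw [one_div_mul_eq_div]
      exact (div_le_div_of_nonneg_right hX1 (by linarith)).trans
        (div_le_self (by positivity) hφ)
    linarith
  refine main_terms_incompatible (J := J) (f := J.factorial) (i₁ := (I + 1 : ℕ))
    (tot := totalMass J) (e₁ := e₁) (e₂ := 2 * tinyMass J N * S2 + 1 / W.totient * X) hk hγ
    (by linarith : (0 : ℝ) < W.totient) hW' hf (by linarith) (by exact_mod_cast hbig) ?_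
    (fun i => hA.le_primeMean hk i) (hA.intMean_le (by omega))
    hmass (fun i => ?_)
    (T := intSum J W n₀ b p h (coeff p G R)) ?_
    (sum_primeSum_le_intSum hn₀1 (coeff p G R) hno) ?_
  · rw [hRdef, Real.log_exp] at hratio
    push_cast
    exact hratio
  · have h1 := le_primeSum (i := i) (J := J) (N := N) (a := coeff p G R) hP hW hs (hb i) hRn₀
      (by have := hhH i; omega) (by omega) hpK (abs_divCoeff_le hpos hG0 hG2)
      (fun δ hδ => divCoeff_eq_zero hpos hδ)
    exact h1
  · have h1 := intSum_le (J := J) (b := b) hP hW hs (fun l => by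
      have := hA.two_mul_le l
      omega) hn₀1 (coeff p G R)
    rw [Nat.factorial_succ] at h1
    push_cast at h1 ⊢
    exact h1
  · have h1 : k * (2 * tinyMass J N * S2 + 1 / W.totient * X) ≤
        k * ((2 + 4 ^ k * √W) * J.factorial) :=
      mul_le_mul_of_nonneg_left he₂le (Nat.cast_nonneg k)
    rw [le_div_iff₀ hW']
    have h2 : (e₁ + k * (2 * tinyMass J N * S2 + 1 / W.totient * X)) * W ≤
        (J.factorial + k * ((2 + 4 ^ k * √W) * J.factorial)) * W :=
      mul_le_mul_of_nonneg_right (add_le_add he₁le h1) hW'.le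
    refine h2.trans ?_
    have h3 : (W * (1 + k * (2 + 4 ^ k * √W))) * (J.factorial : ℝ) ≤ J * J.factorial :=
      mul_le_mul_of_nonneg_right (by linarith) hf.le
    linarith

theorem exists_tupleProperty : ∃ k, 2 ≤ k ∧ TupleProperty k := by
  obtain ⟨I, k, hk, hI, hbig⟩ := exists_parameters 5000000000
  exact ⟨k, hk, tupleProperty_of_parameters hk hI hbig⟩

end TupleSieve

/-- There is a constant `C₀` such that for every `C > C₀`, a positive proportion of the
even numbers in the interval `[x, x + (log x)^C]` are differences of two primes, for all
sufficiently large `x`: at least `c · (log x)^C` even integers in that interval are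
Maillet numbers, for a fixed `c > 0`. -/
theorem positive_proportion_even_maillet :
    ∃ C₀ : ℝ, ∀ C : ℝ, C₀ < C →
      ∃ c : ℝ, 0 < c ∧ ∃ x₀ : ℝ, ∀ x : ℝ, x₀ < x →
        c * (Real.log x) ^ C ≤
          ({m : ℕ | x ≤ (m : ℝ) ∧ (m : ℝ) ≤ x + (Real.log x) ^ C ∧ Even m ∧
            IsMaillet m}.ncard : ℝ) := by
  obtain ⟨k, hk, hT⟩ := TupleSieve.exists_tupleProperty
  exact hT.positive_proportion hk
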